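/- Let n ≥ 1 and 1 ≤ m ≤ n. Let U be a connected open neighborhood of 0 in ℝⁿ. Let X₁, …, X_m : U → ℝⁿ be real analytic vector fields with X₁(0) = 0 which commute pairwise, i.e. [X_i, X_j](x) = 0 for all x ∈ U and all i, j, and let f₁, …, f_{n−m} : U → ℝ be real analytic functions which are common first integrals, i.e. Df_j(x)(X_i(x)) = 0 for all x ∈ U, all i = 1,…,m and j = 1,…,n−m. Assume there exists a point x ∈ U at which the vectors X₁(x), …, X_m(x) are linearly independent over ℝ, and there exists a point x ∈ U at which the continuous linear functionals Df₁(x), …, Df_{n−m}(x) are linearly independent over ℝ. Then X₁ admits a convergent Poincaré–Dulac normalization (over ℝ). -/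

import Mathlib

/-- `Y` is in Poincaré–Dulac normal form on the neighborhood `U` of `0`:
writing the Jordan–Chevalley decomposition `DY(0) = S + N` with `S` semisimple,
`N` nilpotent and `S ∘ N = N ∘ S`, the Lie bracket `[Y, Yˢ]` (where `Yˢ x = S x`)
vanishes on `U`. -/
def InPDNormalForm (𝕂 : Type*) [NontriviallyNormedField 𝕂] {n : ℕ}
    (Y : (Fin n → 𝕂) → (Fin n → 𝕂)) (U : Set (Fin n → 𝕂)) : Prop :=
  ∃ S N : (Fin n → 𝕂) →L[𝕂] (Fin n → 𝕂),
    fderiv 𝕂 Y 0 = S + N ∧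
    Module.End.IsSemisimple (S : Module.End 𝕂 (Fin n → 𝕂)) ∧
    IsNilpotent (N : Module.End 𝕂 (Fin n → 𝕂)) ∧
    S ∘L N = N ∘L S ∧
    ∀ x ∈ U, VectorField.lieBracket 𝕂 Y (fun y => S y) x = 0

/-- `X` admits a convergent Poincaré–Dulac normalization: there are an analytic
vector field `Y` near `0`, in Poincaré–Dulac normal form with `Y 0 = 0`, and an
analytic map `φ` near `0` with `φ 0 = 0` and `Dφ(0)` invertible, such that
`Dφ(x) (Y x) = X (φ x)` for all `x` near `0`. -/
def AdmitsPDNormalization (𝕂 : Type*) [NontriviallyNormedField 𝕂] {n : ℕ}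
    (X : (Fin n → 𝕂) → (Fin n → 𝕂)) : Prop :=
  ∃ (V : Set (Fin n → 𝕂)) (Y φ : (Fin n → 𝕂) → (Fin n → 𝕂)),
    IsOpen V ∧ (0 : Fin n → 𝕂) ∈ V ∧
    AnalyticOnNhd 𝕂 Y V ∧ AnalyticOnNhd 𝕂 φ V ∧
    Y 0 = 0 ∧ φ 0 = 0 ∧ Function.Bijective (fderiv 𝕂 φ 0) ∧
    InPDNormalForm 𝕂 Y V ∧
    ∀ x ∈ V, fderiv 𝕂 φ x (Y x) = X (φ x)

namespace PoincareDulac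

set_option linter.unusedSectionVars false

open MvPowerSeries Topology

section LowIdeal

variable {σ R : Type*} [CommRing R]

/-- The ideal of power series all of whose coefficients of degree `< d` vanish. -/
def lowIdeal (σ R : Type*) [CommRing R] (d : ℕ) : Ideal (MvPowerSeries σ R) where
  carrier := {g | (d : ℕ∞) ≤ g.order}
  add_mem' := fun {_ _} ha hb => le_trans (le_min ha hb) min_order_le_add
  zero_mem' := by simp
  smul_mem' := fun c x hx => by
    simp only [smul_eq_mul, Set.mem_ofPred_eq] at hx ⊢
    exact le_trans hx (le_trans le_add_self le_order_mul)

theorem mem_lowIdeal {d : ℕ} {g : MvPowerSeries σ R} :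
    g ∈ lowIdeal σ R d ↔ ∀ α : σ →₀ ℕ, α.degree < d → coeff α g = 0 := by
  constructor
  · intro h α hα
    exact coeff_of_lt_order (lt_of_lt_of_le (by exact_mod_cast hα) h)
  · intro h
    exact nat_le_order h

theorem mem_lowIdeal_iff_order {d : ℕ} {g : MvPowerSeries σ R} :
    g ∈ lowIdeal σ R d ↔ (d : ℕ∞) ≤ g.order := Iff.rfl

theorem lowIdeal_zero (g : MvPowerSeries σ R) : g ∈ lowIdeal σ R 0 :=
  mem_lowIdeal.2 fun _ h => absurd h (Nat.not_lt_zero _)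

theorem lowIdeal_mono {d e : ℕ} (h : d ≤ e) {g : MvPowerSeries σ R}
    (hg : g ∈ lowIdeal σ R e) : g ∈ lowIdeal σ R d :=
  mem_lowIdeal.2 fun α hα => mem_lowIdeal.1 hg α (lt_of_lt_of_le hα h)

theorem mul_mem_lowIdeal {d e : ℕ} {g h : MvPowerSeries σ R}
    (hg : g ∈ lowIdeal σ R d) (hh : h ∈ lowIdeal σ R e) : g * h ∈ lowIdeal σ R (d + e) := by
  rw [mem_lowIdeal_iff_order] at *
  push_cast
  exact le_trans (add_le_add hg hh) le_order_mul

theorem eq_zero_of_forall_mem_lowIdeal {g : MvPowerSeries σ R}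
    (h : ∀ d, g ∈ lowIdeal σ R d) : g = 0 := by
  ext α
  simpa using mem_lowIdeal.1 (h (α.degree + 1)) α (Nat.lt_succ_self _)

theorem mem_lowIdeal_one {g : MvPowerSeries σ R} :
    g ∈ lowIdeal σ R 1 ↔ constantCoeff g = 0 := by
  rw [mem_lowIdeal]
  constructor
  · intro h
    simpa using h 0 (by simp)
  · intro h α hα
    have : α = 0 := by
      rw [← Finsupp.degree_eq_zero_iff]; omega
    subst this
    simpa using h

theorem X_mem_lowIdeal (i : σ) : (X i : MvPowerSeries σ R) ∈ lowIdeal σ R 1 := by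
  rw [mem_lowIdeal_one]; simp

theorem pderiv_mem_lowIdeal {d : ℕ} {g : MvPowerSeries σ R} (i : σ)
    (hg : g ∈ lowIdeal σ R (d + 1)) : pderiv R i g ∈ lowIdeal σ R d := by
  rw [mem_lowIdeal] at *
  intro α hα
  rw [coeff_pderiv, hg _ (by simpa using hα), zero_mul]

theorem powerSeries_mem_lowIdeal {d : ℕ} {g : PowerSeries R} :
    g ∈ lowIdeal Unit R d ↔ (PowerSeries.X : PowerSeries R) ^ d ∣ g := by
  rw [PowerSeries.X_pow_dvd_iff, mem_lowIdeal]
  constructor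
  · intro h m hm
    exact h (Finsupp.single () m) (by simpa using hm)
  · intro h α hα
    have : α = Finsupp.single () (α ()) := by ext; simp
    rw [this] at hα ⊢
    exact h _ (by simpa using hα)

end LowIdeal

section Hadamard

variable {σ R : Type*} [CommRing R]

/-- The part of `g` supported on monomials on which `p` selects the variable `j`,
divided by that variable. -/
noncomputable def hadamardQuot (p : (σ →₀ ℕ) → Option σ) (g : MvPowerSeries σ R) (j : σ) :
    MvPowerSeries σ R :=
  open Classical in
  fun α => if p (α + Finsupp.single j 1) = some j then coeff (α + Finsupp.single j 1) g else 0

theorem coeff_hadamardQuot (p : (σ →₀ ℕ) → Option σ) (g : MvPowerSeries σ R) (j : σ)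
    (α : σ →₀ ℕ) [DecidableEq σ] :
    coeff α (hadamardQuot p g j) =
      if p (α + Finsupp.single j 1) = some j then coeff (α + Finsupp.single j 1) g else 0 := by
  change hadamardQuot p g j α = _
  unfold hadamardQuot
  congr

/-- The part of `g` on monomials on which `p` selects no variable. -/
noncomputable def hadamardRest (p : (σ →₀ ℕ) → Option σ) (g : MvPowerSeries σ R) :
    MvPowerSeries σ R :=
  fun α => if p α = none then coeff α g else 0

theorem coeff_hadamardRest (p : (σ →₀ ℕ) → Option σ) (g : MvPowerSeries σ R) (α : σ →₀ ℕ) :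
    coeff α (hadamardRest p g) = if p α = none then coeff α g else 0 := rfl

theorem coeff_X_mul_eq [DecidableEq σ] (i : σ) (g : MvPowerSeries σ R) (α : σ →₀ ℕ) :
    coeff α (X i * g) = if α i = 0 then 0 else coeff (α - Finsupp.single i 1) g := by
  rw [X, coeff_monomial_mul]
  by_cases h : α i = 0
  · rw [if_pos h, if_neg]
    intro hle
    have := hle i
    simp [h] at this
  · rw [if_neg h, if_pos, one_mul]
    intro j
    by_cases hj : j = i
    · subst hj; simp; omega
    · simp [Ne.symm hj]

theorem hadamard_decomp [Fintype σ] (p : (σ →₀ ℕ) → Option σ)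
    (hp : ∀ α j, p α = some j → α j ≠ 0) (g : MvPowerSeries σ R) :
    g = hadamardRest p g + ∑ j, X j * hadamardQuot p g j := by
  classical
  ext α
  rw [map_add, map_sum, coeff_hadamardRest]
  simp_rw [coeff_X_mul_eq, coeff_hadamardQuot]
  have key : ∀ j, (if α j = 0 then (0 : R) else
      if p (α - Finsupp.single j 1 + Finsupp.single j 1) = some j then
        coeff (α - Finsupp.single j 1 + Finsupp.single j 1) g else 0)
      = if p α = some j then coeff α g else 0 := by
    intro j
    by_cases h : α j = 0
    · rw [if_pos h, if_neg]
      intro h'; exact hp _ _ h' h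
    · rw [if_neg h, tsub_add_cancel_of_le]
      intro i
      by_cases hj : i = j
      · subst hj; simp; omega
      · simp [Ne.symm hj]
  simp_rw [key]
  cases hpa : p α with
  | none => simp
  | some j => simp

theorem hadamardQuot_mem_lowIdeal (p : (σ →₀ ℕ) → Option σ) {g : MvPowerSeries σ R} {d : ℕ}
    (hg : g ∈ lowIdeal σ R (d + 1)) (j : σ) : hadamardQuot p g j ∈ lowIdeal σ R d := by
  classical
  rw [mem_lowIdeal] at *
  intro α hα
  rw [coeff_hadamardQuot, hg _ (by simpa using hα), ite_self]

/-- Select some variable occurring in a monomial. -/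
noncomputable def pickVar (α : σ →₀ ℕ) : Option σ :=
  open Classical in if h : ∃ j, α j ≠ 0 then some h.choose else none

theorem pickVar_spec (α : σ →₀ ℕ) (j : σ) (h : pickVar α = some j) : α j ≠ 0 := by
  unfold pickVar at h
  split_ifs at h with h'
  have := h'.choose_spec
  simp only [Option.some.injEq] at h
  rwa [h] at this

theorem hadamardRest_pickVar (g : MvPowerSeries σ R) :
    hadamardRest pickVar g = C (constantCoeff g) := by
  classical
  ext α
  rw [coeff_hadamardRest, coeff_C]
  by_cases h : α = 0
  · subst h; simp [pickVar]
  · have : ∃ j, α j ≠ 0 := by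
      by_contra hcon; push Not at hcon; exact h (Finsupp.ext hcon)
    simp [pickVar, this, h]

theorem hadamard [Fintype σ] (g : MvPowerSeries σ R) :
    g = C (constantCoeff g) + ∑ j, X j * hadamardQuot pickVar g j := by
  conv_lhs => rw [hadamard_decomp pickVar pickVar_spec g, hadamardRest_pickVar]

theorem hadamard_of_mem [Fintype σ] {g : MvPowerSeries σ R} {d : ℕ}
    (hg : g ∈ lowIdeal σ R (d + 1)) :
    g = ∑ j, X j * hadamardQuot pickVar g j := by
  conv_lhs => rw [hadamard g, mem_lowIdeal_one.1 (lowIdeal_mono (Nat.le_add_left 1 d) hg)]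
  simp

/-- An additive operator which is determined by the Hadamard decomposition vanishes. -/
theorem eq_zero_of_hadamard [Finite σ] {τ S : Type*} [CommRing S]
    (Δ : MvPowerSeries σ R →+ MvPowerSeries τ S) (a : σ → MvPowerSeries τ S)
    (ha : ∀ i, a i ∈ lowIdeal τ S 1) (hC : ∀ c, Δ (C c) = 0)
    (hX : ∀ i g, Δ (X i * g) = a i * Δ g) (g : MvPowerSeries σ R) : Δ g = 0 := by
  have := Fintype.ofFinite σ
  refine eq_zero_of_forall_mem_lowIdeal fun d => ?_
  induction d generalizing g with
  | zero => exact lowIdeal_zero _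
  | succ d ih =>
    rw [hadamard g, map_add, hC, zero_add, map_sum]
    refine Ideal.sum_mem _ fun j _ => ?_
    rw [hX, add_comm]
    exact mul_mem_lowIdeal (ha j) (ih _)

theorem ringHom_mem_lowIdeal [Finite σ] {τ S : Type*} [CommRing S]
    (φ : MvPowerSeries σ R →+* MvPowerSeries τ S)
    (hφ : ∀ i, φ (X i) ∈ lowIdeal τ S 1) {d : ℕ} {g : MvPowerSeries σ R}
    (hg : g ∈ lowIdeal σ R d) : φ g ∈ lowIdeal τ S d := by
  have := Fintype.ofFinite σ
  induction d generalizing g with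
  | zero => exact lowIdeal_zero _
  | succ d ih =>
    rw [hadamard_of_mem hg, map_sum]
    refine Ideal.sum_mem _ fun j _ => ?_
    rw [map_mul, add_comm]
    exact mul_mem_lowIdeal (hφ j) (ih (hadamardQuot_mem_lowIdeal _ hg j))

theorem algHom_ext_X [Finite σ] {τ S : Type*} [CommRing S] [Algebra R S]
    (φ ψ : MvPowerSeries σ R →ₐ[R] MvPowerSeries τ S)
    (hφ : ∀ i, φ (X i) ∈ lowIdeal τ S 1) (h : ∀ i, φ (X i) = ψ (X i)) : φ = ψ := by
  ext1 g
  rw [← sub_eq_zero]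
  refine eq_zero_of_hadamard ((φ : _ →+ _) - (ψ : _ →+ _)) (fun i => φ (X i)) hφ ?_ ?_ g
  · intro c
    have h1 : φ (C c) = ψ (C c) := by
      have : (C c : MvPowerSeries σ R) = algebraMap R _ c := rfl
      rw [this, φ.commutes, ψ.commutes]
    simp [h1]
  · intro i g
    simp [h i, mul_sub]

theorem derivAlong_eq_zero [Finite σ] {τ S : Type*} [CommRing S] [Algebra R S]
    (φ : MvPowerSeries σ R →ₐ[R] MvPowerSeries τ S)
    (hφ : ∀ i, φ (X i) ∈ lowIdeal τ S 1)
    (D : MvPowerSeries σ R →ₗ[R] MvPowerSeries τ S)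
    (hD : ∀ g h, D (g * h) = φ g * D h + φ h * D g) (h : ∀ i, D (X i) = 0)
    (g : MvPowerSeries σ R) : D g = 0 := by
  refine eq_zero_of_hadamard (D : _ →+ _) (fun i => φ (X i)) hφ ?_ ?_ g
  · intro c
    have h1 : D 1 = 0 := by
      have := hD 1 1
      simpa using this
    have : (C c : MvPowerSeries σ R) = c • 1 := by
      rw [MvPowerSeries.smul_eq_C_mul, mul_one]
    simp [this, h1]
  · intro i g
    simp [hD, h i]

theorem derivAlong_ext [Finite σ] {τ S : Type*} [CommRing S] [Algebra R S]
    (φ : MvPowerSeries σ R →ₐ[R] MvPowerSeries τ S)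
    (hφ : ∀ i, φ (X i) ∈ lowIdeal τ S 1)
    (D D' : MvPowerSeries σ R →ₗ[R] MvPowerSeries τ S)
    (hD : ∀ g h, D (g * h) = φ g * D h + φ h * D g)
    (hD' : ∀ g h, D' (g * h) = φ g * D' h + φ h * D' g)
    (h : ∀ i, D (X i) = D' (X i)) : D = D' := by
  ext1 g
  rw [← sub_eq_zero]
  refine derivAlong_eq_zero φ hφ (D - D') ?_ ?_ g
  · intro g h; simp only [LinearMap.sub_apply, hD, hD']; ring
  · intro i; simp [h]

/-- Chain rule for derivations along an algebra homomorphism. -/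
theorem derivAlong_apply [Fintype σ] {τ S : Type*} [CommRing S] [Algebra R S]
    (φ : MvPowerSeries σ R →ₐ[R] MvPowerSeries τ S)
    (hφ : ∀ i, φ (X i) ∈ lowIdeal τ S 1)
    (D : MvPowerSeries σ R →ₗ[R] MvPowerSeries τ S)
    (hD : ∀ g h, D (g * h) = φ g * D h + φ h * D g) (g : MvPowerSeries σ R) :
    D g = ∑ i, φ (pderiv R i g) * D (X i) := by
  classical
  have key : D = ∑ i, (LinearMap.mulRight R (D (X i))) ∘ₗ φ.toLinearMap ∘ₗ
      (pderiv R i).toLinearMap := by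
    refine derivAlong_ext φ hφ _ _ hD ?_ ?_
    · intro g h
      simp only [LinearMap.sum_apply, LinearMap.comp_apply, LinearMap.mulRight_apply,
        Derivation.coeFn_coe, Derivation.leibniz, AlgHom.toLinearMap_apply, map_add,
        smul_eq_mul, map_mul, Finset.mul_sum, ← Finset.sum_add_distrib]
      refine Finset.sum_congr rfl fun i _ => ?_
      ring
    · intro i
      simp [pderiv_X, Pi.single_apply]
  conv_lhs => rw [key]
  simp

theorem derivation_apply [Fintype σ]
    (D : Derivation R (MvPowerSeries σ R) (MvPowerSeries σ R)) (g : MvPowerSeries σ R) :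
    D g = ∑ i, pderiv R i g * D (X i) := by
  refine derivAlong_apply (AlgHom.id R _) (fun i => by simpa using X_mem_lowIdeal i) D.toLinearMap ?_ g
  intro g h
  simp

theorem derivation_mem_lowIdeal [Finite σ]
    (D : Derivation R (MvPowerSeries σ R) (MvPowerSeries σ R)) {d : ℕ} {g : MvPowerSeries σ R}
    (hg : g ∈ lowIdeal σ R (d + 1)) : D g ∈ lowIdeal σ R d := by
  have := Fintype.ofFinite σ
  rw [derivation_apply]
  exact Ideal.sum_mem _ fun i _ => Ideal.mul_mem_right _ _ (pderiv_mem_lowIdeal i hg)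

theorem derivation_mem_lowIdeal_of_X [Finite σ]
    (D : Derivation R (MvPowerSeries σ R) (MvPowerSeries σ R))
    (hD : ∀ i, D (X i) ∈ lowIdeal σ R 1) {d : ℕ} {g : MvPowerSeries σ R}
    (hg : g ∈ lowIdeal σ R d) : D g ∈ lowIdeal σ R d := by
  have := Fintype.ofFinite σ
  cases d with
  | zero => exact lowIdeal_zero _
  | succ d =>
    rw [derivation_apply]
    exact Ideal.sum_mem _ fun i _ => mul_mem_lowIdeal (pderiv_mem_lowIdeal i hg) (hD i)

theorem derivation_ext_X [Finite σ]
    {D D' : Derivation R (MvPowerSeries σ R) (MvPowerSeries σ R)}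
    (h : ∀ i, D (X i) = D' (X i)) : D = D' := by
  have := Fintype.ofFinite σ
  ext1 g
  rw [derivation_apply D, derivation_apply D']
  simp [h]

end Hadamard

section Ev

variable {σ τ R S : Type*} [CommRing R] [CommRing S] [Algebra R S] [Finite σ]

/-- Substitution of power series without constant term. -/
noncomputable def ev (R : Type*) [CommRing R] [Algebra R S] (c : σ → MvPowerSeries τ S)
    (hc : ∀ i, c i ∈ lowIdeal τ S 1) :
    MvPowerSeries σ R →ₐ[R] MvPowerSeries τ S :=
  substAlgHom (hasSubst_of_constantCoeff_zero fun i => mem_lowIdeal_one.1 (hc i))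

@[simp]
theorem ev_X (c : σ → MvPowerSeries τ S) (hc : ∀ i, c i ∈ lowIdeal τ S 1) (i : σ) :
    ev R c hc (X i) = c i :=
  substAlgHom_X _ i

theorem finsuppProd_mem_lowIdeal (c : σ → MvPowerSeries τ S)
    (hc : ∀ i, c i ∈ lowIdeal τ S 1) (α : σ →₀ ℕ) :
    (α.prod fun i k => c i ^ k) ∈ lowIdeal τ S α.degree := by
  induction α using Finsupp.induction_linear with
  | zero => simpa using lowIdeal_zero _
  | add a b ha hb =>
    rw [Finsupp.prod_add_index' (by simp) (by intros; rw [pow_add]), map_add]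
    exact mul_mem_lowIdeal ha hb
  | single i k =>
    rw [Finsupp.prod_single_index (by simp), Finsupp.degree_single]
    induction k with
    | zero => simpa using lowIdeal_zero _
    | succ k ih => rw [pow_succ]; exact mul_mem_lowIdeal ih (hc i)

/-- The finite set of monomials of degree `< d`. -/
noncomputable def degLT (σ : Type*) [Finite σ] (d : ℕ) : Finset (σ →₀ ℕ) :=
  (Finsupp.finite_of_degree_lt d).toFinset

@[simp]
theorem mem_degLT {d : ℕ} {α : σ →₀ ℕ} : α ∈ degLT σ d ↔ α.degree < d := by
  simp [degLT]

theorem coeff_ev (c : σ → MvPowerSeries τ S) (hc : ∀ i, c i ∈ lowIdeal τ S 1)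
    (F : MvPowerSeries σ R) (e : τ →₀ ℕ) {d : ℕ} (hd : e.degree < d) :
    coeff e (ev R c hc F) = ∑ α ∈ degLT σ d, coeff α F • coeff e (α.prod fun i k => c i ^ k) := by
  rw [ev, substAlgHom_apply,
    coeff_subst (hasSubst_of_constantCoeff_zero fun i => mem_lowIdeal_one.1 (hc i))]
  rw [finsum_eq_sum_of_support_subset]
  intro α hα
  by_contra h
  simp only [Finset.mem_coe, mem_degLT, not_lt] at h
  apply hα
  simp only
  rw [mem_lowIdeal.1 (finsuppProd_mem_lowIdeal c hc α) e (lt_of_lt_of_le hd h), smul_zero]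

theorem ev_mem_lowIdeal (c : σ → MvPowerSeries τ S) (hc : ∀ i, c i ∈ lowIdeal τ S 1)
    {d : ℕ} {F : MvPowerSeries σ R} (hF : F ∈ lowIdeal σ R d) :
    ev R c hc F ∈ lowIdeal τ S d :=
  ringHom_mem_lowIdeal (ev R c hc).toRingHom (fun i => by simpa using hc i) hF

theorem constantCoeff_ev (c : σ → MvPowerSeries τ S) (hc : ∀ i, c i ∈ lowIdeal τ S 1)
    (F : MvPowerSeries σ R) :
    constantCoeff (ev R c hc F) = algebraMap R S (constantCoeff F) := by
  classical
  rw [← coeff_zero_eq_constantCoeff_apply, coeff_ev c hc F 0 (d := 1) (by simp)]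
  rw [Finset.sum_eq_single 0]
  · simp [Algebra.smul_def]
  · intro α hα h0
    simp only [mem_degLT, Nat.lt_one_iff, Finsupp.degree_eq_zero_iff] at hα
    exact absurd hα h0
  · simp

theorem eq_ev (φ : MvPowerSeries σ R →ₐ[R] MvPowerSeries τ S)
    (hφ : ∀ i, φ (X i) ∈ lowIdeal τ S 1) : φ = ev R (fun i => φ (X i)) hφ :=
  algHom_ext_X _ _ hφ fun i => by simp

end Ev

section Norm

variable {τ S : Type*} [Finite τ] [NormedCommRing S]

/-- Truncated `ℓ¹` norm with weight `s`. -/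
noncomputable def nrm (s : ℝ) (d : ℕ) (g : MvPowerSeries τ S) : ℝ :=
  ∑ α ∈ degLT τ d, ‖coeff α g‖ * s ^ α.degree

variable {s : ℝ} {d : ℕ}

theorem nrm_nonneg (hs : 0 ≤ s) (g : MvPowerSeries τ S) : 0 ≤ nrm s d g :=
  Finset.sum_nonneg fun _ _ => by positivity

theorem nrm_congr {g h : MvPowerSeries τ S} (hgh : g - h ∈ lowIdeal τ S d) :
    nrm s d g = nrm s d h := by
  refine Finset.sum_congr rfl fun α hα => ?_
  have := mem_lowIdeal.1 hgh α (mem_degLT.1 hα)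
  rw [map_sub, sub_eq_zero] at this
  rw [this]

theorem nrm_eq_zero_of_mem {g : MvPowerSeries τ S} (hg : g ∈ lowIdeal τ S d) :
    nrm s d g = 0 := by
  rw [nrm_congr (h := 0) (by simpa using hg)]
  simp [nrm]

theorem nrm_mono (hs : 0 ≤ s) {d e : ℕ} (hde : d ≤ e) (g : MvPowerSeries τ S) : nrm s d g ≤ nrm s e g := by
  refine Finset.sum_le_sum_of_subset_of_nonneg ?_ fun _ _ _ => by positivity
  intro α hα
  rw [mem_degLT] at *
  omega

theorem nrm_add (hs : 0 ≤ s) (g h : MvPowerSeries τ S) : nrm s d (g + h) ≤ nrm s d g + nrm s d h := by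
  rw [nrm, nrm, nrm, ← Finset.sum_add_distrib]
  refine Finset.sum_le_sum fun α _ => ?_
  rw [map_add, ← add_mul]
  gcongr
  exact norm_add_le _ _

@[simp]
theorem nrm_neg (g : MvPowerSeries τ S) : nrm s d (-g) = nrm s d g := by
  simp [nrm]

@[simp]
theorem nrm_zero : nrm s d (0 : MvPowerSeries τ S) = 0 := by
  simp [nrm]

theorem nrm_sub (hs : 0 ≤ s) (g h : MvPowerSeries τ S) : nrm s d (g - h) ≤ nrm s d g + nrm s d h := by
  rw [sub_eq_add_neg, ← nrm_neg h]
  exact nrm_add hs _ _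

theorem nrm_sum (hs : 0 ≤ s) {ι : Type*} (t : Finset ι) (g : ι → MvPowerSeries τ S) :
    nrm s d (∑ i ∈ t, g i) ≤ ∑ i ∈ t, nrm s d (g i) := by
  classical
  induction t using Finset.induction_on with
  | empty => simp
  | insert a t ha ih =>
    rw [Finset.sum_insert ha, Finset.sum_insert ha]
    exact (nrm_add hs _ _).trans (by gcongr)

theorem nrm_mul (hs : 0 ≤ s) (g h : MvPowerSeries τ S) : nrm s d (g * h) ≤ nrm s d g * nrm s d h := by
  classical
  calc nrm s d (g * h)
      ≤ ∑ α ∈ degLT τ d, ∑ p ∈ Finset.HasAntidiagonal.antidiagonal α,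
        (‖coeff p.1 g‖ * s ^ p.1.degree) * (‖coeff p.2 h‖ * s ^ p.2.degree) := by
        refine Finset.sum_le_sum fun α _ => ?_
        rw [coeff_mul]
        refine (mul_le_mul_of_nonneg_right (norm_sum_le _ _) (by positivity)).trans ?_
        rw [Finset.sum_mul]
        refine Finset.sum_le_sum fun p hp => ?_
        rw [← Finset.HasAntidiagonal.mem_antidiagonal.1 hp, map_add, pow_add]
        refine (mul_le_mul_of_nonneg_right (norm_mul_le _ _) (by positivity)).trans
          (le_of_eq (by ring))
    _ ≤ ∑ p ∈ degLT τ d ×ˢ degLT τ d,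
        (‖coeff p.1 g‖ * s ^ p.1.degree) * (‖coeff p.2 h‖ * s ^ p.2.degree) := by
        rw [Finset.sum_sigma']
        rw [← Finset.sum_image (f := fun p : (τ →₀ ℕ) × (τ →₀ ℕ) =>
          (‖coeff p.1 g‖ * s ^ p.1.degree) * (‖coeff p.2 h‖ * s ^ p.2.degree))
          (g := fun x : (_ : τ →₀ ℕ) × ((τ →₀ ℕ) × (τ →₀ ℕ)) => x.2)]
        · refine Finset.sum_le_sum_of_subset_of_nonneg ?_ fun _ _ _ => by positivity
          intro p hp
          simp only [Finset.mem_image, Finset.mem_sigma, mem_degLT,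
            Finset.HasAntidiagonal.mem_antidiagonal] at hp
          obtain ⟨⟨α, q⟩, ⟨h1, h2⟩, rfl⟩ := hp
          simp only [Finset.mem_product, mem_degLT]
          simp only at h1 h2
          rw [← h2, map_add] at h1
          omega
        · rintro ⟨α, p⟩ hx ⟨β, q⟩ hy hxy
          simp only [Finset.mem_coe, Finset.mem_sigma,
            Finset.HasAntidiagonal.mem_antidiagonal] at hx hy
          simp only at hxy
          subst hxy
          obtain rfl : α = β := hx.2.symm.trans hy.2
          rfl
    _ = nrm s d g * nrm s d h := by
        rw [nrm, nrm, Finset.sum_mul_sum, Finset.sum_product]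

theorem nrm_one [NormOneClass S] : nrm s d (1 : MvPowerSeries τ S) ≤ 1 := by
  classical
  calc nrm s d (1 : MvPowerSeries τ S)
      ≤ ∑ α ∈ degLT τ d, if α = 0 then 1 else 0 := by
        refine Finset.sum_le_sum fun α _ => ?_
        rw [coeff_one]
        split_ifs with h
        · simp [h]
        · simp
    _ ≤ 1 := by
        rw [Finset.sum_ite_eq']
        split_ifs <;> norm_num

theorem nrm_smul {𝕜 : Type*} [NormedField 𝕜] [NormedAlgebra 𝕜 S] (a : 𝕜)
    (g : MvPowerSeries τ S) : nrm s d (a • g) = ‖a‖ * nrm s d g := by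
  simp [nrm, Finset.mul_sum, norm_smul, mul_assoc]

theorem nrm_pow [NormOneClass S] (hs : 0 ≤ s) (g : MvPowerSeries τ S) (k : ℕ) :
    nrm s d (g ^ k) ≤ nrm s d g ^ k := by
  induction k with
  | zero => simpa using nrm_one
  | succ k ih =>
    rw [pow_succ, pow_succ]
    exact (nrm_mul hs _ _).trans (mul_le_mul_of_nonneg_right ih (nrm_nonneg hs _))

theorem nrm_finsuppProd_le [NormOneClass S] {σ : Type*} (hs : 0 ≤ s)
    (c : σ → MvPowerSeries τ S) {ρ : ℝ} (hc : ∀ i, nrm s d (c i) ≤ ρ) (α : σ →₀ ℕ) :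
    nrm s d (α.prod fun i k => c i ^ k) ≤ ρ ^ α.degree := by
  induction α using Finsupp.induction_linear with
  | zero => simpa using nrm_one
  | add a b ha hb =>
    rw [Finsupp.prod_add_index' (by simp) (by intros; rw [pow_add]), map_add, pow_add]
    exact (nrm_mul hs _ _).trans (mul_le_mul ha hb (nrm_nonneg hs _)
      ((nrm_nonneg hs _).trans ha))
  | single i k =>
    rw [Finsupp.prod_single_index (by simp), Finsupp.degree_single]
    exact (nrm_pow hs _ _).trans (pow_le_pow_left₀ (nrm_nonneg hs _) (hc i) _)

theorem coeff_mul_pow_le_nrm (hs : 0 ≤ s) (g : MvPowerSeries τ S) (α : τ →₀ ℕ) {d : ℕ}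
    (hα : α.degree < d) :
    ‖coeff α g‖ * s ^ α.degree ≤ nrm s d g :=
  Finset.single_le_sum (f := fun α => ‖coeff α g‖ * s ^ α.degree)
    (fun _ _ => by positivity) (mem_degLT.2 hα)

theorem nrm_ev_le_sum {σ 𝕜 : Type*} [Finite σ] [NormedField 𝕜] [NormedAlgebra 𝕜 S] (hs : 0 ≤ s)
    (c : σ → MvPowerSeries τ S) (hc : ∀ i, c i ∈ lowIdeal τ S 1) (F : MvPowerSeries σ 𝕜) :
    nrm s d (ev 𝕜 c hc F) ≤
      ∑ α ∈ degLT σ d, ‖coeff α F‖ * nrm s d (α.prod fun i k => c i ^ k) := by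
  have h1 : nrm s d (ev 𝕜 c hc F) =
      nrm s d (∑ α ∈ degLT σ d, coeff α F • (α.prod fun i k => c i ^ k)) := by
    refine Finset.sum_congr rfl fun e he => ?_
    rw [coeff_ev c hc F e (mem_degLT.1 he), map_sum]
    simp
  rw [h1]
  refine (nrm_sum hs _ _).trans (Finset.sum_le_sum fun α _ => ?_)
  rw [nrm_smul]

end Norm

section Conv

theorem sum_half_pow_degree_le {σ : Type*} [Fintype σ] (T : Finset (σ →₀ ℕ)) :
    ∑ α ∈ T, (1 / 2 : ℝ) ^ α.degree ≤ 2 ^ Fintype.card σ := by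
  classical
  obtain ⟨N, hN⟩ : ∃ N, ∀ α ∈ T, ∀ i, α i < N := by
    refine ⟨T.sup Finsupp.degree + 1, fun α hα i => ?_⟩
    exact Nat.lt_succ_of_le ((Finsupp.le_degree i α).trans (Finset.le_sup (f := Finsupp.degree) hα))
  calc ∑ α ∈ T, (1 / 2 : ℝ) ^ α.degree
      = ∑ a ∈ T.image (fun α : σ →₀ ℕ => (α : σ → ℕ)), ∏ i, (1 / 2 : ℝ) ^ a i := by
        rw [Finset.sum_image (fun _ _ _ _ h => DFunLike.coe_injective h)]
        refine Finset.sum_congr rfl fun α _ => ?_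
        rw [Finset.prod_pow_eq_pow_sum, Finsupp.degree_eq_sum]
    _ ≤ ∑ a ∈ Fintype.piFinset fun _ : σ => Finset.range N, ∏ i, (1 / 2 : ℝ) ^ a i := by
        refine Finset.sum_le_sum_of_subset_of_nonneg ?_ fun _ _ _ => by positivity
        intro a ha
        obtain ⟨α, hα, rfl⟩ := Finset.mem_image.1 ha
        simpa using hN α hα
    _ = ∏ _i : σ, ∑ k ∈ Finset.range N, (1 / 2 : ℝ) ^ k := by
        rw [Finset.sum_prod_piFinset]
    _ ≤ ∏ _i : σ, 2 := by
        refine Finset.prod_le_prod (fun _ _ => by positivity) fun _ _ => ?_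
        exact sum_geometric_two_le N
    _ = 2 ^ Fintype.card σ := by simp

/-- Convergent power series: the coefficients grow at most geometrically. -/
def Conv {σ S : Type*} [NormedCommRing S] (F : MvPowerSeries σ S) : Prop :=
  ∃ C : ℝ, 1 ≤ C ∧ ∀ α : σ →₀ ℕ, ‖coeff α F‖ ≤ C ^ (α.degree + 1)

variable {σ τ S : Type*} [Finite τ] [NormedCommRing S]

/-- Bound for the substitution into a series with geometrically bounded coefficients. -/
theorem nrm_ev_le {𝕜 : Type*} [Fintype σ] [NormedField 𝕜] [NormedAlgebra 𝕜 S]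
    {s : ℝ} (hs : 0 ≤ s) (c : σ → MvPowerSeries τ S) (hc : ∀ i, c i ∈ lowIdeal τ S 1)
    {F : MvPowerSeries σ 𝕜} {C ρ : ℝ} {d q : ℕ} (hC : 1 ≤ C)
    (hF : ∀ α : σ →₀ ℕ, ‖coeff α F‖ ≤ C ^ (α.degree + 1)) (hq : F ∈ lowIdeal σ 𝕜 q)
    (hprod : ∀ α : σ →₀ ℕ, q ≤ α.degree → nrm s d (α.prod fun i k => c i ^ k) ≤ ρ ^ α.degree)
    (hρ : 0 ≤ ρ) (hCρ : 2 * C * ρ ≤ 1) :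
    nrm s d (ev 𝕜 c hc F) ≤ C * (2 * C * ρ) ^ q * 2 ^ Fintype.card σ := by
  refine (nrm_ev_le_sum hs c hc F).trans ?_
  refine le_trans ?_ (mul_le_mul_of_nonneg_left (sum_half_pow_degree_le (degLT σ d))
    (by positivity))
  rw [Finset.mul_sum]
  refine Finset.sum_le_sum fun α _ => ?_
  by_cases hα : α.degree < q
  · rw [mem_lowIdeal.1 hq α hα, norm_zero, zero_mul]
    positivity
  · push Not at hα
    calc ‖coeff α F‖ * nrm s d (α.prod fun i k => c i ^ k)
        ≤ C ^ (α.degree + 1) * ρ ^ α.degree :=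
          mul_le_mul (hF α) (hprod α hα) (nrm_nonneg hs _) (by positivity)
      _ = C * (2 * C * ρ) ^ α.degree * (1 / 2) ^ α.degree := by
          rw [pow_succ, mul_assoc, mul_assoc, ← mul_pow, mul_comm (C ^ _), mul_assoc, ← mul_pow]
          congr 2; ring
      _ ≤ C * (2 * C * ρ) ^ q * (1 / 2) ^ α.degree := by
          gcongr 2
          exact pow_le_pow_of_le_one (by positivity) hCρ hα

theorem eventually_mul_le (K : ℝ) {ε : ℝ} (hε : 0 < ε) :
    ∀ᶠ s in 𝓝[>] (0 : ℝ), K * s ≤ ε := by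
  have : Filter.Tendsto (fun s : ℝ => K * s) (𝓝[>] 0) (𝓝 (K * 0)) :=
    (Filter.Tendsto.const_mul K Filter.tendsto_id).mono_left nhdsWithin_le_nhds
  rw [mul_zero] at this
  exact this.eventually (eventually_le_nhds hε)

theorem Conv.of_nrm {g : MvPowerSeries τ S} {s M : ℝ} (hs : 0 < s)
    (h : ∀ d, nrm s d g ≤ M) : Conv g := by
  refine ⟨max 1 (max M s⁻¹), le_max_left _ _, fun α => ?_⟩
  have h1 := (coeff_mul_pow_le_nrm hs.le g α (Nat.lt_succ_self _)).trans (h _)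
  have hM : 0 ≤ M := (nrm_nonneg hs.le g).trans (h 0)
  have h2 : ‖coeff α g‖ ≤ M * s⁻¹ ^ α.degree := by
    rw [inv_pow, ← div_eq_mul_inv, le_div_iff₀ (by positivity)]
    exact h1
  refine h2.trans ?_
  rw [pow_succ']
  gcongr
  · exact (le_max_left _ _).trans (le_max_right _ _)
  · exact (le_max_right _ _).trans (le_max_right _ _)

/-- A convergent series without terms of degree `< q` is `O(s ^ q)` in norm. -/
theorem Conv.exists_nrm_le {g : MvPowerSeries τ S} (hg : Conv g) {q : ℕ}
    (hq : g ∈ lowIdeal τ S q) :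
    ∃ M : ℝ, 0 < M ∧ ∀ᶠ s in 𝓝[>] (0 : ℝ), ∀ d, nrm s d g ≤ M * s ^ q := by
  have := Fintype.ofFinite τ
  obtain ⟨C, hC, hb⟩ := hg
  have hC0 : 0 < C := by linarith
  refine ⟨C * (2 * C) ^ q * 2 ^ Fintype.card τ, by positivity, ?_⟩
  filter_upwards [eventually_mul_le (2 * C) one_pos, self_mem_nhdsWithin] with s hCs hs d
  replace hs : 0 < s := hs
  calc nrm s d g ≤ ∑ α ∈ degLT τ d, C * (2 * C * s) ^ q * (1 / 2) ^ α.degree := by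
        refine Finset.sum_le_sum fun α _ => ?_
        by_cases hα : α.degree < q
        · rw [mem_lowIdeal.1 hq α hα, norm_zero, zero_mul]
          positivity
        · push Not at hα
          calc ‖coeff α g‖ * s ^ α.degree ≤ C ^ (α.degree + 1) * s ^ α.degree := by
                gcongr; exact hb α
            _ = C * (2 * C * s) ^ α.degree * (1 / 2) ^ α.degree := by
                rw [pow_succ, mul_assoc, mul_assoc, ← mul_pow, mul_comm (C ^ _), mul_assoc,
                  ← mul_pow]
                congr 2; ring
            _ ≤ _ := by
                gcongr 2
                exact pow_le_pow_of_le_one (by positivity) hCs hα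
    _ ≤ C * (2 * C * s) ^ q * 2 ^ Fintype.card τ := by
        rw [← Finset.mul_sum]
        gcongr
        exact sum_half_pow_degree_le _
    _ = _ := by rw [mul_pow]; ring

theorem Conv.exists_nrm_le' {g : MvPowerSeries τ S} (hg : Conv g) :
    ∃ M : ℝ, 0 < M ∧ ∀ᶠ s in 𝓝[>] (0 : ℝ), ∀ d, nrm s d g ≤ M := by
  simpa using hg.exists_nrm_le (q := 0) (lowIdeal_zero g)

theorem Conv.add {g h : MvPowerSeries τ S} (hg : Conv g) (hh : Conv h) : Conv (g + h) := by
  obtain ⟨M, -, hM⟩ := hg.exists_nrm_le'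
  obtain ⟨M', -, hM'⟩ := hh.exists_nrm_le'
  obtain ⟨s, ⟨h1, h2⟩, hs⟩ := ((hM.and hM').and self_mem_nhdsWithin).exists
  replace hs : 0 < s := hs
  exact Conv.of_nrm hs fun d => (nrm_add hs.le _ _).trans (add_le_add (h1 d) (h2 d))

theorem Conv.mul {g h : MvPowerSeries τ S} (hg : Conv g) (hh : Conv h) : Conv (g * h) := by
  obtain ⟨M, hM0, hM⟩ := hg.exists_nrm_le'
  obtain ⟨M', -, hM'⟩ := hh.exists_nrm_le'
  obtain ⟨s, ⟨h1, h2⟩, hs⟩ := ((hM.and hM').and self_mem_nhdsWithin).exists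
  replace hs : 0 < s := hs
  exact Conv.of_nrm hs fun d => (nrm_mul hs.le _ _).trans
    (mul_le_mul (h1 d) (h2 d) (nrm_nonneg hs.le _) hM0.le)

theorem Conv.neg {g : MvPowerSeries τ S} (hg : Conv g) : Conv (-g) := by
  obtain ⟨C, hC, h⟩ := hg
  exact ⟨C, hC, fun α => by simpa using h α⟩

theorem conv_zero : Conv (0 : MvPowerSeries τ S) :=
  ⟨1, le_rfl, fun α => by simp⟩

theorem Conv.sub {g h : MvPowerSeries τ S} (hg : Conv g) (hh : Conv h) : Conv (g - h) := by
  rw [sub_eq_add_neg]; exact hg.add hh.neg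

theorem Conv.sum {ι : Type*} (t : Finset ι) {g : ι → MvPowerSeries τ S}
    (hg : ∀ i ∈ t, Conv (g i)) : Conv (∑ i ∈ t, g i) := by
  classical
  induction t using Finset.induction_on with
  | empty => simpa using conv_zero
  | insert a t ha ih =>
    rw [Finset.sum_insert ha]
    exact (hg a (Finset.mem_insert_self _ _)).add
      (ih fun i hi => hg i (Finset.mem_insert_of_mem hi))

theorem conv_of_mem_lowIdeal_compl {g : MvPowerSeries τ S} {M : ℝ}
    (h : ∀ α, ‖coeff α g‖ ≤ M) : Conv g := by
  refine ⟨max 1 M, le_max_left _ _, fun α => (h α).trans ((le_max_right 1 M).trans ?_)⟩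
  exact le_self_pow₀ (le_max_left _ _) (Nat.succ_ne_zero _)

theorem conv_of_finite_support {g : MvPowerSeries τ S} (T : Finset (τ →₀ ℕ))
    (h : ∀ α, α ∉ T → coeff α g = 0) : Conv g := by
  refine conv_of_mem_lowIdeal_compl (M := ∑ α ∈ T, ‖coeff α g‖) fun α => ?_
  by_cases hα : α ∈ T
  · exact Finset.single_le_sum (f := fun α => ‖coeff α g‖) (fun _ _ => norm_nonneg _) hα
  · rw [h α hα, norm_zero]
    positivity

theorem conv_C (a : S) : Conv (C a : MvPowerSeries τ S) := by
  classical
  exact conv_of_finite_support {0} fun α hα => by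
    rw [coeff_C, if_neg (by simpa using hα)]

theorem conv_X (i : τ) : Conv (X i : MvPowerSeries τ S) := by
  classical
  exact conv_of_finite_support {Finsupp.single i 1} fun α hα => by
    rw [coeff_X, if_neg (by simpa using hα)]

theorem conv_one : Conv (1 : MvPowerSeries τ S) := by
  simpa using conv_C (τ := τ) (1 : S)

theorem Conv.prod {ι : Type*} (t : Finset ι) {g : ι → MvPowerSeries τ S}
    (hg : ∀ i ∈ t, Conv (g i)) : Conv (∏ i ∈ t, g i) := by
  classical
  induction t using Finset.induction_on with
  | empty => simpa using conv_one
  | insert a t ha ih =>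
    rw [Finset.prod_insert ha]
    exact (hg a (Finset.mem_insert_self _ _)).mul
      (ih fun i hi => hg i (Finset.mem_insert_of_mem hi))

theorem Conv.det {ι : Type*} [Fintype ι] [DecidableEq ι] {A : Matrix ι ι (MvPowerSeries τ S)}
    (hA : ∀ i j, Conv (A i j)) : Conv A.det := by
  rw [Matrix.det_apply]
  refine Conv.sum _ fun p _ => ?_
  rcases Int.units_eq_one_or (Equiv.Perm.sign p) with h | h <;> rw [h]
  · simpa using Conv.prod _ fun i _ => hA _ _
  · simpa using (Conv.prod _ fun i _ => hA _ _).neg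

theorem Conv.adjugate {ι : Type*} [Fintype ι] [DecidableEq ι]
    {A : Matrix ι ι (MvPowerSeries τ S)} (hA : ∀ i j, Conv (A i j)) (i j : ι) :
    Conv (A.adjugate i j) := by
  rw [Matrix.adjugate_apply]
  refine Conv.det fun a b => ?_
  rw [Matrix.updateRow_apply]
  split_ifs
  · rw [Pi.single_apply]
    split_ifs
    exacts [conv_one, conv_zero]
  · exact hA a b

theorem Conv.ev {𝕜 : Type*} [Finite σ] [NormedField 𝕜] [NormedAlgebra 𝕜 S] [NormOneClass S]
    (c : σ → MvPowerSeries τ S) (hc : ∀ i, c i ∈ lowIdeal τ S 1)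
    {F : MvPowerSeries σ 𝕜} (hF : Conv F) (hcc : ∀ i, Conv (c i)) : Conv (ev 𝕜 c hc F) := by
  have := Fintype.ofFinite σ
  choose M hM hb using fun i => (hcc i).exists_nrm_le (hc i)
  obtain ⟨C, hC, hF⟩ := hF
  have hC0 : 0 < C := by linarith
  have hMpos : 0 < 1 + ∑ i, M i := by
    have : 0 ≤ ∑ i, M i := Finset.sum_nonneg fun i _ => (hM i).le
    linarith
  obtain ⟨s, ⟨hsle, hsmall⟩, hs⟩ := (((Filter.eventually_all.2 hb).and
    (eventually_mul_le (2 * C * (1 + ∑ i, M i)) one_pos)).and self_mem_nhdsWithin).exists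
  replace hs : 0 < s := hs
  refine Conv.of_nrm hs fun d => nrm_ev_le (ρ := (1 + ∑ i, M i) * s) hs.le c hc hC hF
    (lowIdeal_zero F) (fun α _ => ?_) (mul_nonneg hMpos.le hs.le)
    (by linarith)
  refine nrm_finsuppProd_le hs.le c (fun i => ?_) α
  refine (hsle i d).trans ?_
  rw [pow_one]
  gcongr
  have := Finset.single_le_sum (f := M) (fun i _ => (hM i).le) (Finset.mem_univ i)
  linarith

theorem Conv.pderiv {F : MvPowerSeries σ ℂ} (hF : Conv F) (i : σ) :
    Conv (MvPowerSeries.pderiv ℂ i F) := by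
  obtain ⟨C, hC, h⟩ := hF
  refine ⟨2 * C ^ 2, by nlinarith, fun α => ?_⟩
  rw [coeff_pderiv, norm_mul]
  have h1 := h (α + Finsupp.single i 1)
  rw [map_add, Finsupp.degree_single] at h1
  have h2 : ‖((α i : ℂ) + 1)‖ ≤ 2 ^ (α.degree + 1) := by
    have h3 : ((α i : ℂ) + 1) = ((α i + 1 : ℕ) : ℂ) := by push_cast; rfl
    rw [h3, Complex.norm_natCast]
    have : α i + 1 < 2 ^ (α.degree + 1) + 1 := by
      have := Finsupp.le_degree i α
      have := Nat.lt_two_pow_self (n := α.degree + 1)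
      omega
    exact_mod_cast Nat.le_of_lt_succ this
  calc _ ≤ C ^ (α.degree + 1 + 1) * 2 ^ (α.degree + 1) :=
        mul_le_mul h1 h2 (norm_nonneg _) (by positivity)
    _ ≤ C ^ (2 * (α.degree + 1)) * 2 ^ (α.degree + 1) := by
        gcongr
        omega
    _ = _ := by rw [pow_mul, mul_pow, mul_comm]

theorem Conv.hadamardQuot (p : (σ →₀ ℕ) → Option σ) {F : MvPowerSeries σ S} (hF : Conv F)
    (j : σ) : Conv (hadamardQuot p F j) := by
  classical
  obtain ⟨C, hC, h⟩ := hF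
  refine ⟨C ^ 2, one_le_pow₀ hC, fun α => ?_⟩
  rw [coeff_hadamardQuot]
  split_ifs
  · refine (h _).trans ?_
    rw [← pow_mul]
    refine pow_le_pow_right₀ hC ?_
    simp
  · simp only [norm_zero]
    positivity

end Conv

section EvCongr

variable {σ τ S : Type*} [CommRing S] [Algebra ℂ S] [Finite σ]

theorem ev_comp {σ' : Type*} [Finite σ'] (b : σ' → MvPowerSeries σ ℂ)
    (hb : ∀ i, b i ∈ lowIdeal σ ℂ 1)
    (c : σ → MvPowerSeries τ S) (hc : ∀ i, c i ∈ lowIdeal τ S 1) (F : MvPowerSeries σ' ℂ) :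
    ev ℂ c hc (ev ℂ b hb F) =
      ev ℂ (fun i => ev ℂ c hc (b i)) (fun i => ev_mem_lowIdeal c hc (hb i)) F := by
  have h := eq_ev ((ev ℂ c hc).comp (ev ℂ b hb))
    (fun i => by simpa using ev_mem_lowIdeal c hc (hb i))
  have h2 := DFunLike.congr_fun h F
  simp only [AlgHom.comp_apply, ev_X] at h2
  exact h2

theorem ev_congr {c c' : σ → MvPowerSeries τ S} (h : c = c') (hc : ∀ i, c i ∈ lowIdeal τ S 1)
    (F : MvPowerSeries σ ℂ) : ev ℂ c hc F = ev ℂ c' (h ▸ hc) F := by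
  subst h; rfl

/-- Selects a variable of the second group. -/
noncomputable def pickRight (α : σ ⊕ σ →₀ ℕ) : Option (σ ⊕ σ) :=
  open Classical in if h : ∃ j, α (Sum.inr j) ≠ 0 then some (Sum.inr h.choose) else none

theorem pickRight_spec (α : σ ⊕ σ →₀ ℕ) (j : σ ⊕ σ) (h : pickRight α = some j) : α j ≠ 0 := by
  unfold pickRight at h
  split_ifs at h with h'
  have := h'.choose_spec
  simp only [Option.some.injEq] at h
  rwa [h] at this

theorem pickRight_eq_none {α : σ ⊕ σ →₀ ℕ} (h : pickRight α = none) (j : σ) :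
    α (Sum.inr j) = 0 := by
  unfold pickRight at h
  split_ifs at h with h'
  push Not at h'
  exact h' j

theorem hadamardQuot_pickRight_inl (G : MvPowerSeries (σ ⊕ σ) ℂ) (i : σ) :
    hadamardQuot pickRight G (Sum.inl i) = 0 := by
  classical
  ext α
  rw [coeff_hadamardQuot, if_neg, map_zero]
  unfold pickRight
  split_ifs <;> simp

theorem elim_mem_lowIdeal {c y : σ → MvPowerSeries τ S} (hc : ∀ i, c i ∈ lowIdeal τ S 1)
    (hy : ∀ i, y i ∈ lowIdeal τ S 1) (i : σ ⊕ σ) : Sum.elim c y i ∈ lowIdeal τ S 1 := by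
  cases i with
  | inl i => exact hc i
  | inr i => exact hy i

theorem ev_hadamardRest_pickRight (c y y' : σ → MvPowerSeries τ S)
    (hc : ∀ i, c i ∈ lowIdeal τ S 1) (hy : ∀ i, y i ∈ lowIdeal τ S 1)
    (hy' : ∀ i, y' i ∈ lowIdeal τ S 1) (G : MvPowerSeries (σ ⊕ σ) ℂ) :
    ev ℂ (Sum.elim c y) (elim_mem_lowIdeal hc hy) (hadamardRest pickRight G) =
      ev ℂ (Sum.elim c y') (elim_mem_lowIdeal hc hy') (hadamardRest pickRight G) := by
  ext e
  rw [coeff_ev _ _ _ e (Nat.lt_succ_self _), coeff_ev _ _ _ e (Nat.lt_succ_self _)]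
  refine Finset.sum_congr rfl fun α _ => ?_
  rw [coeff_hadamardRest]
  split_ifs with h
  · congr 2
    refine Finsupp.prod_congr fun i hi => ?_
    cases i with
    | inl i => rfl
    | inr i => exact absurd (pickRight_eq_none h i) (Finsupp.mem_support_iff.1 hi)
  · simp

variable [Fintype σ]

theorem ev_elim_decomp (c y : σ → MvPowerSeries τ S)
    (hc : ∀ i, c i ∈ lowIdeal τ S 1) (hy : ∀ i, y i ∈ lowIdeal τ S 1)
    (G : MvPowerSeries (σ ⊕ σ) ℂ) :
    ev ℂ (Sum.elim c y) (elim_mem_lowIdeal hc hy) G =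
      ev ℂ (Sum.elim c 0) (elim_mem_lowIdeal hc fun _ => Ideal.zero_mem _) G +
      ∑ j, y j * ev ℂ (Sum.elim c y) (elim_mem_lowIdeal hc hy)
        (hadamardQuot pickRight G (Sum.inr j)) := by
  have h1 := hadamard_decomp pickRight pickRight_spec G
  have h2 : ∀ y' : σ → MvPowerSeries τ S, ∀ hy' : ∀ i, y' i ∈ lowIdeal τ S 1,
      ev ℂ (Sum.elim c y') (elim_mem_lowIdeal hc hy') G =
      ev ℂ (Sum.elim c y') (elim_mem_lowIdeal hc hy') (hadamardRest pickRight G) +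
      ∑ j, y' j * ev ℂ (Sum.elim c y') (elim_mem_lowIdeal hc hy')
        (hadamardQuot pickRight G (Sum.inr j)) := by
    intro y' hy'
    conv_lhs => rw [h1]
    rw [map_add, map_sum, Fintype.sum_sum_type]
    simp [hadamardQuot_pickRight_inl]
  rw [h2 y hy, h2 0 fun _ => Ideal.zero_mem _, ev_hadamardRest_pickRight c y 0 hc hy
    fun _ => Ideal.zero_mem _]
  simp

/-- The series `F (c + y)` in the variables `c` and `y`. -/
noncomputable def shiftSeries (F : MvPowerSeries σ ℂ) : MvPowerSeries (σ ⊕ σ) ℂ :=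
  ev ℂ (fun i => X (Sum.inl i) + X (Sum.inr i))
    (fun _ => Ideal.add_mem _ (X_mem_lowIdeal _) (X_mem_lowIdeal _)) F

/-- Second order Taylor remainder of `F`. -/
noncomputable def taylorRem (F : MvPowerSeries σ ℂ) (i j : σ) : MvPowerSeries (σ ⊕ σ) ℂ :=
  hadamardQuot pickRight (hadamardQuot pickRight (shiftSeries F) (Sum.inr i)) (Sum.inr j)

theorem Conv.taylorRem {F : MvPowerSeries σ ℂ} (hF : Conv F) (i j : σ) :
    Conv (taylorRem F i j) :=
  Conv.hadamardQuot _ (Conv.hadamardQuot _ (Conv.ev _ _ hF fun _ => (conv_X _).add (conv_X _)) _) _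

theorem ev_shiftSeries (c y : σ → MvPowerSeries τ S)
    (hc : ∀ i, c i ∈ lowIdeal τ S 1) (hy : ∀ i, y i ∈ lowIdeal τ S 1) (F : MvPowerSeries σ ℂ) :
    ev ℂ (Sum.elim c y) (elim_mem_lowIdeal hc hy) (shiftSeries F) =
      ev ℂ (c + y) (fun i => Ideal.add_mem _ (hc i) (hy i)) F := by
  rw [shiftSeries, ev_comp]
  refine ev_congr ?_ _ _
  ext1 i
  simp

theorem ev_shiftQuot (c : σ → MvPowerSeries τ S) (hc : ∀ i, c i ∈ lowIdeal τ S 1)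
    (F : MvPowerSeries σ ℂ) (i : σ) :
    ev ℂ (Sum.elim c 0) (elim_mem_lowIdeal hc fun _ => Ideal.zero_mem _)
      (hadamardQuot pickRight (shiftSeries F) (Sum.inr i)) = ev ℂ c hc (pderiv ℂ i F) := by
  classical
  have hmem : ∀ i : σ, (X (Sum.inl i) + X (Sum.inr i) : MvPowerSeries (σ ⊕ σ) ℂ) ∈
    lowIdeal (σ ⊕ σ) ℂ 1 := fun _ => Ideal.add_mem _ (X_mem_lowIdeal _) (X_mem_lowIdeal _)
  have h1 : pderiv ℂ (Sum.inr i) (shiftSeries F) = shiftSeries (pderiv ℂ i F) := by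
    have := derivAlong_apply (ev ℂ (fun i => X (Sum.inl i) + X (Sum.inr i)) hmem)
      (fun i => by rw [ev_X]; exact hmem i)
      ((pderiv ℂ (Sum.inr i : σ ⊕ σ)).toLinearMap ∘ₗ
        (ev ℂ (fun i => X (Sum.inl i) + X (Sum.inr i)) hmem).toLinearMap)
      (fun g h => by simp) F
    simp only [LinearMap.comp_apply, AlgHom.toLinearMap_apply, Derivation.coeFn_coe, ev_X,
      map_add, pderiv_X] at this
    rw [shiftSeries, this, shiftSeries, Finset.sum_eq_single i]
    · simp
    · intro j _ hj
      simp [hj]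
    · simp
  have h2 : pderiv ℂ (Sum.inr i) (hadamardRest pickRight (shiftSeries F)) = 0 := by
    ext α
    rw [coeff_pderiv, coeff_hadamardRest, if_neg, zero_mul, map_zero]
    intro h
    have := pickRight_eq_none h i
    simp at this
  have h3 := hadamard_decomp pickRight pickRight_spec (shiftSeries F)
  rw [Fintype.sum_sum_type] at h3
  simp only [hadamardQuot_pickRight_inl, mul_zero, Finset.sum_const_zero, zero_add] at h3
  have h4 := congrArg (fun g => ev ℂ (Sum.elim c 0)
    (elim_mem_lowIdeal hc fun _ => Ideal.zero_mem _) (pderiv ℂ (Sum.inr i) g)) h3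
  simp only [h1, map_add, h2, zero_add, map_sum, Derivation.leibniz, smul_eq_mul, map_mul, ev_X,
    Sum.elim_inr, Pi.zero_apply, zero_mul, pderiv_X, ev_shiftSeries c 0 hc
      (fun _ => Ideal.zero_mem _)] at h4
  rw [Finset.sum_eq_single i] at h4
  · simp only [Pi.single_eq_same, map_one, mul_one] at h4
    rw [← h4]
    exact ev_congr (by simp) _ _
  · intro j _ hj
    simp [hj]
  · simp

theorem ev_add_taylor (c y : σ → MvPowerSeries τ S)
    (hc : ∀ i, c i ∈ lowIdeal τ S 1) (hy : ∀ i, y i ∈ lowIdeal τ S 1) (F : MvPowerSeries σ ℂ) :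
    ev ℂ (c + y) (fun i => Ideal.add_mem _ (hc i) (hy i)) F =
      ev ℂ c hc F + ∑ i, ev ℂ c hc (pderiv ℂ i F) * y i +
      ∑ i, ∑ j, y i * y j *
        ev ℂ (Sum.elim c y) (elim_mem_lowIdeal hc hy) (taylorRem F i j) := by
  rw [← ev_shiftSeries c y hc hy, ev_elim_decomp c y hc hy, ev_shiftSeries c 0 hc
    fun _ => Ideal.zero_mem _, add_assoc, ← Finset.sum_add_distrib]
  congr 1
  · exact ev_congr (by simp) _ _
  refine Finset.sum_congr rfl fun i _ => ?_
  rw [ev_elim_decomp c y hc hy (hadamardQuot _ _ _), ev_shiftQuot c hc, mul_add, mul_comm,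
    Finset.mul_sum]
  congr 1
  refine Finset.sum_congr rfl fun j _ => ?_
  rw [mul_assoc]
  rfl

theorem ev_sub_mem {d : ℕ} (c c' : σ → MvPowerSeries τ S)
    (hc : ∀ i, c i ∈ lowIdeal τ S 1) (hc' : ∀ i, c' i ∈ lowIdeal τ S 1)
    (h : ∀ i, c' i - c i ∈ lowIdeal τ S d) (F : MvPowerSeries σ ℂ) :
    ev ℂ c' hc' F - ev ℂ c hc F ∈ lowIdeal τ S d := by
  have hy : ∀ i, (c' - c) i ∈ lowIdeal τ S 1 := fun i => Ideal.sub_mem _ (hc' i) (hc i)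
  have h1 := ev_add_taylor c (c' - c) hc hy F
  have h2 : ev ℂ c' hc' F = ev ℂ (c + (c' - c)) (fun i => Ideal.add_mem _ (hc i) (hy i)) F :=
    ev_congr (by simp) _ _
  rw [h2, h1, add_assoc, add_sub_cancel_left]
  refine Ideal.add_mem _ (Ideal.sum_mem _ fun i _ => Ideal.mul_mem_left _ _ (h i))
    (Ideal.sum_mem _ fun i _ => Ideal.sum_mem _ fun j _ => Ideal.mul_mem_right _ _
      (Ideal.mul_mem_right _ _ (h i)))

theorem ev_add_mem {d : ℕ} (c y : σ → MvPowerSeries τ S)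
    (hc : ∀ i, c i ∈ lowIdeal τ S 1) (hy : ∀ i, y i ∈ lowIdeal τ S 1)
    (h : ∀ i, y i ∈ lowIdeal τ S d) (F : MvPowerSeries σ ℂ) :
    ev ℂ (c + y) (fun i => Ideal.add_mem _ (hc i) (hy i)) F -
      (ev ℂ c hc F + ∑ i, ev ℂ c hc (pderiv ℂ i F) * y i) ∈ lowIdeal τ S (2 * d) := by
  rw [ev_add_taylor c y hc hy F, add_sub_cancel_left, two_mul]
  exact Ideal.sum_mem _ fun i _ => Ideal.sum_mem _ fun j _ => Ideal.mul_mem_right _ _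
    (mul_mem_lowIdeal (h i) (h j))

end EvCongr

section Limit

variable {τ S : Type*} [CommRing S]

/-- Coefficientwise limits of sequences of power series. -/
theorem exists_limit {ι : Type*} (P : ℕ → (ι → MvPowerSeries τ S) → Prop) (N : ℕ)
    (h0 : ∃ c, P 0 c)
    (hstep : ∀ k c, P k c → ∃ c', P (k + 1) c' ∧ ∀ i, c' i - c i ∈ lowIdeal τ S (N + k)) :
    ∃ γ : ι → MvPowerSeries τ S, ∀ k, ∃ c, P k c ∧ ∀ i, γ i - c i ∈ lowIdeal τ S (N + k) := by
  choose! nxt hnxt hdiff using hstep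
  obtain ⟨c₀, hc₀⟩ := h0
  let seq : ℕ → ι → MvPowerSeries τ S := fun k => Nat.rec c₀ (fun k c => nxt k c) k
  have hseq : ∀ k, P k (seq k) := by
    intro k
    induction k with
    | zero => exact hc₀
    | succ k ih => exact hnxt k _ ih
  have hmono : ∀ k l i, seq (k + l) i - seq k i ∈ lowIdeal τ S (N + k) := by
    intro k l i
    induction l with
    | zero => simp
    | succ l ih =>
      have h1 := lowIdeal_mono (show N + k ≤ N + (k + l) by omega) (hdiff (k + l) _ (hseq _) i)
      have := Ideal.add_mem _ h1 ih
      rwa [sub_add_sub_cancel] at this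
  let lim : ι → MvPowerSeries τ S := fun i => (fun α => coeff α (seq (α.degree + 1) i) : _ → S)
  refine ⟨lim, fun k => ⟨seq k, hseq k, fun i => ?_⟩⟩
  rw [mem_lowIdeal]
  intro α hα
  rw [map_sub, sub_eq_zero]
  change coeff α (seq (α.degree + 1) i) = _
  rcases le_total (α.degree + 1) k with h | h
  · obtain ⟨l, rfl⟩ := Nat.exists_eq_add_of_le h
    have := mem_lowIdeal.1 (hmono (α.degree + 1) l i) α (by omega)
    rw [map_sub, sub_eq_zero] at this
    exact this.symm
  · obtain ⟨l, hl⟩ := Nat.exists_eq_add_of_le h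
    have := mem_lowIdeal.1 (hmono k l i) α hα
    rw [map_sub, sub_eq_zero] at this
    rw [hl, this]

end Limit

section ExactOrder

variable {S : Type*} [CommRing S]

/-- The series `g` is a unit times `t ^ q`. -/
def ExactOrder (q : ℕ) (g : PowerSeries S) : Prop :=
  ∃ u : PowerSeries S, IsUnit u ∧ g = PowerSeries.X ^ q * u

theorem ExactOrder.of_sub_mem {q : ℕ} {g g' : PowerSeries S} (hg : ExactOrder q g)
    (h : g' - g ∈ lowIdeal Unit S (q + 1)) : ExactOrder q g' := by
  obtain ⟨u, hu, rfl⟩ := hg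
  obtain ⟨w, hw⟩ := powerSeries_mem_lowIdeal.1 h
  refine ⟨u + PowerSeries.X * w, ?_, ?_⟩
  · rw [PowerSeries.isUnit_iff_constantCoeff] at hu ⊢
    simpa using hu
  · rw [sub_eq_iff_eq_add] at hw
    rw [hw]; ring

theorem ExactOrder.mem_of_mul {q d : ℕ} {g y : PowerSeries S} (hg : ExactOrder q g)
    (h : g * y ∈ lowIdeal Unit S (q + d)) : y ∈ lowIdeal Unit S d := by
  obtain ⟨u, hu, rfl⟩ := hg
  rw [powerSeries_mem_lowIdeal] at *
  obtain ⟨w, hw⟩ := h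
  rw [pow_add, mul_assoc, mul_assoc] at hw
  have := PowerSeries.X_pow_mul_cancel hw
  exact (IsUnit.dvd_mul_left hu).1 (this ▸ dvd_mul_right _ _)

theorem ExactOrder.mul_cancel {q : ℕ} {g y z : PowerSeries S} (hg : ExactOrder q g)
    (h : g * y = g * z) : y = z := by
  obtain ⟨u, hu, rfl⟩ := hg
  rw [mul_assoc, mul_assoc] at h
  exact hu.mul_left_cancel (PowerSeries.X_pow_mul_cancel h)

theorem ExactOrder.map {S' : Type*} [CommRing S'] (φ : S →+* S') {q : ℕ} {g : PowerSeries S}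
    (hg : ExactOrder q g) : ExactOrder q (PowerSeries.map φ g) := by
  obtain ⟨u, hu, rfl⟩ := hg
  exact ⟨_, hu.map (PowerSeries.map φ), by simp⟩

theorem det_sub_mem {A ι : Type*} [CommRing A] [Fintype ι] [DecidableEq ι] (I : Ideal A)
    (P Q : Matrix ι ι A) (h : ∀ i j, P i j - Q i j ∈ I) : P.det - Q.det ∈ I := by
  rw [← Ideal.Quotient.eq, RingHom.map_det, RingHom.map_det]
  congr 1
  ext i j
  simpa using Ideal.Quotient.eq.2 (h i j)

end ExactOrder

section Tougeron

variable {σ S : Type*} [Fintype σ] [DecidableEq σ] [CommRing S] [Algebra ℂ S]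

/-- The Jacobian matrix of `F` evaluated at `c`. -/
noncomputable def jac {τ : Type*} (F : σ → MvPowerSeries σ ℂ) (c : σ → MvPowerSeries τ S)
    (hc : ∀ i, c i ∈ lowIdeal τ S 1) : Matrix σ σ (MvPowerSeries τ S) :=
  Matrix.of fun i j => ev ℂ c hc (pderiv ℂ j (F i))

theorem det_jac_sub_mem {d : ℕ} (F : σ → MvPowerSeries σ ℂ) (c c' : σ → PowerSeries S)
    (hc : ∀ i, c i ∈ lowIdeal Unit S 1) (hc' : ∀ i, c' i ∈ lowIdeal Unit S 1)
    (h : ∀ i, c' i - c i ∈ lowIdeal Unit S d) :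
    (jac F c' hc').det - (jac F c hc).det ∈ lowIdeal Unit S d :=
  det_sub_mem _ _ _ fun _ _ => ev_sub_mem c c' hc hc' h _

theorem tougeron_step (F : σ → MvPowerSeries σ ℂ) (c : σ → PowerSeries S)
    (hc : ∀ i, c i ∈ lowIdeal Unit S 1) (v : σ → PowerSeries S) {q M : ℕ} (hM : 2 * q + 1 ≤ M)
    (hJ : ExactOrder q (jac F c hc).det)
    (hF : ∀ i, ev ℂ c hc (F i) - v i ∈ lowIdeal Unit S M) :
    ∃ (c' : σ → PowerSeries S) (hc' : ∀ i, c' i ∈ lowIdeal Unit S 1),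
      (∀ i, c' i - c i ∈ lowIdeal Unit S (M - q)) ∧
      (∀ i, ev ℂ c' hc' (F i) - v i ∈ lowIdeal Unit S (M + 1)) := by
  obtain ⟨u, hu, hdet⟩ := hJ
  obtain ⟨w, hw⟩ := hu.exists_right_inv
  choose ε hε using fun i => powerSeries_mem_lowIdeal.1 (hF i)
  let η : σ → PowerSeries S := fun j =>
    -(PowerSeries.X ^ (M - q) * (w * ∑ k, (jac F c hc).adjugate j k * ε k))
  have hηd : ∀ j, η j ∈ lowIdeal Unit S (M - q) := fun j =>
    Ideal.neg_mem_iff _ |>.2 (powerSeries_mem_lowIdeal.2 (dvd_mul_right _ _))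
  have hη : ∀ j, η j ∈ lowIdeal Unit S 1 := fun j => lowIdeal_mono (by omega) (hηd j)
  refine ⟨c + η, fun i => Ideal.add_mem _ (hc i) (hη i), fun i => by simpa using hηd i,
    fun i => ?_⟩
  have h1 := ev_add_mem c η hc hη hηd (F i)
  have h2 : ∑ j, ev ℂ c hc (pderiv ℂ j (F i)) * η j = -(PowerSeries.X ^ M * ε i) := by
    have h3 : ∑ j, (jac F c hc) i j * ∑ k, (jac F c hc).adjugate j k * ε k =
        PowerSeries.X ^ q * u * ε i := by
      have h4 := congrFun (congrArg (fun A => A.mulVec ε) (jac F c hc).mul_adjugate) i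
      rw [← Matrix.mulVec_mulVec, hdet] at h4
      simp only [Matrix.smul_mulVec, Matrix.one_mulVec, Pi.smul_apply, smul_eq_mul] at h4
      exact h4
    calc ∑ j, ev ℂ c hc (pderiv ℂ j (F i)) * η j
        = -(PowerSeries.X ^ (M - q) * w *
          ∑ j, (jac F c hc) i j * ∑ k, (jac F c hc).adjugate j k * ε k) := by
          rw [Finset.mul_sum, ← Finset.sum_neg_distrib]
          refine Finset.sum_congr rfl fun j _ => ?_
          simp only [η, jac, Matrix.of_apply]
          ring
      _ = -(PowerSeries.X ^ (M - q + q) * (u * w) * ε i) := by rw [h3, pow_add]; ring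
      _ = _ := by rw [hw, mul_one, Nat.sub_add_cancel (by omega)]
  rw [h2, ← hε i] at h1
  have h5 : ev ℂ c hc (F i) + -(ev ℂ c hc (F i) - v i) = v i := by ring
  rw [h5] at h1
  exact lowIdeal_mono (by omega) h1

theorem tougeron_exists (F : σ → MvPowerSeries σ ℂ) (c : σ → PowerSeries S)
    (hc : ∀ i, c i ∈ lowIdeal Unit S 1) (v : σ → PowerSeries S) {q M : ℕ} (hM : 2 * q + 1 ≤ M)
    (hJ : ExactOrder q (jac F c hc).det)
    (hF : ∀ i, ev ℂ c hc (F i) - v i ∈ lowIdeal Unit S M) :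
    ∃ (γ : σ → PowerSeries S) (hγ : ∀ i, γ i ∈ lowIdeal Unit S 1),
      (∀ i, γ i - c i ∈ lowIdeal Unit S (M - q)) ∧ (∀ i, ev ℂ γ hγ (F i) = v i) := by
  obtain ⟨γ, hγ⟩ := exists_limit (τ := Unit) (S := S)
    (fun k (c' : σ → PowerSeries S) => ∃ hc' : ∀ i, c' i ∈ lowIdeal Unit S 1,
      (∀ i, c' i - c i ∈ lowIdeal Unit S (M - q)) ∧
      (∀ i, ev ℂ c' hc' (F i) - v i ∈ lowIdeal Unit S (M + k))) (M - q)
    ⟨c, hc, by simp, hF⟩ (by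
      rintro k c₁ ⟨hc₁, h1, h2⟩
      have hJ' := hJ.of_sub_mem (lowIdeal_mono (by omega) (det_jac_sub_mem F c c₁ hc hc₁ h1))
      obtain ⟨c', hc', h3, h4⟩ := tougeron_step F c₁ hc₁ v (by omega) hJ' h2
      refine ⟨c', ⟨hc', fun i => ?_, h4⟩, fun i => lowIdeal_mono (by omega) (h3 i)⟩
      have := Ideal.add_mem _ (lowIdeal_mono (by omega) (h3 i)) (h1 i)
      rwa [sub_add_sub_cancel] at this)
  have hγ1 : ∀ i, γ i ∈ lowIdeal Unit S 1 := fun i => by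
    obtain ⟨c₁, ⟨hc₁, -, -⟩, h⟩ := hγ 0
    have := Ideal.add_mem _ (lowIdeal_mono (by omega) (h i)) (hc₁ i)
    rwa [sub_add_cancel] at this
  refine ⟨γ, hγ1, fun i => ?_, fun i => ?_⟩
  · obtain ⟨c₁, ⟨-, h1, -⟩, h⟩ := hγ 0
    have := Ideal.add_mem _ (h i) (h1 i)
    rwa [sub_add_sub_cancel] at this
  · rw [← sub_eq_zero]
    refine eq_zero_of_forall_mem_lowIdeal fun d => ?_
    obtain ⟨c₁, ⟨hc₁, -, h2⟩, h⟩ := hγ d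
    have := Ideal.add_mem _ (lowIdeal_mono (by omega) (ev_sub_mem c₁ γ hc₁ hγ1 h (F i)))
      (lowIdeal_mono (by omega : d ≤ M + d) (h2 i))
    rwa [sub_add_sub_cancel] at this

theorem tougeron_unique (F : σ → MvPowerSeries σ ℂ) (γ γ' : σ → PowerSeries S)
    (hγ : ∀ i, γ i ∈ lowIdeal Unit S 1) (hγ' : ∀ i, γ' i ∈ lowIdeal Unit S 1) {q : ℕ}
    (hJ : ExactOrder q (jac F γ hγ).det)
    (h : ∀ i, γ' i - γ i ∈ lowIdeal Unit S (q + 1))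
    (hF : ∀ i, ev ℂ γ hγ (F i) = ev ℂ γ' hγ' (F i)) : γ = γ' := by
  suffices H : ∀ d, ∀ i, γ' i - γ i ∈ lowIdeal Unit S (q + 1 + d) by
    ext1 i
    rw [eq_comm, ← sub_eq_zero]
    exact eq_zero_of_forall_mem_lowIdeal fun d => lowIdeal_mono (by omega) (H d i)
  intro d
  induction d with
  | zero => exact h
  | succ d ih =>
    have hy : ∀ i, (γ' - γ) i ∈ lowIdeal Unit S 1 := fun i => Ideal.sub_mem _ (hγ' i) (hγ i)
    have h1 : ∀ i, ((jac F γ hγ).mulVec (γ' - γ)) i ∈ lowIdeal Unit S (2 * (q + 1 + d)) := by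
      intro i
      have h2 := ev_add_mem γ (γ' - γ) hγ hy ih (F i)
      have h3 : ev ℂ (γ + (γ' - γ)) (fun i => Ideal.add_mem _ (hγ i) (hy i)) (F i) =
          ev ℂ γ' hγ' (F i) := ev_congr (by simp) _ _
      rw [h3, ← hF i, sub_add_cancel_left] at h2
      exact (Ideal.neg_mem_iff _).1 h2
    intro i
    have h4 : (jac F γ hγ).det * (γ' i - γ i) ∈ lowIdeal Unit S (2 * (q + 1 + d)) := by
      have h5 := congrFun (congrArg (fun A => A.mulVec (γ' - γ)) (jac F γ hγ).adjugate_mul) i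
      rw [← Matrix.mulVec_mulVec] at h5
      simp only [Matrix.smul_mulVec, Matrix.one_mulVec, Pi.smul_apply, smul_eq_mul,
        Pi.sub_apply] at h5
      rw [← h5]
      exact Ideal.sum_mem _ fun k _ => Ideal.mul_mem_left _ _ (h1 k)
    exact hJ.mem_of_mul (lowIdeal_mono (by omega) h4)

end Tougeron

section PowerSeriesConv

variable {S : Type*} [NormedCommRing S]

theorem nrm_powerSeries {s : ℝ} {d : ℕ} (g : PowerSeries S) :
    nrm s d g = ∑ k ∈ Finset.range d, ‖PowerSeries.coeff k g‖ * s ^ k := by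
  rw [nrm]
  refine Finset.sum_bij' (fun α _ => α ()) (fun k _ => Finsupp.single () k) ?_ ?_ ?_ ?_ ?_
  · intro α hα
    rw [mem_degLT] at hα
    exact Finset.mem_range.2 ((Finsupp.le_degree () α).trans_lt hα)
  · intro k hk
    simpa using hk
  · intro α _
    ext; simp
  · intro k _
    simp
  · intro α _
    have : α = Finsupp.single () (α ()) := by ext; simp
    conv_lhs => rw [this]
    rw [Finsupp.degree_single]
    rfl

theorem conv_powerSeries {g : PowerSeries S} :
    Conv g ↔ ∃ C : ℝ, 1 ≤ C ∧ ∀ k, ‖PowerSeries.coeff k g‖ ≤ C ^ (k + 1) := by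
  constructor
  · rintro ⟨C, hC, h⟩
    refine ⟨C, hC, fun k => ?_⟩
    simpa using h (Finsupp.single () k)
  · rintro ⟨C, hC, h⟩
    refine ⟨C, hC, fun α => ?_⟩
    have : α = Finsupp.single () (α ()) := by ext; simp
    rw [this, Finsupp.degree_single]
    exact h _

theorem nrm_X_mul {s : ℝ} {d : ℕ} (g : PowerSeries S) :
    nrm s (d + 1) (PowerSeries.X * g) = s * nrm s d g := by
  rw [nrm_powerSeries, nrm_powerSeries, Finset.sum_range_succ', Finset.mul_sum]
  simp only [PowerSeries.coeff_succ_X_mul, PowerSeries.coeff_zero_X_mul, norm_zero, zero_mul,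
    add_zero]
  refine Finset.sum_congr rfl fun k _ => ?_
  ring

theorem nrm_X_pow_mul_le {s : ℝ} {d : ℕ} (hs : 0 ≤ s) (hs1 : s ≤ 1) (q : ℕ) (g : PowerSeries S) :
    nrm s d (PowerSeries.X ^ q * g) ≤ nrm s d g := by
  induction q with
  | zero => simp
  | succ q ih =>
    rw [pow_succ', mul_assoc]
    refine le_trans ?_ ih
    refine (nrm_mono hs (Nat.le_succ d) _).trans ?_
    rw [nrm_X_mul]
    exact mul_le_of_le_one_left (nrm_nonneg hs _) hs1

theorem Conv.of_X_pow_mul {q : ℕ} {g : PowerSeries S} (h : Conv (PowerSeries.X ^ q * g)) :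
    Conv g := by
  rw [conv_powerSeries] at *
  obtain ⟨C, hC, h⟩ := h
  refine ⟨C ^ (q + 1), one_le_pow₀ hC, fun k => ?_⟩
  have h1 := h (k + q)
  rw [PowerSeries.coeff_X_pow_mul] at h1
  refine h1.trans ?_
  rw [← pow_mul]
  exact pow_le_pow_right₀ hC (by nlinarith)

theorem Conv.X_pow (q : ℕ) : Conv (PowerSeries.X ^ q : PowerSeries S) := by
  induction q with
  | zero => simpa using conv_one
  | succ q ih => rw [pow_succ]; exact ih.mul (conv_X ())

theorem Conv.of_mul_eq_one [NormOneClass S] {u w : PowerSeries S} (hu : Conv u) (h : u * w = 1) :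
    Conv w := by
  obtain ⟨a, ha⟩ : ∃ a : S, a * PowerSeries.constantCoeff u = 1 :=
    ⟨PowerSeries.constantCoeff w, by rw [← map_mul, mul_comm, h, map_one]⟩
  have hmem : u - C (PowerSeries.constantCoeff u) ∈ lowIdeal Unit S 1 := by
    rw [mem_lowIdeal_one, map_sub, constantCoeff_C, sub_eq_zero]; rfl
  obtain ⟨M, hM0, hM⟩ := (hu.sub (conv_C _)).exists_nrm_le hmem
  obtain ⟨s, ⟨h1, h2⟩, hs⟩ := ((hM.and (eventually_mul_le (‖a‖ * M) one_half_pos)).and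
    self_mem_nhdsWithin).exists
  replace hs : 0 < s := hs
  have hCa : ∀ d (g : PowerSeries S), nrm s d (C a * g) ≤ ‖a‖ * nrm s d g := by
    intro d g
    rw [nrm, nrm, Finset.mul_sum]
    refine Finset.sum_le_sum fun α _ => ?_
    rw [coeff_C_mul, ← mul_assoc]
    gcongr
    exact norm_mul_le _ _
  have hw : w = C a * (1 - (u - C (PowerSeries.constantCoeff u)) * w) := by
    have : (C a * C (PowerSeries.constantCoeff u) : MvPowerSeries Unit S) = 1 := by
      rw [← map_mul, ha, map_one]
    rw [sub_mul, h, sub_sub_cancel, ← mul_assoc, this, one_mul]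
  refine Conv.of_nrm hs (M := 2 * ‖a‖) fun d => ?_
  have h3 : nrm s d w ≤ ‖a‖ * (1 + M * s ^ 1 * nrm s d w) := by
    conv_lhs => rw [hw]
    refine (hCa d _).trans ?_
    gcongr
    refine (nrm_sub hs.le _ _).trans (add_le_add nrm_one ((nrm_mul hs.le _ _).trans ?_))
    exact mul_le_mul_of_nonneg_right (h1 d) (nrm_nonneg hs.le _)
  have h4 := nrm_nonneg hs.le (d := d) w
  nlinarith

theorem conv_trunc (g : PowerSeries S) (N : ℕ) :
    ∃ c : PowerSeries S, Conv c ∧ g - c ∈ lowIdeal Unit S N := by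
  refine ⟨(PowerSeries.trunc N g : Polynomial S), ?_, ?_⟩
  · refine conv_of_finite_support (degLT Unit N) fun α hα => ?_
    have : α = Finsupp.single () (α ()) := by ext; simp
    rw [this] at hα ⊢
    rw [mem_degLT, Finsupp.degree_single] at hα
    change PowerSeries.coeff (α ()) _ = 0
    rw [Polynomial.coeff_coe, PowerSeries.coeff_trunc, if_neg hα]
  · rw [powerSeries_mem_lowIdeal, PowerSeries.X_pow_dvd_iff]
    intro m hm
    rw [map_sub, Polynomial.coeff_coe, PowerSeries.coeff_trunc, if_pos hm, sub_self]

end PowerSeriesConv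

section TougeronConv

variable {σ S : Type*} [Fintype σ] [DecidableEq σ] [NormedCommRing S] [NormOneClass S]
  [NormedAlgebra ℂ S]

/-- Solutions of convergent equations of the shape `ζ = e - t a Q(ζ)` converge. -/
theorem conv_of_fixedPoint {N : ℕ} (c e ζ : σ → PowerSeries S) (a : σ → σ → PowerSeries S)
    (H : σ → σ → σ → MvPowerSeries (σ ⊕ σ) ℂ)
    (hc : ∀ i, c i ∈ lowIdeal Unit S 1)
    (hy : ∀ i, PowerSeries.X ^ N * ζ i ∈ lowIdeal Unit S 1)
    (he1 : ∀ i, e i ∈ lowIdeal Unit S 1)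
    (hcc : ∀ i, Conv (c i)) (hec : ∀ i, Conv (e i)) (hac : ∀ i j, Conv (a i j))
    (hH : ∀ k i j, Conv (H k i j))
    (heq : ∀ i, ζ i = e i - PowerSeries.X * ∑ k, a i k * ∑ i', ∑ j', ζ i' * ζ j' *
      ev ℂ (Sum.elim c fun i => PowerSeries.X ^ N * ζ i) (elim_mem_lowIdeal hc hy) (H k i' j')) :
    ∀ i, Conv (ζ i) := by
  choose Mc hMc0 hMc using fun i => (hcc i).exists_nrm_le (hc i)
  choose Me hMe0 hMe using fun i => (hec i).exists_nrm_le (he1 i)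
  choose Ma hMa0 hMa using fun i j => (hac i j).exists_nrm_le'
  choose CH hCH1 hCH using hH
  let K : ℝ := 1 + ∑ i, Mc i + ∑ i, Me i
  let A : ℝ := 1 + ∑ i, ∑ j, Ma i j
  let C₀ : ℝ := 1 + ∑ k, ∑ i, ∑ j, CH k i j
  have hCH0 : ∀ k i j, 0 ≤ CH k i j := fun k i j => by linarith [hCH1 k i j]
  have hKc : ∀ i, Mc i ≤ K := fun i => by
    have := Finset.single_le_sum (f := Mc) (fun i _ => (hMc0 i).le) (Finset.mem_univ i)
    have := Finset.sum_nonneg fun i (_ : i ∈ Finset.univ) => (hMe0 i).le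
    simp only [K]; linarith
  have hKe : ∀ i, Me i ≤ K := fun i => by
    have := Finset.single_le_sum (f := Me) (fun i _ => (hMe0 i).le) (Finset.mem_univ i)
    have := Finset.sum_nonneg fun i (_ : i ∈ Finset.univ) => (hMc0 i).le
    simp only [K]; linarith
  have hA : ∀ i j, Ma i j ≤ A := fun i j => by
    have h1 := Finset.single_le_sum (f := Ma i) (fun j _ => (hMa0 i j).le) (Finset.mem_univ j)
    have h2 := Finset.single_le_sum (f := fun i => ∑ j, Ma i j)
      (fun i _ => Finset.sum_nonneg fun j _ => (hMa0 i j).le) (Finset.mem_univ i)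
    simp only [A]; linarith
  have hC₀ : ∀ k i j, CH k i j ≤ C₀ := fun k i j => by
    have h1 := Finset.single_le_sum (f := CH k i) (fun j _ => hCH0 k i j) (Finset.mem_univ j)
    have h2 := Finset.single_le_sum (f := fun i => ∑ j, CH k i j)
      (fun i _ => Finset.sum_nonneg fun j _ => hCH0 k i j) (Finset.mem_univ i)
    have h3 := Finset.single_le_sum (f := fun k => ∑ i, ∑ j, CH k i j)
      (fun k _ => Finset.sum_nonneg fun i _ => Finset.sum_nonneg fun j _ => hCH0 k i j)
      (Finset.mem_univ k)
    simp only [C₀]; linarith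
  have hK1 : 1 ≤ K := by
    have h1 := Finset.sum_nonneg fun i (_ : i ∈ Finset.univ) => (hMc0 i).le
    have h2 := Finset.sum_nonneg fun i (_ : i ∈ Finset.univ) => (hMe0 i).le
    simp only [K]; linarith
  have hA1 : 0 ≤ A := by
    have h1 := Finset.sum_nonneg fun i (_ : i ∈ Finset.univ) =>
      Finset.sum_nonneg fun j (_ : j ∈ Finset.univ) => (hMa0 i j).le
    simp only [A]; linarith
  have hC1 : 1 ≤ C₀ := by
    have h1 := Finset.sum_nonneg fun k (_ : k ∈ Finset.univ) =>
      Finset.sum_nonneg fun i (_ : i ∈ Finset.univ) =>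
      Finset.sum_nonneg fun j (_ : j ∈ Finset.univ) => hCH0 k i j
    simp only [C₀]; linarith
  let n : ℝ := Fintype.card σ
  let D : ℝ := n * (A * (n * (n * (2 * K * (2 * K) * (C₀ * 2 ^ Fintype.card (σ ⊕ σ))))))
  obtain ⟨s, ⟨⟨⟨⟨⟨h1, h2⟩, h3⟩, h4⟩, h5⟩, h6⟩, hs⟩ :=
    ((((((Filter.eventually_all.2 hMc).and (Filter.eventually_all.2 hMe)).and
      (Filter.eventually_all.2 fun i => Filter.eventually_all.2 (hMa i))).and
      (eventually_mul_le (2 * C₀ * (2 * K)) one_pos)).and (eventually_mul_le 1 one_pos)).and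
      (eventually_mul_le D one_pos)).and self_mem_nhdsWithin |>.exists
  replace hs : 0 < s := hs
  have hs1 : s ≤ 1 := by linarith
  suffices hmain : ∀ d i, nrm s d (ζ i) ≤ 2 * K * s from
    fun i => Conv.of_nrm hs fun d => hmain d i
  intro d
  induction d with
  | zero => intro i; rw [nrm_powerSeries]; simp; positivity
  | succ d ih =>
    intro i
    have hH' : ∀ k i' j', nrm s d (ev ℂ (Sum.elim c fun i => PowerSeries.X ^ N * ζ i)
        (elim_mem_lowIdeal hc hy) (H k i' j')) ≤ C₀ * 2 ^ Fintype.card (σ ⊕ σ) := by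
      intro k i' j'
      have h7 := nrm_ev_le hs.le (Sum.elim c fun i => PowerSeries.X ^ N * ζ i)
        (elim_mem_lowIdeal hc hy) (F := H k i' j') (C := C₀) (ρ := 2 * K * s) (d := d) (q := 0)
        hC1 (fun α => (hCH k i' j' α).trans (pow_le_pow_left₀ (hCH0 k i' j') (hC₀ k i' j') _))
        (lowIdeal_zero _) (fun α _ => nrm_finsuppProd_le hs.le _ (fun i => ?_) α) (by positivity)
        (by linarith)
      · simpa using h7
      · cases i with
        | inl i =>
          refine (h1 i d).trans ?_
          rw [pow_one]
          have := hKc i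
          exact mul_le_mul_of_nonneg_right (by linarith) hs.le
        | inr i => exact (nrm_X_pow_mul_le hs.le hs1 N _).trans (ih i)
    have hQ : ∀ k, nrm s d (∑ i', ∑ j', ζ i' * ζ j' *
        ev ℂ (Sum.elim c fun i => PowerSeries.X ^ N * ζ i) (elim_mem_lowIdeal hc hy)
          (H k i' j')) ≤ n * (n * (2 * K * s * (2 * K * s) *
          (C₀ * 2 ^ Fintype.card (σ ⊕ σ)))) := by
      intro k
      refine (nrm_sum hs.le _ _).trans ?_
      refine (Finset.sum_le_sum fun i' _ => (nrm_sum hs.le _ _).trans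
        (Finset.sum_le_sum fun j' _ => ((nrm_mul hs.le _ _).trans (mul_le_mul ((nrm_mul hs.le _
          _).trans (mul_le_mul (ih i') (ih j') (nrm_nonneg hs.le _) (by positivity))) (hH' k i' j')
          (nrm_nonneg hs.le _) (by positivity))))).trans ?_
      simp [n]
    have hR : nrm s d (∑ k, a i k * ∑ i', ∑ j', ζ i' * ζ j' *
        ev ℂ (Sum.elim c fun i => PowerSeries.X ^ N * ζ i) (elim_mem_lowIdeal hc hy)
          (H k i' j')) ≤ n * (A * (n * (n * (2 * K * s * (2 * K * s) *
          (C₀ * 2 ^ Fintype.card (σ ⊕ σ)))))) := by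
      refine (nrm_sum hs.le _ _).trans ?_
      refine (Finset.sum_le_sum fun k _ => (nrm_mul hs.le _ _).trans (mul_le_mul
        ((h3 i k d).trans (hA i k)) (hQ k) (nrm_nonneg hs.le _) hA1)).trans ?_
      simp [n]
    rw [heq i]
    refine (nrm_sub hs.le _ _).trans ?_
    rw [nrm_X_mul]
    have h8 : nrm s (d + 1) (e i) ≤ K * s := (h2 i _).trans (by
      rw [pow_one]; exact mul_le_mul_of_nonneg_right (hKe i) hs.le)
    have h9 : s * (n * (A * (n * (n * (2 * K * s * (2 * K * s) *
          (C₀ * 2 ^ Fintype.card (σ ⊕ σ))))))) ≤ K * s := by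
      calc _ = (D * s) * (s * s) := by simp only [D]; ring
        _ ≤ 1 * (1 * s) := by gcongr
        _ ≤ K * s := by nlinarith
    have h10 := mul_le_mul_of_nonneg_left hR hs.le
    linarith

theorem tougeron_conv (F : σ → MvPowerSeries σ ℂ) (γ v : σ → PowerSeries S)
    (hγ : ∀ i, γ i ∈ lowIdeal Unit S 1) {q : ℕ} (hJ : ExactOrder q (jac F γ hγ).det)
    (hF : ∀ i, ev ℂ γ hγ (F i) = v i) (hFc : ∀ i, Conv (F i)) (hv : ∀ i, Conv (v i)) :
    ∀ i, Conv (γ i) := by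
  let N := q + 1
  choose c hcc hcγ using fun i => conv_trunc (γ i) (N + 1)
  choose z hz using fun i => powerSeries_mem_lowIdeal.1 (hcγ i)
  let ζ : σ → PowerSeries S := fun i => PowerSeries.X * z i
  have hζ1 : ∀ i, ζ i ∈ lowIdeal Unit S 1 := fun i =>
    powerSeries_mem_lowIdeal.2 (by simp [ζ])
  have hζ : ∀ i, γ i - c i = PowerSeries.X ^ N * ζ i := fun i => by
    rw [hz i, pow_succ, mul_assoc]
  have hc : ∀ i, c i ∈ lowIdeal Unit S 1 := fun i => by
    have := Ideal.sub_mem _ (hγ i) (lowIdeal_mono (by omega) (hcγ i))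
    rwa [sub_sub_cancel] at this
  have hy : ∀ i, PowerSeries.X ^ N * ζ i ∈ lowIdeal Unit S 1 := fun i =>
    Ideal.mul_mem_left _ _ (hζ1 i)
  have hJc : ExactOrder q (jac F c hc).det := hJ.of_sub_mem (lowIdeal_mono (by omega)
    (det_jac_sub_mem (d := N + 1) F γ c hγ hc fun i => by
      rw [← neg_sub]; exact (Ideal.neg_mem_iff _).2 (hcγ i)))
  obtain ⟨u, hu, hdet⟩ := hJc
  obtain ⟨w, hw⟩ := hu.exists_right_inv
  have hJconv : ∀ i j, Conv (jac F c hc i j) := fun i j => ((hFc i).pderiv j).ev c hc hcc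
  have huc : Conv u := by
    have := Conv.det hJconv
    rw [hdet] at this
    exact this.of_X_pow_mul
  have hwc : Conv w := huc.of_mul_eq_one hw
  let a : σ → σ → PowerSeries S := fun i j => w * (jac F c hc).adjugate i j
  have hac : ∀ i j, Conv (a i j) := fun i j => hwc.mul (Conv.adjugate hJconv i j)
  let Q : σ → PowerSeries S := fun k => ∑ i', ∑ j', ζ i' * ζ j' *
    ev ℂ (Sum.elim c fun i => PowerSeries.X ^ N * ζ i) (elim_mem_lowIdeal hc hy)
      (taylorRem (F k) i' j')
  have h1 : ∀ k, v k - ev ℂ c hc (F k) - PowerSeries.X ^ (2 * N) * Q k =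
      PowerSeries.X ^ N * (jac F c hc).mulVec ζ k := by
    intro k
    have h2 := ev_add_taylor c (fun i => PowerSeries.X ^ N * ζ i) hc hy (F k)
    have h3 : ev ℂ (c + fun i => PowerSeries.X ^ N * ζ i) (fun i => Ideal.add_mem _ (hc i) (hy i))
        (F k) = v k := by
      rw [← hF k]
      refine ev_congr ?_ _ _
      ext1 i
      simp [← hζ]
    rw [h3] at h2
    rw [h2]
    have h4 : ∑ i, ∑ j, PowerSeries.X ^ N * ζ i * (PowerSeries.X ^ N * ζ j) *
        ev ℂ (Sum.elim c fun i => PowerSeries.X ^ N * ζ i) (elim_mem_lowIdeal hc hy)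
          (taylorRem (F k) i j) = PowerSeries.X ^ (2 * N) * Q k := by
      simp only [Q, Finset.mul_sum]
      refine Finset.sum_congr rfl fun i _ => Finset.sum_congr rfl fun j _ => ?_
      ring
    have h5 : ∑ i, ev ℂ c hc (pderiv ℂ i (F k)) * (PowerSeries.X ^ N * ζ i) =
        PowerSeries.X ^ N * (jac F c hc).mulVec ζ k := by
      simp only [Matrix.mulVec, dotProduct, Finset.mul_sum, jac, Matrix.of_apply]
      refine Finset.sum_congr rfl fun i _ => ?_
      ring
    rw [h4, h5]
    ring
  let e : σ → PowerSeries S := fun i => ζ i + PowerSeries.X * ∑ k, a i k * Q k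
  have h6 : ∀ i, PowerSeries.X ^ (q + N) * e i = ∑ k, a i k * (v k - ev ℂ c hc (F k)) := by
    intro i
    have h7 : ∑ k, a i k * (jac F c hc).mulVec ζ k = PowerSeries.X ^ q * ζ i := by
      have h8 := congrFun (congrArg (fun A => A.mulVec ζ) (jac F c hc).adjugate_mul) i
      rw [← Matrix.mulVec_mulVec, hdet] at h8
      simp only [Matrix.smul_mulVec, Matrix.one_mulVec, Pi.smul_apply, smul_eq_mul] at h8
      calc ∑ k, a i k * (jac F c hc).mulVec ζ k
          = w * ((jac F c hc).adjugate.mulVec ((jac F c hc).mulVec ζ)) i := by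
            simp only [a, Matrix.mulVec, dotProduct, Finset.mul_sum, mul_assoc]
        _ = PowerSeries.X ^ q * (u * w) * ζ i := by rw [h8]; ring
        _ = _ := by rw [hw, mul_one]
    have h9 : ∑ k, a i k * (v k - ev ℂ c hc (F k)) =
        PowerSeries.X ^ N * ∑ k, a i k * (jac F c hc).mulVec ζ k +
        PowerSeries.X ^ (2 * N) * ∑ k, a i k * Q k := by
      rw [Finset.mul_sum, Finset.mul_sum, ← Finset.sum_add_distrib]
      refine Finset.sum_congr rfl fun k _ => ?_
      rw [mul_left_comm, ← h1 k]
      ring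
    rw [h9, h7]
    have : 2 * N = q + N + 1 := by omega
    rw [this]
    simp only [e]
    ring
  have hec : ∀ i, Conv (e i) := fun i => by
    refine Conv.of_X_pow_mul (q := q + N) ?_
    rw [h6 i]
    exact Conv.sum _ fun k _ => (hac i k).mul ((hv k).sub ((hFc k).ev c hc hcc))
  have hζc := conv_of_fixedPoint (N := N) c e ζ a (fun k i j => taylorRem (F k) i j) hc hy
    (fun i => Ideal.add_mem _ (hζ1 i) (Ideal.mul_mem_right _ _ (X_mem_lowIdeal ()))) hcc hec hac
    (fun k i j => (hFc k).taylorRem i j) (fun i => by simp only [e, Q]; ring)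
  intro i
  have : γ i = c i + PowerSeries.X ^ N * ζ i := by rw [← hζ i]; ring
  rw [this]
  exact (hcc i).add ((Conv.X_pow N).mul (hζc i))

end TougeronConv

section Weights

variable {σ : Type*} [Fintype σ]

/-- The operator `D - w`. -/
noncomputable def shiftOp (D : Derivation ℂ (MvPowerSeries σ ℂ) (MvPowerSeries σ ℂ)) (w : ℂ) :
    Module.End ℂ (MvPowerSeries σ ℂ) := D.toLinearMap - algebraMap ℂ _ w

/-- `g` is a generalized eigenvector of `D` with eigenvalue `w` modulo terms of degree `≥ d`. -/
def GenEig (D : Derivation ℂ (MvPowerSeries σ ℂ) (MvPowerSeries σ ℂ)) (d : ℕ) (w : ℂ)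
    (g : MvPowerSeries σ ℂ) : Prop :=
  ∃ N : ℕ, (shiftOp D w ^ N) g ∈ lowIdeal σ ℂ d

variable {D : Derivation ℂ (MvPowerSeries σ ℂ) (MvPowerSeries σ ℂ)}

theorem shiftOp_apply (w : ℂ) (g : MvPowerSeries σ ℂ) : shiftOp D w g = D g - w • g := by
  simp [shiftOp, Module.algebraMap_end_apply]

theorem aeval_shiftOp (w : ℂ) (N : ℕ) :
    Polynomial.aeval D.toLinearMap ((Polynomial.X - Polynomial.C w) ^ N) = shiftOp D w ^ N := by
  simp [shiftOp]

theorem smul_mem_lowIdeal {d : ℕ} {g : MvPowerSeries σ ℂ} (a : ℂ) (hg : g ∈ lowIdeal σ ℂ d) :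
    a • g ∈ lowIdeal σ ℂ d := by
  rw [smul_eq_C_mul]
  exact Ideal.mul_mem_left _ _ hg

theorem aeval_mem_lowIdeal (hD : ∀ i, D (X i) ∈ lowIdeal σ ℂ 1) (P : Polynomial ℂ) {d : ℕ}
    {g : MvPowerSeries σ ℂ} (hg : g ∈ lowIdeal σ ℂ d) :
    Polynomial.aeval D.toLinearMap P g ∈ lowIdeal σ ℂ d := by
  induction P using Polynomial.induction_on' with
  | add p q hp hq => rw [map_add]; exact Ideal.add_mem _ hp hq
  | monomial n a =>
    rw [Polynomial.aeval_monomial, Module.End.mul_apply, Module.algebraMap_end_apply]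
    refine smul_mem_lowIdeal a ?_
    induction n with
    | zero => simpa using hg
    | succ n ih =>
      rw [pow_succ', Module.End.mul_apply]
      exact derivation_mem_lowIdeal_of_X D hD ih

theorem shiftOp_pow_mem (hD : ∀ i, D (X i) ∈ lowIdeal σ ℂ 1) (w : ℂ) (N : ℕ) {d : ℕ}
    {g : MvPowerSeries σ ℂ} (hg : g ∈ lowIdeal σ ℂ d) :
    (shiftOp D w ^ N) g ∈ lowIdeal σ ℂ d := by
  rw [← aeval_shiftOp]
  exact aeval_mem_lowIdeal hD _ hg

theorem shiftOp_pow_mem_of_le (hD : ∀ i, D (X i) ∈ lowIdeal σ ℂ 1) {w : ℂ} {N N' : ℕ}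
    (h : N ≤ N') {d : ℕ} {g : MvPowerSeries σ ℂ} (hg : (shiftOp D w ^ N) g ∈ lowIdeal σ ℂ d) :
    (shiftOp D w ^ N') g ∈ lowIdeal σ ℂ d := by
  obtain ⟨k, rfl⟩ := Nat.exists_eq_add_of_le' h
  rw [pow_add, Module.End.mul_apply]
  exact shiftOp_pow_mem hD w k hg

theorem GenEig.of_mem {d : ℕ} {w : ℂ} {g : MvPowerSeries σ ℂ} (hg : g ∈ lowIdeal σ ℂ d) :
    GenEig D d w g := ⟨0, by simpa using hg⟩

theorem GenEig.mono {d e : ℕ} {w : ℂ} {g : MvPowerSeries σ ℂ} (hde : d ≤ e)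
    (h : GenEig D e w g) : GenEig D d w g :=
  ⟨h.choose, lowIdeal_mono hde h.choose_spec⟩

theorem GenEig.add (hD : ∀ i, D (X i) ∈ lowIdeal σ ℂ 1) {d : ℕ} {w : ℂ}
    {g h : MvPowerSeries σ ℂ} (hg : GenEig D d w g) (hh : GenEig D d w h) :
    GenEig D d w (g + h) := by
  obtain ⟨a, ha⟩ := hg
  obtain ⟨b, hb⟩ := hh
  refine ⟨max a b, ?_⟩
  rw [map_add]
  exact Ideal.add_mem _ (shiftOp_pow_mem_of_le hD (le_max_left _ _) ha)
    (shiftOp_pow_mem_of_le hD (le_max_right _ _) hb)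

theorem GenEig.smul {d : ℕ} {w : ℂ} {g : MvPowerSeries σ ℂ} (a : ℂ) (hg : GenEig D d w g) :
    GenEig D d w (a • g) := by
  obtain ⟨N, hN⟩ := hg
  exact ⟨N, by rw [map_smul]; exact smul_mem_lowIdeal a hN⟩

theorem GenEig.neg {d : ℕ} {w : ℂ} {g : MvPowerSeries σ ℂ} (hg : GenEig D d w g) :
    GenEig D d w (-g) := by
  simpa using hg.smul (-1)

theorem GenEig.sub (hD : ∀ i, D (X i) ∈ lowIdeal σ ℂ 1) {d : ℕ} {w : ℂ}
    {g h : MvPowerSeries σ ℂ} (hg : GenEig D d w g) (hh : GenEig D d w h) :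
    GenEig D d w (g - h) := by
  rw [sub_eq_add_neg]
  exact hg.add hD hh.neg

theorem GenEig.sum (hD : ∀ i, D (X i) ∈ lowIdeal σ ℂ 1) {d : ℕ} {w : ℂ} {ι : Type*}
    (t : Finset ι) {g : ι → MvPowerSeries σ ℂ} (hg : ∀ i ∈ t, GenEig D d w (g i)) :
    GenEig D d w (∑ i ∈ t, g i) := by
  classical
  induction t using Finset.induction_on with
  | empty => simpa using GenEig.of_mem (Ideal.zero_mem _)
  | insert a t ha ih =>
    rw [Finset.sum_insert ha]
    exact (hg a (Finset.mem_insert_self _ _)).add hD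
      (ih fun i hi => hg i (Finset.mem_insert_of_mem hi))

theorem GenEig.of_congr (hD : ∀ i, D (X i) ∈ lowIdeal σ ℂ 1) {d : ℕ} {w : ℂ}
    {g h : MvPowerSeries σ ℂ} (hg : GenEig D d w g) (hh : h - g ∈ lowIdeal σ ℂ d) :
    GenEig D d w h := by
  have := hg.add hD (GenEig.of_mem hh)
  rwa [add_sub_cancel] at this

theorem shiftOp_pow_mul_mem (hD : ∀ i, D (X i) ∈ lowIdeal σ ℂ 1) {w w' : ℂ}
    {p p' q q' K : ℕ} (h₁ : K ≤ p' + q) (h₂ : K ≤ p + q') (n a b : ℕ) (hn : a + b ≤ n)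
    (g h : MvPowerSeries σ ℂ) (hg : g ∈ lowIdeal σ ℂ p) (hh : h ∈ lowIdeal σ ℂ q)
    (hga : (shiftOp D w ^ a) g ∈ lowIdeal σ ℂ p') (hhb : (shiftOp D w' ^ b) h ∈ lowIdeal σ ℂ q') :
    (shiftOp D (w + w') ^ n) (g * h) ∈ lowIdeal σ ℂ K := by
  induction n generalizing a b g h with
  | zero =>
    obtain ⟨rfl, rfl⟩ : a = 0 ∧ b = 0 := by omega
    simp only [pow_zero, Module.End.one_apply] at *
    exact lowIdeal_mono h₁ (mul_mem_lowIdeal hga hh)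
  | succ n ih =>
    rcases Nat.eq_zero_or_pos a with rfl | ha
    · simp only [pow_zero, Module.End.one_apply] at hga
      exact shiftOp_pow_mem hD _ _ (lowIdeal_mono h₁ (mul_mem_lowIdeal hga hh))
    rcases Nat.eq_zero_or_pos b with rfl | hb
    · simp only [pow_zero, Module.End.one_apply] at hhb
      exact shiftOp_pow_mem hD _ _ (lowIdeal_mono h₂ (mul_mem_lowIdeal hg hhb))
    obtain ⟨a, rfl⟩ := Nat.exists_eq_add_of_lt ha
    obtain ⟨b, rfl⟩ := Nat.exists_eq_add_of_lt hb
    rw [zero_add] at *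
    have h3 : shiftOp D (w + w') (g * h) = shiftOp D w g * h + g * shiftOp D w' h := by
      simp only [shiftOp_apply, Derivation.leibniz, smul_eq_mul, smul_eq_C_mul, map_add]
      ring
    rw [pow_succ, Module.End.mul_apply, h3, map_add]
    refine Ideal.add_mem _ (ih a (b + 1) (by omega) _ _ ?_ hh ?_ hhb)
      (ih (a + 1) b (by omega) _ _ hg ?_ hga ?_)
    · simpa using shiftOp_pow_mem hD w 1 hg
    · rwa [← Module.End.mul_apply, ← pow_succ]
    · simpa using shiftOp_pow_mem hD w' 1 hh
    · rwa [← Module.End.mul_apply, ← pow_succ]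

theorem GenEig.mul (hD : ∀ i, D (X i) ∈ lowIdeal σ ℂ 1) {d : ℕ} {w w' : ℂ}
    {g h : MvPowerSeries σ ℂ} (hg : GenEig D d w g) (hh : GenEig D d w' h) :
    GenEig D d (w + w') (g * h) := by
  obtain ⟨a, ha⟩ := hg
  obtain ⟨b, hb⟩ := hh
  exact ⟨a + b, shiftOp_pow_mul_mem hD (p := 0) (q := 0) (p' := d) (q' := d) (by omega)
    (by omega) _ a b le_rfl g h (lowIdeal_zero _) (lowIdeal_zero _) ha hb⟩

theorem GenEig.mul_graded (hD : ∀ i, D (X i) ∈ lowIdeal σ ℂ 1) {d e : ℕ} {w w' : ℂ}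
    {g h : MvPowerSeries σ ℂ} (hg : GenEig D (d + 1) w g) (hh : GenEig D (e + 1) w' h)
    (hgd : g ∈ lowIdeal σ ℂ d) (hhe : h ∈ lowIdeal σ ℂ e) :
    GenEig D (d + e + 1) (w + w') (g * h) := by
  obtain ⟨a, ha⟩ := hg
  obtain ⟨b, hb⟩ := hh
  exact ⟨a + b, shiftOp_pow_mul_mem hD (p := d) (q := e) (p' := d + 1) (q' := e + 1) (by omega)
    (by omega) _ a b le_rfl g h hgd hhe ha hb⟩

theorem GenEig.one (d : ℕ) : GenEig D d 0 1 := by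
  refine ⟨1, ?_⟩
  simp [shiftOp_apply]

theorem GenEig.comm (V : Derivation ℂ (MvPowerSeries σ ℂ) (MvPowerSeries σ ℂ))
    (hV : ∀ g, V (D g) = D (V g)) {d : ℕ} {w : ℂ} {g : MvPowerSeries σ ℂ}
    (hg : GenEig D (d + 1) w g) : GenEig D d w (V g) := by
  obtain ⟨N, hN⟩ := hg
  refine ⟨N, ?_⟩
  have : ∀ N, (shiftOp D w ^ N) (V g) = V ((shiftOp D w ^ N) g) := by
    intro N
    induction N with
    | zero => simp
    | succ N ih =>
      rw [pow_succ', Module.End.mul_apply, Module.End.mul_apply, ih, shiftOp_apply, shiftOp_apply,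
        map_sub, hV, Derivation.map_smul]
  rw [this]
  exact derivation_mem_lowIdeal V hN

/-- The weight of a monomial. -/
noncomputable def wt (μ : σ → ℂ) : (σ →₀ ℕ) →ₗ[ℕ] ℂ := Finsupp.linearCombination ℕ μ

@[simp]
theorem wt_single (μ : σ → ℂ) (i : σ) (k : ℕ) : wt μ (Finsupp.single i k) = k * μ i := by
  simp [wt]

theorem genEig_monomial (hD : ∀ i, D (X i) ∈ lowIdeal σ ℂ 1) {μ : σ → ℂ}
    (hμ : ∀ d i, GenEig D d (μ i) (X i)) (d : ℕ) (α : σ →₀ ℕ) :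
    GenEig D d (wt μ α) (monomial α 1) := by
  classical
  induction α using Finsupp.induction_linear with
  | zero => simpa using GenEig.one d
  | add a b ha hb =>
    have := ha.mul hD hb
    rwa [monomial_mul_monomial, one_mul, ← map_add] at this
  | single i k =>
    rw [wt_single]
    induction k with
    | zero => simpa using GenEig.one d
    | succ k ih =>
      have := ih.mul hD (hμ d i)
      rw [X, monomial_mul_monomial, one_mul, ← Finsupp.single_add] at this
      convert this using 1
      push_cast; ring

theorem monomial_mem_lowIdeal (α : σ →₀ ℕ) (a : ℂ) :
    monomial α a ∈ lowIdeal σ ℂ α.degree := by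
  classical
  rw [mem_lowIdeal]
  intro β hβ
  rw [coeff_monomial, if_neg]
  rintro rfl
  omega

theorem genEig_monomial_graded (hD : ∀ i, D (X i) ∈ lowIdeal σ ℂ 1) {μ : σ → ℂ}
    (hμ : ∀ i, GenEig D 2 (μ i) (X i)) (α : σ →₀ ℕ) :
    GenEig D (α.degree + 1) (wt μ α) (monomial α 1) := by
  classical
  induction α using Finsupp.induction_linear with
  | zero => simpa using GenEig.one 1
  | add a b ha hb =>
    have := ha.mul_graded hD hb (monomial_mem_lowIdeal _ _) (monomial_mem_lowIdeal _ _)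
    rwa [monomial_mul_monomial, one_mul, ← map_add, ← map_add] at this
  | single i k =>
    rw [wt_single]
    induction k with
    | zero => simpa using GenEig.one 1
    | succ k ih =>
      have := ih.mul_graded (e := 1) hD (hμ i) (monomial_mem_lowIdeal _ _) (X_mem_lowIdeal i)
      rw [X, monomial_mul_monomial, one_mul, ← Finsupp.single_add] at this
      simp only [Finsupp.degree_single] at this ⊢
      convert this using 1
      push_cast; ring

theorem mem_of_genEig_sum (hD : ∀ i, D (X i) ∈ lowIdeal σ ℂ 1) {d : ℕ} {w : ℂ} {ι : Type*}
    (t : Finset ι) (g : ι → MvPowerSeries σ ℂ) (v : ι → ℂ) (hv : ∀ i ∈ t, v i ≠ w)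
    (hg : ∀ i ∈ t, GenEig D d (v i) (g i)) (hw : GenEig D d w (∑ i ∈ t, g i)) :
    ∑ i ∈ t, g i ∈ lowIdeal σ ℂ d := by
  classical
  obtain ⟨N, hN⟩ := hw
  choose! n hn using hg
  let Q : Polynomial ℂ := ∏ i ∈ t, (Polynomial.X - Polynomial.C (v i)) ^ n i
  have hQ : Polynomial.aeval D.toLinearMap Q (∑ i ∈ t, g i) ∈ lowIdeal σ ℂ d := by
    rw [map_sum]
    refine Ideal.sum_mem _ fun i hi => ?_
    have : Q = (∏ i ∈ t.erase i, (Polynomial.X - Polynomial.C (v i)) ^ n i) *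
        (Polynomial.X - Polynomial.C (v i)) ^ n i := (Finset.prod_erase_mul t _ hi).symm
    rw [this, map_mul, Module.End.mul_apply, aeval_shiftOp]
    exact aeval_mem_lowIdeal hD _ (hn i hi)
  have hcop : IsCoprime ((Polynomial.X - Polynomial.C w) ^ N) Q :=
    IsCoprime.pow_left (IsCoprime.prod_right fun i hi => IsCoprime.pow_right
      (Polynomial.isCoprime_X_sub_C_of_isUnit_sub
        (by rw [isUnit_iff_ne_zero, sub_ne_zero]; exact (hv i hi).symm)))
  obtain ⟨a, b, hab⟩ := hcop
  have h1 := congrArg (fun P => Polynomial.aeval D.toLinearMap P (∑ i ∈ t, g i)) hab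
  simp only [map_add, map_mul, map_one, LinearMap.add_apply, Module.End.mul_apply,
    Module.End.one_apply] at h1
  rw [← h1]
  refine Ideal.add_mem _ (aeval_mem_lowIdeal hD a ?_) (aeval_mem_lowIdeal hD b hQ)
  have h2 := aeval_shiftOp (D := D) w N
  rw [map_pow] at h2
  rw [map_pow, h2]
  exact hN

theorem sub_sum_monomial_mem (e : MvPowerSeries σ ℂ) (d : ℕ) :
    e - ∑ α ∈ degLT σ d, coeff α e • monomial α (1 : ℂ) ∈ lowIdeal σ ℂ d := by
  classical
  rw [mem_lowIdeal]
  intro β hβ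
  rw [map_sub, map_sum, Finset.sum_eq_single β]
  · simp
  · intro α _ hα
    rw [map_smul, coeff_monomial, if_neg hα.symm, smul_zero]
  · intro h
    exact absurd (mem_degLT.2 hβ) h

theorem genEig_step (hD : ∀ i, D (X i) ∈ lowIdeal σ ℂ 1) {μ : σ → ℂ}
    (hμ : ∀ i, GenEig D 2 (μ i) (X i)) {d : ℕ} {w : ℂ} {h : MvPowerSeries σ ℂ}
    (hh : GenEig D d w h) : ∃ r ∈ lowIdeal σ ℂ d, GenEig D (d + 1) w (h - r) := by
  obtain ⟨N, hN⟩ := hh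
  have hmon : ∀ α : σ →₀ ℕ, ∃ r ∈ lowIdeal σ ℂ α.degree,
      GenEig D (α.degree + 1) w (monomial α 1 - (shiftOp D w ^ N) r) := by
    intro α
    have h1 := genEig_monomial_graded hD hμ α
    by_cases hw : wt μ α = w
    · exact ⟨0, Ideal.zero_mem _, by simpa [hw] using h1⟩
    · obtain ⟨N', hN'⟩ := h1
      have hcop : IsCoprime ((Polynomial.X - Polynomial.C w) ^ N)
          ((Polynomial.X - Polynomial.C (wt μ α)) ^ N') :=
        IsCoprime.pow (Polynomial.isCoprime_X_sub_C_of_isUnit_sub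
          (by rw [isUnit_iff_ne_zero, sub_ne_zero]; exact Ne.symm hw))
      obtain ⟨a, b, hab⟩ := hcop
      refine ⟨Polynomial.aeval D.toLinearMap a (monomial α 1),
        aeval_mem_lowIdeal hD a (monomial_mem_lowIdeal _ _), ?_⟩
      have h1 := congrArg (fun P => Polynomial.aeval D.toLinearMap P (monomial α (1 : ℂ))) hab
      rw [mul_comm a] at h1
      simp only [map_add, map_mul, aeval_shiftOp, map_one, LinearMap.add_apply,
        Module.End.mul_apply, Module.End.one_apply] at h1
      refine GenEig.of_mem ?_
      rw [← eq_sub_iff_add_eq'] at h1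
      rw [← h1]
      exact aeval_mem_lowIdeal hD b hN'
  choose r hr hr2 using hmon
  set e := (shiftOp D w ^ N) h with he
  refine ⟨∑ α ∈ degLT σ (d + 1), coeff α e • r α, Ideal.sum_mem _ fun α _ => ?_, ?_⟩
  · by_cases hα : α.degree < d
    · rw [mem_lowIdeal.1 hN α hα, zero_smul]; exact Ideal.zero_mem _
    · exact smul_mem_lowIdeal _ (lowIdeal_mono (by omega) (hr α))
  · suffices GenEig D (d + 1) w ((shiftOp D w ^ N)
        (h - ∑ α ∈ degLT σ (d + 1), coeff α e • r α)) by
      obtain ⟨n, hn⟩ := this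
      exact ⟨n + N, by rwa [pow_add, Module.End.mul_apply]⟩
    rw [map_sub, ← he, map_sum]
    have h3 : GenEig D (d + 1) w (∑ α ∈ degLT σ (d + 1),
        coeff α e • (monomial α 1 - (shiftOp D w ^ N) (r α))) := by
      refine GenEig.sum hD _ fun α _ => ?_
      by_cases hα : α.degree < d
      · rw [mem_lowIdeal.1 hN α hα, zero_smul]; exact GenEig.of_mem (Ideal.zero_mem _)
      · exact ((hr2 α).mono (by omega)).smul _
    refine h3.of_congr hD ?_
    have h4 := sub_sum_monomial_mem e (d + 1)
    convert h4 using 1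
    simp only [smul_sub, Finset.sum_sub_distrib, map_smul]
    ring

theorem exists_genEig_coords (hD : ∀ i, D (X i) ∈ lowIdeal σ ℂ 1) {μ : σ → ℂ}
    (hμ : ∀ i, GenEig D 2 (μ i) (X i)) :
    ∃ h : σ → MvPowerSeries σ ℂ, (∀ i, h i - X i ∈ lowIdeal σ ℂ 2) ∧
      ∀ d i, GenEig D d (μ i) (h i) := by
  obtain ⟨h, hh⟩ := exists_limit (τ := σ) (S := ℂ) (fun k c => ∀ i,
    GenEig D (2 + k) (μ i) (c i) ∧ c i - X i ∈ lowIdeal σ ℂ 2) 2 ⟨fun i => X i, by simpa using hμ⟩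
    (by
      intro k c hc
      choose r hr hr2 using fun i => genEig_step hD hμ (hc i).1
      refine ⟨fun i => c i - r i, fun i => ⟨hr2 i, ?_⟩, fun i => ?_⟩
      · have := Ideal.sub_mem _ (hc i).2 (lowIdeal_mono (by omega) (hr i))
        rwa [sub_right_comm] at this
      · rw [sub_sub_cancel_left]
        exact (Ideal.neg_mem_iff _).2 (hr i))
  refine ⟨h, fun i => ?_, fun d i => ?_⟩
  · obtain ⟨c, hc, hc'⟩ := hh 0
    have := Ideal.add_mem _ (hc' i) (hc i).2
    rwa [sub_add_sub_cancel] at this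
  · obtain ⟨c, hc, hc'⟩ := hh d
    exact ((hc i).1.of_congr hD (hc' i)).mono (by omega)

end Weights

section Coords

variable {σ : Type*} [Fintype σ]

theorem mem_lowIdeal_one_of_sub_mem {h : σ → MvPowerSeries σ ℂ}
    (hh : ∀ i, h i - X i ∈ lowIdeal σ ℂ 2) (i : σ) : h i ∈ lowIdeal σ ℂ 1 := by
  have := Ideal.add_mem _ (lowIdeal_mono one_le_two (hh i)) (X_mem_lowIdeal i)
  rwa [sub_add_cancel] at this

theorem algHom_sub_mem (φ : MvPowerSeries σ ℂ →ₐ[ℂ] MvPowerSeries σ ℂ)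
    (hφ : ∀ i, φ (X i) - X i ∈ lowIdeal σ ℂ 2) {d : ℕ} {g : MvPowerSeries σ ℂ}
    (hg : g ∈ lowIdeal σ ℂ d) : φ g - g ∈ lowIdeal σ ℂ (d + 1) := by
  have hφ1 : ∀ i, φ (X i) ∈ lowIdeal σ ℂ 1 :=
    mem_lowIdeal_one_of_sub_mem (h := fun i => φ (X i)) hφ
  have key : ∀ g', φ (∑ j, X j * hadamardQuot pickVar g' j) -
      ∑ j, X j * hadamardQuot pickVar g' j = ∑ j, ((φ (X j) - X j) * φ (hadamardQuot pickVar g' j) +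
        X j * (φ (hadamardQuot pickVar g' j) - hadamardQuot pickVar g' j)) := by
    intro g'
    rw [map_sum, ← Finset.sum_sub_distrib]
    refine Finset.sum_congr rfl fun j _ => ?_
    rw [map_mul]; ring
  induction d generalizing g with
  | zero =>
    rw [mem_lowIdeal_one, map_sub]
    have h1 := constantCoeff_ev (R := ℂ) (fun i => φ (X i)) hφ1 g
    rw [← eq_ev φ hφ1] at h1
    rw [h1]; simp
  | succ d ih =>
    rw [hadamard_of_mem hg, key]
    refine Ideal.sum_mem _ fun j _ => Ideal.add_mem _ ?_ ?_
    · have := mul_mem_lowIdeal (hφ j)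
        (ringHom_mem_lowIdeal φ.toRingHom hφ1 (hadamardQuot_mem_lowIdeal pickVar hg j))
      exact lowIdeal_mono (by omega) this
    · have := mul_mem_lowIdeal (X_mem_lowIdeal (R := ℂ) j)
        (ih (hadamardQuot_mem_lowIdeal pickVar hg j))
      exact lowIdeal_mono (by omega) this

theorem algHom_bijective (φ : MvPowerSeries σ ℂ →ₐ[ℂ] MvPowerSeries σ ℂ)
    (hφ : ∀ i, φ (X i) - X i ∈ lowIdeal σ ℂ 2) : Function.Bijective φ := by
  have hφ1 : ∀ i, φ (X i) ∈ lowIdeal σ ℂ 1 :=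
    mem_lowIdeal_one_of_sub_mem (h := fun i => φ (X i)) hφ
  constructor
  · rw [injective_iff_map_eq_zero]
    intro g hg
    refine eq_zero_of_forall_mem_lowIdeal fun d => ?_
    induction d with
    | zero => exact lowIdeal_zero _
    | succ d ih =>
      have := algHom_sub_mem φ hφ ih
      rw [hg, zero_sub] at this
      exact (Ideal.neg_mem_iff _).1 this
  · intro g
    obtain ⟨γ, hγ⟩ := exists_limit (τ := σ) (S := ℂ) (ι := Unit)
      (fun k c => g - φ (c ()) ∈ lowIdeal σ ℂ k) 0 ⟨0, lowIdeal_zero _⟩ (by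
        intro k c hc
        refine ⟨fun _ => c () + (g - φ (c ())), ?_, fun _ => by simpa using hc⟩
        have := algHom_sub_mem φ hφ hc
        rw [map_add]
        rw [← Ideal.neg_mem_iff] at this
        convert this using 1
        ring)
    refine ⟨γ (), ?_⟩
    rw [eq_comm, ← sub_eq_zero]
    refine eq_zero_of_forall_mem_lowIdeal fun d => ?_
    obtain ⟨c, hc, hc'⟩ := hγ d
    have h2 := ringHom_mem_lowIdeal φ.toRingHom hφ1 (hc' ())
    have h3 := Ideal.sub_mem _ hc (lowIdeal_mono (by omega) h2)
    convert h3 using 1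
    simp

theorem symm_sub_mem (ψ : MvPowerSeries σ ℂ ≃ₐ[ℂ] MvPowerSeries σ ℂ)
    (hψ : ∀ i, ψ (X i) - X i ∈ lowIdeal σ ℂ 2) {d : ℕ} {g : MvPowerSeries σ ℂ} :
    ψ.symm g ∈ lowIdeal σ ℂ d ↔ g ∈ lowIdeal σ ℂ d := by
  have hψ1 : ∀ i, ψ (X i) ∈ lowIdeal σ ℂ 1 :=
    mem_lowIdeal_one_of_sub_mem (h := fun i => ψ (X i)) hψ
  constructor
  · intro h
    have := ringHom_mem_lowIdeal ψ.toAlgHom.toRingHom hψ1 h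
    simpa using this
  · intro h
    induction d with
    | zero => exact lowIdeal_zero _
    | succ d ih =>
      have h1 := ih (lowIdeal_mono (Nat.le_succ d) h)
      have h2 := algHom_sub_mem ψ.toAlgHom hψ h1
      have h3 : ψ.toAlgHom (ψ.symm g) = g := by simp
      rw [h3] at h2
      have := Ideal.sub_mem _ h h2
      rwa [sub_sub_cancel] at this

/-- All monomials of `g` have weight `w`. -/
def HasWeight (μ : σ → ℂ) (w : ℂ) (g : MvPowerSeries σ ℂ) : Prop :=
  ∀ α, coeff α g ≠ 0 → wt μ α = w

theorem hasWeight_of_genEig {D : Derivation ℂ (MvPowerSeries σ ℂ) (MvPowerSeries σ ℂ)}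
    (hD : ∀ i, D (X i) ∈ lowIdeal σ ℂ 1) {μ : σ → ℂ}
    (hμ : ∀ d i, GenEig D d (μ i) (X i)) {w : ℂ} {g : MvPowerSeries σ ℂ}
    (hg : ∀ d, GenEig D d w g) : HasWeight μ w g := by
  classical
  intro α hα
  by_contra hw
  refine hα ?_
  let d := α.degree + 1
  let bad := (degLT σ d).filter fun β => wt μ β ≠ w
  have h1 : GenEig D d w (∑ β ∈ bad, coeff β g • monomial β (1 : ℂ)) := by
    have h2 : GenEig D d w (∑ β ∈ (degLT σ d).filter fun β => wt μ β = w,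
        coeff β g • monomial β (1 : ℂ)) := by
      refine GenEig.sum hD _ fun β hβ => GenEig.smul _ ?_
      have := genEig_monomial hD hμ d β
      rwa [(Finset.mem_filter.1 hβ).2] at this
    refine ((hg d).sub hD h2).of_congr hD ?_
    have h3 := sub_sum_monomial_mem g d
    rw [← Finset.sum_filter_add_sum_filter_not (degLT σ d) (fun β => wt μ β = w)] at h3
    rw [← Ideal.neg_mem_iff] at h3
    convert h3 using 1
    simp only [bad, ne_eq]
    abel
  have h2 := mem_of_genEig_sum hD bad (fun β => coeff β g • monomial β (1 : ℂ)) (fun β => wt μ β)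
    (fun β hβ => (Finset.mem_filter.1 hβ).2)
    (fun β _ => (genEig_monomial hD hμ d β).smul _) h1
  have h3 := mem_lowIdeal.1 h2 α (Nat.lt_succ_self _)
  rw [map_sum, Finset.sum_eq_single α] at h3
  · simpa using h3
  · intro β _ hβ
    rw [map_smul, coeff_monomial, if_neg hβ.symm, smul_zero]
  · intro h
    exact absurd (Finset.mem_filter.2 ⟨mem_degLT.2 (Nat.lt_succ_self _), hw⟩) h

theorem genEig_of_hasWeight {D : Derivation ℂ (MvPowerSeries σ ℂ) (MvPowerSeries σ ℂ)}
    (hD : ∀ i, D (X i) ∈ lowIdeal σ ℂ 1) {μ : σ → ℂ}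
    (hμ : ∀ d i, GenEig D d (μ i) (X i)) {w : ℂ} {g : MvPowerSeries σ ℂ}
    (hg : HasWeight μ w g) (d : ℕ) : GenEig D d w g := by
  refine GenEig.of_congr hD (GenEig.sum hD (degLT σ d)
    (g := fun α => coeff α g • monomial α (1 : ℂ)) fun α _ => ?_) (sub_sum_monomial_mem g d)
  by_cases h : coeff α g = 0
  · rw [h, zero_smul]; exact GenEig.of_mem (Ideal.zero_mem _)
  · have := genEig_monomial hD hμ d α
    rw [hg α h] at this
    exact this.smul _

/-- Conjugation of a derivation by an automorphism. -/
noncomputable def conjDer (ψ : MvPowerSeries σ ℂ ≃ₐ[ℂ] MvPowerSeries σ ℂ)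
    (D : Derivation ℂ (MvPowerSeries σ ℂ) (MvPowerSeries σ ℂ)) :
    Derivation ℂ (MvPowerSeries σ ℂ) (MvPowerSeries σ ℂ) :=
  Derivation.mk' (ψ.symm.toLinearMap ∘ₗ D.toLinearMap ∘ₗ ψ.toLinearMap) fun a b => by
    simp

@[simp]
theorem conjDer_apply (ψ : MvPowerSeries σ ℂ ≃ₐ[ℂ] MvPowerSeries σ ℂ)
    (D : Derivation ℂ (MvPowerSeries σ ℂ) (MvPowerSeries σ ℂ)) (g : MvPowerSeries σ ℂ) :
    conjDer ψ D g = ψ.symm (D (ψ g)) := rfl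

theorem genEig_conjDer (ψ : MvPowerSeries σ ℂ ≃ₐ[ℂ] MvPowerSeries σ ℂ)
    (hψ : ∀ i, ψ (X i) - X i ∈ lowIdeal σ ℂ 2)
    {D : Derivation ℂ (MvPowerSeries σ ℂ) (MvPowerSeries σ ℂ)} {d : ℕ} {w : ℂ}
    {g : MvPowerSeries σ ℂ} : GenEig (conjDer ψ D) d w g ↔ GenEig D d w (ψ g) := by
  have : ∀ N, (shiftOp (conjDer ψ D) w ^ N) g = ψ.symm ((shiftOp D w ^ N) (ψ g)) := by
    intro N
    induction N with
    | zero => simp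
    | succ N ih =>
      rw [pow_succ', Module.End.mul_apply, ih, pow_succ', Module.End.mul_apply, shiftOp_apply,
        shiftOp_apply]
      simp
  simp only [GenEig, this, symm_sub_mem ψ hψ]

theorem exists_normalizing {D : Derivation ℂ (MvPowerSeries σ ℂ) (MvPowerSeries σ ℂ)}
    (hD : ∀ i, D (X i) ∈ lowIdeal σ ℂ 1) {μ : σ → ℂ}
    (hμ : ∀ i, GenEig D 2 (μ i) (X i)) :
    ∃ ψ : MvPowerSeries σ ℂ ≃ₐ[ℂ] MvPowerSeries σ ℂ,
      (∀ i, ψ (X i) - X i ∈ lowIdeal σ ℂ 2) ∧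
      ∀ w g, (∀ d, GenEig D d w (ψ g)) ↔ HasWeight μ w g := by
  obtain ⟨h, hh2, hh⟩ := exists_genEig_coords hD hμ
  have hh1 := mem_lowIdeal_one_of_sub_mem hh2
  let ψ := AlgEquiv.ofBijective (ev ℂ h hh1) (algHom_bijective _ fun i => by simpa using hh2 i)
  have hψX : ∀ i, ψ (X i) = h i := fun i => by simp [ψ]
  have hψ : ∀ i, ψ (X i) - X i ∈ lowIdeal σ ℂ 2 := fun i => by rw [hψX]; exact hh2 i
  have hD' : ∀ i, conjDer ψ D (X i) ∈ lowIdeal σ ℂ 1 := fun i => by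
    rw [conjDer_apply, symm_sub_mem ψ hψ, hψX]
    exact derivation_mem_lowIdeal_of_X D hD (hh1 i)
  have hμ' : ∀ d i, GenEig (conjDer ψ D) d (μ i) (X i) := fun d i => by
    rw [genEig_conjDer ψ hψ, hψX]; exact hh d i
  refine ⟨ψ, hψ, fun w g => ⟨fun hg => hasWeight_of_genEig hD' hμ' fun d => ?_,
    fun hg d => ?_⟩⟩
  · rw [genEig_conjDer ψ hψ]; exact hg d
  · rw [← genEig_conjDer ψ hψ]; exact genEig_of_hasWeight hD' hμ' hg d

end Coords

section WeightRing

/-- The group algebra of `(ℂ, +)`, the ring of formal exponentials. -/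
abbrev WRing : Type := AddMonoidAlgebra ℂ ℂ

/-- The formal exponential of weight `w`. -/
noncomputable def fexp (w : ℂ) : WRing := AddMonoidAlgebra.single w 1

theorem fexp_add (w w' : ℂ) : fexp (w + w') = fexp w * fexp w' := by
  simp [fexp, AddMonoidAlgebra.single_mul_single]

theorem fexp_zero : fexp 0 = 1 := rfl

theorem isUnit_fexp (w : ℂ) : IsUnit (fexp w) :=
  IsUnit.of_mul_eq_one (fexp (-w)) (by rw [← fexp_add, add_neg_cancel, fexp_zero])

theorem fexp_nsmul (k : ℕ) (w : ℂ) : fexp (k • w) = fexp w ^ k := by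
  induction k with
  | zero => simp [fexp_zero]
  | succ k ih => rw [succ_nsmul, fexp_add, ih, pow_succ]

/-- The coefficient of weight `w`. -/
noncomputable def wcoeff (w : ℂ) : WRing →ₗ[ℂ] ℂ where
  toFun x := x.coeff w
  map_add' _ _ := rfl
  map_smul' _ _ := rfl

theorem wcoeff_fexp (w w' : ℂ) : wcoeff w (fexp w') = if w' = w then 1 else 0 :=
  Finsupp.single_apply

theorem wring_ext {x y : WRing} (h : ∀ w, wcoeff w x = wcoeff w y) : x = y :=
  AddMonoidAlgebra.coeff_injective (Finsupp.ext h)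

theorem wring_induction {P : WRing → Prop} (x : WRing) (zero : P 0)
    (add : ∀ x y, P x → P y → P (x + y)) (smul : ∀ (a : ℂ) w, P (a • fexp w)) : P x := by
  refine AddMonoidAlgebra.induction_linear x zero add fun w a => ?_
  have := smul a w
  rwa [fexp, AddMonoidAlgebra.smul_single, smul_eq_mul, mul_one] at this

theorem wcoeff_algebraMap (w a : ℂ) : wcoeff w (algebraMap ℂ WRing a) = if w = 0 then a else 0 := by
  rw [Algebra.algebraMap_eq_smul_one, map_smul, ← fexp_zero, wcoeff_fexp]
  simp [eq_comm]

/-- Multiplication of the weight `w` part by `χ w`. -/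
noncomputable def wscaleLin (χ : ℂ →+ ℂ) : WRing →ₗ[ℂ] WRing where
  toFun x := AddMonoidAlgebra.ofCoeff (Finsupp.onFinset x.coeff.support (fun w => χ w * x.coeff w)
    fun _ hw => Finsupp.mem_support_iff.2 (right_ne_zero_of_mul hw))
  map_add' x y := wring_ext fun w => mul_add (χ w) (x.coeff w) (y.coeff w)
  map_smul' a x := wring_ext fun w => mul_left_comm (χ w) a (x.coeff w)

theorem wcoeff_wscaleLin (χ : ℂ →+ ℂ) (w : ℂ) (x : WRing) :
    wcoeff w (wscaleLin χ x) = χ w * wcoeff w x := rfl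

theorem wscaleLin_fexp (χ : ℂ →+ ℂ) (w : ℂ) : wscaleLin χ (fexp w) = χ w • fexp w := by
  refine wring_ext fun v => ?_
  rw [wcoeff_wscaleLin, map_smul, wcoeff_fexp]
  split_ifs with h
  · rw [h, smul_eq_mul]
  · simp

/-- The derivation multiplying the weight `w` part by `χ w`. -/
noncomputable def wscale (χ : ℂ →+ ℂ) : Derivation ℂ WRing WRing :=
  Derivation.mk' (wscaleLin χ) (by
    intro x y
    induction x using wring_induction with
    | zero => simp
    | add x x' hx hx' => rw [add_mul, map_add, hx, hx', map_add]; simp only [smul_eq_mul]; ring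
    | smul a w =>
      induction y using wring_induction with
      | zero => simp
      | add y y' hy hy' => rw [mul_add, map_add, hy, hy', map_add]; simp only [smul_eq_mul]; ring
      | smul b v =>
        rw [smul_mul_smul_comm, ← fexp_add, map_smul, map_smul, map_smul, wscaleLin_fexp,
          wscaleLin_fexp, wscaleLin_fexp, map_add, fexp_add]
        simp only [smul_eq_mul, Algebra.smul_def, map_mul, map_add]
        ring)

theorem wcoeff_wscale (χ : ℂ →+ ℂ) (w : ℂ) (x : WRing) :
    wcoeff w (wscale χ x) = χ w * wcoeff w x := rfl

theorem wscale_fexp (χ : ℂ →+ ℂ) (w : ℂ) : wscale χ (fexp w) = χ w • fexp w :=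
  wscaleLin_fexp χ w

/-- The `ℓ¹` norm of the coefficients. -/
noncomputable def wnorm (x : WRing) : ℝ := x.coeff.sum fun _ a => ‖a‖

theorem wnorm_eq (x : WRing) {t : Finset ℂ} (ht : x.coeff.support ⊆ t) :
    wnorm x = ∑ w ∈ t, ‖wcoeff w x‖ :=
  Finset.sum_subset ht fun w _ hw => by
    rw [Finsupp.notMem_support_iff.1 hw]; exact norm_zero

theorem wnorm_zero : wnorm 0 = 0 := by simp [wnorm]

theorem wnorm_add (x y : WRing) : wnorm (x + y) ≤ wnorm x + wnorm y := by
  classical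
  rw [wnorm_eq x (t := x.coeff.support ∪ y.coeff.support) Finset.subset_union_left,
    wnorm_eq y (t := x.coeff.support ∪ y.coeff.support) Finset.subset_union_right,
    wnorm_eq (x + y) (t := x.coeff.support ∪ y.coeff.support) Finsupp.support_add,
    ← Finset.sum_add_distrib]
  exact Finset.sum_le_sum fun w _ => by rw [map_add]; exact norm_add_le _ _

theorem wnorm_smul (a : ℂ) (x : WRing) : wnorm (a • x) = ‖a‖ * wnorm x := by
  rw [wnorm_eq x subset_rfl, wnorm_eq (a • x) (t := x.coeff.support) Finsupp.support_smul,
    Finset.mul_sum]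
  simp

theorem wnorm_fexp (w : ℂ) : wnorm (fexp w) = 1 := by
  rw [wnorm, fexp, AddMonoidAlgebra.coeff_single, Finsupp.sum_single_index] <;> simp

theorem wnorm_sum {ι : Type*} (t : Finset ι) (x : ι → WRing) :
    wnorm (∑ i ∈ t, x i) ≤ ∑ i ∈ t, wnorm (x i) := by
  classical
  induction t using Finset.induction_on with
  | empty => simp [wnorm_zero]
  | insert a t ha ih =>
    rw [Finset.sum_insert ha, Finset.sum_insert ha]
    exact (wnorm_add _ _).trans (by gcongr)

theorem wring_eq_sum (x : WRing) : x = ∑ w ∈ x.coeff.support, wcoeff w x • fexp w := by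
  conv_lhs => rw [← AddMonoidAlgebra.sum_coeff_single x]
  refine Finset.sum_congr rfl fun w _ => ?_
  rw [fexp, AddMonoidAlgebra.smul_single, smul_eq_mul, mul_one]
  rfl

theorem wnorm_mul (x y : WRing) : wnorm (x * y) ≤ wnorm x * wnorm y := by
  have h1 : ∀ w, wnorm (fexp w * y) ≤ wnorm y := by
    intro w
    conv_lhs => rw [wring_eq_sum y, Finset.mul_sum]
    refine (wnorm_sum _ _).trans ?_
    rw [wnorm_eq y subset_rfl]
    refine Finset.sum_le_sum fun v _ => ?_
    rw [mul_smul_comm, ← fexp_add, wnorm_smul, wnorm_fexp, mul_one]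
  conv_lhs => rw [wring_eq_sum x, Finset.sum_mul]
  refine (wnorm_sum _ _).trans ?_
  rw [wnorm_eq x subset_rfl, Finset.sum_mul]
  refine Finset.sum_le_sum fun w _ => ?_
  rw [smul_mul_assoc, wnorm_smul]
  gcongr
  exact h1 w

/-- The `ℓ¹` norm as a ring norm. -/
noncomputable def wringNorm : RingNorm WRing where
  toFun := wnorm
  map_zero' := wnorm_zero
  add_le' := wnorm_add
  neg' x := by
    have := wnorm_smul (-1) x
    simpa using this
  mul_le' := wnorm_mul
  eq_zero_of_map_eq_zero' x hx := by
    refine wring_ext fun w => ?_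
    by_cases hw : w ∈ x.coeff.support
    · have := (Finset.sum_eq_zero_iff_of_nonneg (fun _ _ => norm_nonneg _)).1 hx w hw
      exact norm_eq_zero.1 this
    · exact Finsupp.notMem_support_iff.1 hw

noncomputable instance : NormedCommRing WRing :=
  { wringNorm.toNormedRing with mul_comm := mul_comm }

theorem norm_wring (x : WRing) : ‖x‖ = wnorm x := rfl

noncomputable instance : NormedAlgebra ℂ WRing where
  norm_smul_le a x := (wnorm_smul a x).le

instance : NormOneClass WRing := ⟨wnorm_fexp 0⟩

theorem norm_wcoeff_le (w : ℂ) (x : WRing) : ‖wcoeff w x‖ ≤ ‖x‖ := by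
  classical
  rw [norm_wring, wnorm_eq x (t := insert w x.coeff.support) (Finset.subset_insert _ _)]
  exact Finset.single_le_sum (f := fun w => ‖wcoeff w x‖) (fun _ _ => norm_nonneg _)
    (Finset.mem_insert_self _ _)

theorem norm_algebraMap_wring (a : ℂ) : ‖algebraMap ℂ WRing a‖ = ‖a‖ := norm_algebraMap' _ a

end WeightRing

section CoeffDer

variable {τ S : Type*} [CommRing S] [Algebra ℂ S]

/-- Coefficientwise application of a derivation. -/
noncomputable def coeffDer (τ : Type*) (δ : Derivation ℂ S S) :
    Derivation ℂ (MvPowerSeries τ S) (MvPowerSeries τ S) :=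
  Derivation.mk'
    { toFun := fun g => (fun α => δ (coeff α g) : MvPowerSeries τ S)
      map_add' := fun g h => by
        ext α
        exact δ.map_add (coeff α g) (coeff α h)
      map_smul' := fun a g => by
        ext α
        exact δ.map_smul a (coeff α g) } (by
    classical
    intro g h
    ext α
    change δ (coeff α (g * h)) = coeff α (g * _ + h * _)
    rw [map_add, coeff_mul, coeff_mul, mul_comm h, coeff_mul, map_sum, ← Finset.sum_add_distrib]
    refine Finset.sum_congr rfl fun p _ => ?_
    rw [Derivation.leibniz, smul_eq_mul, smul_eq_mul, mul_comm (coeff p.2 h)]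
    rfl)

@[simp]
theorem coeff_coeffDer (δ : Derivation ℂ S S) (g : MvPowerSeries τ S) (α : τ →₀ ℕ) :
    coeff α (coeffDer τ δ g) = δ (coeff α g) := rfl

theorem coeffDer_X (δ : Derivation ℂ S S) (i : τ) : coeffDer τ δ (X i) = 0 := by
  classical
  ext α
  rw [coeff_coeffDer, coeff_X]
  split_ifs <;> simp

theorem coeffDer_comm {δ δ' : Derivation ℂ S S} (h : ∀ x, δ (δ' x) = δ' (δ x))
    (g : MvPowerSeries τ S) : coeffDer τ δ (coeffDer τ δ' g) = coeffDer τ δ' (coeffDer τ δ g) := by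
  ext α
  simp [h]

theorem coeffDer_X_pow_mul (δ : Derivation ℂ S S) (p : ℕ) (g : PowerSeries S) :
    coeffDer Unit δ (PowerSeries.X ^ p * g) = PowerSeries.X ^ p * coeffDer Unit δ g := by
  have h : coeffDer Unit δ (PowerSeries.X ^ p) = 0 := by
    rw [Derivation.leibniz_pow]
    rw [show (PowerSeries.X : PowerSeries S) = X () from rfl, coeffDer_X]
    simp
  rw [Derivation.leibniz, h]
  simp

/-- The chain rule for a derivation of the target. -/
theorem derivation_ev {σ : Type*} [Fintype σ]
    (δ : Derivation ℂ (MvPowerSeries τ S) (MvPowerSeries τ S))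
    (c : σ → MvPowerSeries τ S) (hc : ∀ i, c i ∈ lowIdeal τ S 1) (g : MvPowerSeries σ ℂ) :
    δ (ev ℂ c hc g) = ∑ i, ev ℂ c hc (pderiv ℂ i g) * δ (c i) := by
  have := derivAlong_apply (ev ℂ c hc) (fun i => by simpa using hc i)
    (δ.toLinearMap ∘ₗ (ev ℂ c hc).toLinearMap) (by
      intro g h
      simp) g
  simpa using this

end CoeffDer

section Twist

variable {σ : Type*} [Fintype σ]

theorem coeff_mul_pderiv (j : σ) (F : MvPowerSeries σ ℂ) (α : σ →₀ ℕ) :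
    coeff α (X j * pderiv ℂ j F) = α j * coeff α F := by
  classical
  rw [coeff_X_mul_eq]
  split_ifs with h
  · simp [h]
  · rw [coeff_pderiv]
    have : α - Finsupp.single j 1 + Finsupp.single j 1 = α :=
      tsub_add_cancel_of_le (Finsupp.single_le_iff.2 (Nat.one_le_iff_ne_zero.2 h))
    rw [this]
    have h1 : (α - Finsupp.single j 1 : σ →₀ ℕ) j + 1 = α j := by
      rw [Finsupp.tsub_apply, Finsupp.single_eq_same]
      omega
    rw [mul_comm, ← h1]
    push_cast
    rfl

/-- The diagonal linear derivation multiplying the weight `w` part by `χ w`. -/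
noncomputable def wtDer (μ : σ → ℂ) (χ : ℂ →+ ℂ) :
    Derivation ℂ (MvPowerSeries σ ℂ) (MvPowerSeries σ ℂ) :=
  ∑ j, (χ (μ j) • X j : MvPowerSeries σ ℂ) • pderiv ℂ j

theorem wt_eq_sum (μ : σ → ℂ) (α : σ →₀ ℕ) : wt μ α = ∑ j, α j • μ j := by
  rw [wt, Finsupp.linearCombination_apply, Finsupp.sum_fintype _ _ (by simp)]

theorem coeff_wtDer (μ : σ → ℂ) (χ : ℂ →+ ℂ) (F : MvPowerSeries σ ℂ) (α : σ →₀ ℕ) :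
    coeff α (wtDer μ χ F) = χ (wt μ α) * coeff α F := by
  have : wtDer μ χ F = ∑ j, χ (μ j) • (X j * pderiv ℂ j F) := by
    have h1 : ∀ t : Finset σ, (∑ j ∈ t, (χ (μ j) • X j : MvPowerSeries σ ℂ) • pderiv ℂ j) F =
        ∑ j ∈ t, χ (μ j) • (X j * pderiv ℂ j F) := by
      classical
      intro t
      induction t using Finset.induction_on with
      | empty => simp
      | insert a t ha ih =>
        rw [Finset.sum_insert ha, Finset.sum_insert ha, Derivation.add_apply, ih,
          Derivation.smul_apply, smul_eq_mul, smul_mul_assoc]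
    exact h1 _
  rw [this, map_sum, wt_eq_sum, map_sum, Finset.sum_mul]
  refine Finset.sum_congr rfl fun j _ => ?_
  rw [map_smul, coeff_mul_pderiv, map_nsmul, smul_eq_mul, nsmul_eq_mul]
  ring

/-- The part of weight `w`. -/
noncomputable def wpart (μ : σ → ℂ) (w : ℂ) (F : MvPowerSeries σ ℂ) : MvPowerSeries σ ℂ :=
  fun α => if wt μ α = w then coeff α F else 0

theorem coeff_wpart (μ : σ → ℂ) (w : ℂ) (F : MvPowerSeries σ ℂ) (α : σ →₀ ℕ) :
    coeff α (wpart μ w F) = if wt μ α = w then coeff α F else 0 := rfl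

theorem hasWeight_wpart (μ : σ → ℂ) (w : ℂ) (F : MvPowerSeries σ ℂ) :
    HasWeight μ w (wpart μ w F) := by
  intro α hα
  rw [coeff_wpart] at hα
  by_contra h
  exact hα (if_neg h)

/-- Extension of scalars from `ℂ` to the ring of formal exponentials. -/
noncomputable def inc : PowerSeries ℂ →ₐ[ℂ] PowerSeries WRing :=
  MvPowerSeries.mapAlgHom (Algebra.ofId ℂ WRing)

theorem coeff_inc (g : PowerSeries ℂ) (e : Unit →₀ ℕ) :
    MvPowerSeries.coeff e (inc g) = algebraMap ℂ WRing (MvPowerSeries.coeff e g) := rfl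

theorem inc_mem_lowIdeal {d : ℕ} {g : PowerSeries ℂ} (hg : g ∈ lowIdeal Unit ℂ d) :
    inc g ∈ lowIdeal Unit WRing d :=
  mem_lowIdeal.2 fun α hα => by rw [coeff_inc, mem_lowIdeal.1 hg α hα, map_zero]

/-- Coefficientwise extraction of the weight `w` part. -/
noncomputable def wc (w : ℂ) (g : PowerSeries WRing) : PowerSeries ℂ :=
  (fun e => wcoeff w (MvPowerSeries.coeff e g) : MvPowerSeries Unit ℂ)

theorem coeff_wc (w : ℂ) (g : PowerSeries WRing) (e : Unit →₀ ℕ) :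
    MvPowerSeries.coeff e (wc w g) = wcoeff w (MvPowerSeries.coeff e g) := rfl

theorem wc_inc (g : PowerSeries ℂ) : wc 0 (inc g) = g := by
  ext1 e
  change MvPowerSeries.coeff _ (wc 0 (inc g)) = MvPowerSeries.coeff _ g
  rw [coeff_wc, coeff_inc, wcoeff_algebraMap, if_pos rfl]

theorem conv_wc {w : ℂ} {g : PowerSeries WRing} (hg : Conv g) : Conv (wc w g) := by
  obtain ⟨C, hC, h⟩ := hg
  exact ⟨C, hC, fun α => (norm_wcoeff_le _ _).trans (h α)⟩

theorem conv_inc {g : PowerSeries ℂ} (hg : Conv g) : Conv (inc g) := by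
  obtain ⟨C, hC, h⟩ := hg
  exact ⟨C, hC, fun α => (norm_algebraMap_wring _).le.trans (h α)⟩

/-- The constant series of a formal exponential. -/
noncomputable def Cexp (w : ℂ) : PowerSeries WRing := MvPowerSeries.C (fexp w)

theorem coeff_Cexp_mul (w : ℂ) (g : PowerSeries WRing) (e : Unit →₀ ℕ) :
    MvPowerSeries.coeff e (Cexp w * g) = fexp w * MvPowerSeries.coeff e g := coeff_C_mul _ _ _

theorem Cexp_add (w w' : ℂ) : Cexp (w + w') = Cexp w * Cexp w' := by
  rw [Cexp, fexp_add, map_mul]; rfl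

theorem Cexp_nsmul (k : ℕ) (w : ℂ) : Cexp (k • w) = Cexp w ^ k := by
  rw [Cexp, fexp_nsmul, map_pow]; rfl

theorem Cexp_zero : Cexp 0 = 1 := by rw [Cexp, fexp_zero, map_one]

variable (μ : σ → ℂ) (c : σ → PowerSeries ℂ) (hc : ∀ i, c i ∈ lowIdeal Unit ℂ 1)

theorem twist_mem (i : σ) (hc : ∀ i, c i ∈ lowIdeal Unit ℂ 1) :
    Cexp (μ i) * inc (c i) ∈ lowIdeal Unit WRing 1 :=
  Ideal.mul_mem_left _ _ (inc_mem_lowIdeal (hc i))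

/-- Evaluation along the curve `c` with the coordinates twisted by formal exponentials. -/
noncomputable def twist : MvPowerSeries σ ℂ →ₐ[ℂ] PowerSeries WRing :=
  ev ℂ (fun i => Cexp (μ i) * inc (c i)) fun i => twist_mem μ c i hc

theorem twist_prod (α : σ →₀ ℕ) :
    (α.prod fun i k => (Cexp (μ i) * inc (c i)) ^ k) =
      Cexp (wt μ α) * inc (α.prod fun i k => c i ^ k) := by
  induction α using Finsupp.induction_linear with
  | zero => simp [Cexp_zero]
  | add a b ha hb =>
    rw [Finsupp.prod_add_index' (by simp) (by intros; rw [pow_add]), ha, hb,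
      Finsupp.prod_add_index' (by simp) (by intros; rw [pow_add]), map_add, Cexp_add, map_mul]
    ring
  | single i k =>
    rw [Finsupp.prod_single_index (by simp), Finsupp.prod_single_index (by simp), mul_pow,
      ← Cexp_nsmul, map_pow]
    simp [wt]

theorem coeff_twist (F : MvPowerSeries σ ℂ) (e : Unit →₀ ℕ) {d : ℕ} (hd : e.degree < d) :
    MvPowerSeries.coeff e (twist μ c hc F) = ∑ α ∈ degLT σ d,
      (coeff α F * MvPowerSeries.coeff e (α.prod fun i k => c i ^ k)) • fexp (wt μ α) := by
  rw [twist, coeff_ev _ _ _ _ hd]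
  refine Finset.sum_congr rfl fun α _ => ?_
  rw [twist_prod, coeff_Cexp_mul, coeff_inc, mul_smul, ← Algebra.commutes, ← Algebra.smul_def]

theorem wc_twist (w : ℂ) (F : MvPowerSeries σ ℂ) :
    wc w (twist μ c hc F) = ev ℂ c hc (wpart μ w F) := by
  refine MvPowerSeries.ext fun e => ?_
  rw [coeff_wc, coeff_twist μ c hc F e (Nat.lt_succ_self _),
    coeff_ev _ _ _ _ (Nat.lt_succ_self _), map_sum]
  refine Finset.sum_congr rfl fun α _ => ?_
  rw [map_smul, wcoeff_fexp, coeff_wpart]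
  split_ifs <;> simp

theorem twist_of_hasWeight {w : ℂ} {F : MvPowerSeries σ ℂ} (hF : HasWeight μ w F) :
    twist μ c hc F = Cexp w * inc (ev ℂ c hc F) := by
  refine MvPowerSeries.ext fun e => ?_
  rw [coeff_twist μ c hc F e (Nat.lt_succ_self _), coeff_Cexp_mul, coeff_inc,
    coeff_ev _ _ _ _ (Nat.lt_succ_self _), map_sum, Finset.mul_sum]
  refine Finset.sum_congr rfl fun α _ => ?_
  by_cases h : coeff α F = 0
  · simp [h]
  · rw [hF α h, mul_comm (fexp w), ← Algebra.smul_def, smul_eq_mul]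

theorem coeffDer_twist (χ : ℂ →+ ℂ) (F : MvPowerSeries σ ℂ) :
    coeffDer Unit (wscale χ) (twist μ c hc F) = twist μ c hc (wtDer μ χ F) := by
  refine MvPowerSeries.ext fun e => ?_
  rw [coeff_coeffDer, coeff_twist μ c hc F e (Nat.lt_succ_self _),
    coeff_twist μ c hc _ e (Nat.lt_succ_self _), map_sum]
  refine Finset.sum_congr rfl fun α _ => ?_
  rw [Derivation.map_smul, wscale_fexp, smul_smul, coeff_wtDer]
  congr 1
  ring

/-- The augmentation sending all formal exponentials to `1`. -/
noncomputable def aug : WRing →ₐ[ℂ] ℂ :=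
  AddMonoidAlgebra.lift ℂ ℂ ℂ 1

theorem aug_fexp (w : ℂ) : aug (fexp w) = 1 := by
  simp [aug, fexp]

theorem aug_twist (F : MvPowerSeries σ ℂ) :
    MvPowerSeries.mapAlgHom (σ := Unit) aug (twist μ c hc F) = ev ℂ c hc F := by
  refine MvPowerSeries.ext fun e => ?_
  rw [MvPowerSeries.mapAlgHom_apply, coeff_map]
  change aug _ = _
  rw [coeff_twist μ c hc F e (Nat.lt_succ_self _), coeff_ev _ _ _ _ (Nat.lt_succ_self _), map_sum]
  refine Finset.sum_congr rfl fun α _ => ?_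
  rw [map_smul, aug_fexp, smul_eq_mul, smul_eq_mul, mul_one]

theorem HasWeight.pderiv {μ : σ → ℂ} {w : ℂ} {F : MvPowerSeries σ ℂ} (hF : HasWeight μ w F) (j : σ) :
    HasWeight μ (w - μ j) (pderiv ℂ j F) := by
  intro α hα
  rw [coeff_pderiv] at hα
  have := hF _ (left_ne_zero_of_mul hα)
  rw [map_add, wt_single] at this
  rw [← this]; simp

end Twist

section Torus

variable {σ : Type*} [Fintype σ] (μ : σ → ℂ) (ψ : MvPowerSeries σ ℂ ≃ₐ[ℂ] MvPowerSeries σ ℂ)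
  (hψ : ∀ i, ψ (X i) - X i ∈ lowIdeal σ ℂ 2)
  (c : σ → PowerSeries ℂ) (hc : ∀ i, c i ∈ lowIdeal Unit ℂ 1)

theorem hasWeight_X (i : σ) : HasWeight μ (μ i) (X i) := by
  classical
  intro α hα
  rw [coeff_X] at hα
  split_ifs at hα with h
  · rw [h, wt_single, Nat.cast_one, one_mul]
  · exact absurd rfl hα

theorem curve_mem (hψ : ∀ i, ψ (X i) - X i ∈ lowIdeal σ ℂ 2)
    (hc : ∀ i, c i ∈ lowIdeal Unit ℂ 1) (i : σ) : ev ℂ c hc (ψ (X i)) ∈ lowIdeal Unit ℂ 1 :=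
  ev_mem_lowIdeal c hc (mem_lowIdeal_one_of_sub_mem (h := fun i => ψ (X i)) hψ i)

theorem ev_curve (g : MvPowerSeries σ ℂ) :
    ev ℂ (fun i => ev ℂ c hc (ψ (X i))) (curve_mem ψ c hψ hc) g = ev ℂ c hc (ψ g) := by
  have := algHom_ext_X (ev ℂ (fun i => ev ℂ c hc (ψ (X i))) (curve_mem ψ c hψ hc))
    ((ev ℂ c hc).comp ψ.toAlgHom) (fun i => by simpa using curve_mem ψ c hψ hc i)
    (fun i => by simp)
  rw [this]; rfl

/-- Evaluation along the orbit of the curve `c` under the formal torus action. -/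
noncomputable def torusEv : MvPowerSeries σ ℂ →ₐ[ℂ] PowerSeries WRing :=
  (twist μ (fun i => ev ℂ c hc (ψ (X i))) (curve_mem ψ c hψ hc)).comp ψ.symm.toAlgHom

theorem torusEv_apply (g : MvPowerSeries σ ℂ) : torusEv μ ψ hψ c hc g =
    twist μ (fun i => ev ℂ c hc (ψ (X i))) (curve_mem ψ c hψ hc) (ψ.symm g) := rfl

theorem twist_mem_lowIdeal {d : ℕ} {g : MvPowerSeries σ ℂ} (hg : g ∈ lowIdeal σ ℂ d) :
    twist μ c hc g ∈ lowIdeal Unit WRing d := ev_mem_lowIdeal _ _ hg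

theorem torusEv_mem_lowIdeal {d : ℕ} {g : MvPowerSeries σ ℂ} (hg : g ∈ lowIdeal σ ℂ d) :
    torusEv μ ψ hψ c hc g ∈ lowIdeal Unit WRing d :=
  twist_mem_lowIdeal μ _ (curve_mem ψ c hψ hc) ((symm_sub_mem ψ hψ).2 hg)

theorem torusEv_X_mem (i : σ) : torusEv μ ψ hψ c hc (X i) ∈ lowIdeal Unit WRing 1 :=
  torusEv_mem_lowIdeal μ ψ hψ c hc (X_mem_lowIdeal i)

theorem torusEv_eq_ev : torusEv μ ψ hψ c hc =
    ev ℂ (fun i => torusEv μ ψ hψ c hc (X i)) (torusEv_X_mem μ ψ hψ c hc) :=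
  eq_ev _ (torusEv_X_mem μ ψ hψ c hc)

theorem torusEv_of_hasWeight {w : ℂ} {g : MvPowerSeries σ ℂ} (hg : HasWeight μ w (ψ.symm g)) :
    torusEv μ ψ hψ c hc g = Cexp w * inc (ev ℂ c hc g) := by
  rw [torusEv_apply, twist_of_hasWeight μ _ _ hg, ev_curve ψ hψ, AlgEquiv.apply_symm_apply]

theorem wc_torusEv (w : ℂ) (g : MvPowerSeries σ ℂ) :
    wc w (torusEv μ ψ hψ c hc g) = ev ℂ c hc (ψ (wpart μ w (ψ.symm g))) := by
  rw [torusEv_apply, wc_twist, ev_curve ψ hψ]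

/-- The infinitesimal generators of the formal torus action. -/
noncomputable def torusDer (χ : ℂ →+ ℂ) : Derivation ℂ (MvPowerSeries σ ℂ) (MvPowerSeries σ ℂ) :=
  conjDer ψ.symm (wtDer μ χ)

theorem torusDer_apply (χ : ℂ →+ ℂ) (g : MvPowerSeries σ ℂ) :
    torusDer μ ψ χ g = ψ (wtDer μ χ (ψ.symm g)) := rfl

theorem wtDer_of_hasWeight (χ : ℂ →+ ℂ) {w : ℂ} {F : MvPowerSeries σ ℂ} (hF : HasWeight μ w F) :
    wtDer μ χ F = χ w • F := by
  ext α
  rw [coeff_wtDer, map_smul, smul_eq_mul]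
  by_cases h : coeff α F = 0
  · simp [h]
  · rw [hF α h]

theorem torusDer_of_hasWeight (χ : ℂ →+ ℂ) {w : ℂ} {g : MvPowerSeries σ ℂ}
    (hg : HasWeight μ w (ψ.symm g)) : torusDer μ ψ χ g = χ w • g := by
  rw [torusDer_apply, wtDer_of_hasWeight μ χ hg, map_smul, AlgEquiv.apply_symm_apply]

theorem coeffDer_torusEv (χ : ℂ →+ ℂ) (g : MvPowerSeries σ ℂ) :
    coeffDer Unit (wscale χ) (torusEv μ ψ hψ c hc g) =
      torusEv μ ψ hψ c hc (torusDer μ ψ χ g) := by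
  rw [torusEv_apply, coeffDer_twist, torusEv_apply, torusDer_apply, AlgEquiv.symm_apply_apply]

/-- The twisted partial derivatives along the formal torus action. -/
noncomputable def torusPd (b : σ) : MvPowerSeries σ ℂ →ₗ[ℂ] PowerSeries WRing :=
  ∑ j, LinearMap.mulLeft ℂ (Cexp (μ j) * inc (ev ℂ c hc (pderiv ℂ b (ψ (X j))))) ∘ₗ
    (twist μ (fun i => ev ℂ c hc (ψ (X i))) (curve_mem ψ c hψ hc)).toLinearMap ∘ₗ
      (pderiv ℂ j).toLinearMap ∘ₗ ψ.symm.toLinearMap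

theorem torusPd_apply (b : σ) (g : MvPowerSeries σ ℂ) : torusPd μ ψ hψ c hc b g =
    ∑ j, Cexp (μ j) * inc (ev ℂ c hc (pderiv ℂ b (ψ (X j)))) *
      twist μ (fun i => ev ℂ c hc (ψ (X i))) (curve_mem ψ c hψ hc) (pderiv ℂ j (ψ.symm g)) := by
  simp [torusPd, LinearMap.sum_apply, mul_assoc]

theorem torusPd_mul (b : σ) (g h : MvPowerSeries σ ℂ) :
    torusPd μ ψ hψ c hc b (g * h) = torusEv μ ψ hψ c hc g * torusPd μ ψ hψ c hc b h +
      torusEv μ ψ hψ c hc h * torusPd μ ψ hψ c hc b g := by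
  simp only [torusPd_apply, torusEv_apply, Finset.mul_sum, ← Finset.sum_add_distrib]
  refine Finset.sum_congr rfl fun j _ => ?_
  rw [map_mul, Derivation.leibniz, map_add, smul_eq_mul, smul_eq_mul, map_mul, map_mul]
  ring

theorem torusPd_eq_sum (b : σ) (g : MvPowerSeries σ ℂ) :
    torusPd μ ψ hψ c hc b g =
      ∑ a, torusEv μ ψ hψ c hc (pderiv ℂ a g) * torusPd μ ψ hψ c hc b (X a) :=
  derivAlong_apply _ (torusEv_X_mem μ ψ hψ c hc) _ (torusPd_mul μ ψ hψ c hc b) g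

theorem pderiv_algEquiv (hψ : ∀ i, ψ (X i) - X i ∈ lowIdeal σ ℂ 2) (b : σ)
    (F : MvPowerSeries σ ℂ) :
    pderiv ℂ b (ψ F) = ∑ j, ψ (pderiv ℂ j F) * pderiv ℂ b (ψ (X j)) := by
  have := derivAlong_apply ψ.toAlgHom
    (mem_lowIdeal_one_of_sub_mem (h := fun i => ψ (X i)) hψ)
    ((pderiv ℂ b).toLinearMap ∘ₗ ψ.toLinearMap) (by intro g h; simp) F
  simpa using this

theorem torusPd_of_hasWeight (b : σ) {w : ℂ} {g : MvPowerSeries σ ℂ}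
    (hg : HasWeight μ w (ψ.symm g)) :
    torusPd μ ψ hψ c hc b g = Cexp w * inc (ev ℂ c hc (pderiv ℂ b g)) := by
  rw [torusPd_apply]
  conv_rhs => rw [← ψ.apply_symm_apply g, pderiv_algEquiv ψ hψ]
  rw [map_sum, map_sum, Finset.mul_sum]
  refine Finset.sum_congr rfl fun j _ => ?_
  rw [twist_of_hasWeight μ _ _ (hg.pderiv j), ev_curve ψ hψ, map_mul, map_mul]
  have : Cexp w = Cexp (μ j) * Cexp (w - μ j) := by rw [← Cexp_add]; simp
  rw [this]
  ring

theorem torusPd_X_sub_mem [DecidableEq σ] (a b : σ) :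
    torusPd μ ψ hψ c hc b (X a) - (if a = b then Cexp (μ a) else 0) ∈ lowIdeal Unit WRing 1 := by
  have h1 : torusPd μ ψ hψ c hc b (ψ (X a) - X a) ∈ lowIdeal Unit WRing 1 := by
    rw [torusPd_apply]
    refine Ideal.sum_mem _ fun j _ => Ideal.mul_mem_left _ _ (twist_mem_lowIdeal μ _ _ ?_)
    exact pderiv_mem_lowIdeal j ((symm_sub_mem ψ hψ).2 (hψ a))
  have h2 : torusPd μ ψ hψ c hc b (ψ (X a)) - (if a = b then Cexp (μ a) else 0)
      ∈ lowIdeal Unit WRing 1 := by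
    rw [torusPd_of_hasWeight μ ψ hψ c hc b (w := μ a) (by simpa using hasWeight_X μ a)]
    have h3 : pderiv ℂ b (ψ (X a)) - (if a = b then 1 else 0) ∈ lowIdeal σ ℂ 1 := by
      have := pderiv_mem_lowIdeal b (hψ a)
      rwa [map_sub, pderiv_X, Pi.single_apply] at this
    have h4 := Ideal.mul_mem_left _ (Cexp (μ a)) (inc_mem_lowIdeal (ev_mem_lowIdeal c hc h3))
    convert h4 using 1
    rw [map_sub, map_sub, mul_sub]
    split_ifs <;> simp
  rw [map_sub] at h1
  have := Ideal.sub_mem _ h2 h1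
  convert this using 1
  abel

theorem torusEv_derivation (V : Derivation ℂ (MvPowerSeries σ ℂ) (MvPowerSeries σ ℂ))
    (hV : ∀ j, HasWeight μ (μ j) (ψ.symm (V (ψ (X j))))) (g : MvPowerSeries σ ℂ) :
    torusEv μ ψ hψ c hc (V g) = ∑ b, inc (ev ℂ c hc (V (X b))) * torusPd μ ψ hψ c hc b g := by
  have hev : ((torusEv μ ψ hψ c hc).comp ψ.toAlgHom) = twist μ
      (fun i => ev ℂ c hc (ψ (X i))) (curve_mem ψ c hψ hc) := by
    ext1 F
    change torusEv μ ψ hψ c hc (ψ F) = _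
    rw [torusEv_apply, AlgEquiv.symm_apply_apply]
  have key := derivAlong_ext ((torusEv μ ψ hψ c hc).comp ψ.toAlgHom)
    (fun i => by rw [hev]; exact twist_mem_lowIdeal μ _ _ (X_mem_lowIdeal i))
    ((torusEv μ ψ hψ c hc).toLinearMap ∘ₗ V.toLinearMap ∘ₗ ψ.toLinearMap)
    (∑ b, LinearMap.mulLeft ℂ (inc (ev ℂ c hc (V (X b)))) ∘ₗ torusPd μ ψ hψ c hc b ∘ₗ
      ψ.toLinearMap) (by intro g h; simp)
    (by
      intro g h
      simp only [LinearMap.sum_apply, LinearMap.comp_apply, LinearMap.mulLeft_apply,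
        AlgEquiv.toLinearMap_apply, map_mul, torusPd_mul, Finset.mul_sum,
        ← Finset.sum_add_distrib]
      refine Finset.sum_congr rfl fun j _ => ?_
      change _ = torusEv μ ψ hψ c hc (ψ g) * _ + torusEv μ ψ hψ c hc (ψ h) * _
      ring)
    (by
      intro j
      simp only [LinearMap.sum_apply, LinearMap.comp_apply, LinearMap.mulLeft_apply,
        AlgEquiv.toLinearMap_apply, AlgHom.toLinearMap_apply, Derivation.coeFn_coe]
      rw [torusEv_of_hasWeight μ ψ hψ c hc (hV j), derivation_apply V, map_sum, map_sum,
        Finset.mul_sum]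
      refine Finset.sum_congr rfl fun b _ => ?_
      rw [torusPd_of_hasWeight μ ψ hψ c hc b (w := μ j) (by simpa using hasWeight_X μ j),
        map_mul, map_mul]
      ring)
  have := LinearMap.congr_fun key (ψ.symm g)
  simpa [LinearMap.sum_apply] using this

theorem hasWeight_torusDer (χ : ℂ →+ ℂ) (j : σ) :
    HasWeight μ (μ j) (ψ.symm (torusDer μ ψ χ (ψ (X j)))) := by
  rw [torusDer_of_hasWeight μ ψ χ (w := μ j) (by simpa using hasWeight_X μ j), map_smul,
    AlgEquiv.symm_apply_apply]
  intro α hα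
  refine hasWeight_X μ j α fun h => hα ?_
  rw [map_smul, h, smul_zero]

end Torus

section Multilinear

variable {κ ι σ R : Type*} [Fintype κ] [Fintype ι] [Fintype σ] [DecidableEq κ] [DecidableEq ι]
  [DecidableEq σ] [CommRing R]

theorem multilinear_expand (f : MultilinearMap R (fun _ : ι => σ → R) R) (v : ι → σ → R) :
    f v = ∑ r : ι → σ, (∏ j, v j (r j)) * f fun j => Pi.single (r j) 1 := by
  have h : v = fun j => ∑ b, v j b • (Pi.single b 1 : σ → R) := by
    ext j a
    simp [Finset.sum_apply, Pi.single_apply]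
  conv_lhs => rw [h]
  rw [MultilinearMap.map_sum]
  refine Finset.sum_congr rfl fun r _ => ?_
  rw [MultilinearMap.map_smul_univ, smul_eq_mul]

/-- The matrix whose rows are the given covectors and the coordinate covectors selected by `l`. -/
def selRows (u : κ → σ → R) (l : ι → σ) : Matrix (κ ⊕ ι) σ R :=
  Matrix.of (Sum.elim u fun j => Pi.single (l j) 1)

/-- The columns of `A` selected by `l`. -/
def selCols (A : ι → σ → R) (l : ι → σ) : Matrix ι ι R := Matrix.of fun i j => A i (l j)

theorem det_selCols_expand (A : ι → σ → R) (v : ι → σ → R) :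
    (Matrix.of fun i j => ∑ b, A i b * v j b).det =
      ∑ r : ι → σ, (∏ j, v j (r j)) * (selCols A r).det := by
  have h := multilinear_expand ((Matrix.detRowAlternating (R := R) (n := ι)).toMultilinearMap.compLinearMap
    fun _ => Matrix.mulVecLin (Matrix.of A)) v
  convert h using 1
  · rw [← Matrix.det_transpose]
    rfl
  · refine Finset.sum_congr rfl fun r _ => ?_
    congr 1
    rw [← Matrix.det_transpose]
    refine congrArg Matrix.det ?_
    ext i j
    simp [selCols]

theorem det_selRows_expand (u : κ → κ ⊕ ι → R) (v : ι → κ ⊕ ι → R) :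
    (Matrix.of (Sum.elim u v)).det =
      ∑ r : ι → κ ⊕ ι, (∏ j, v j (r j)) * (selRows u r).det := 
  multilinear_expand ((Matrix.detRowAlternating (R := R) (n := κ ⊕ ι)).toMultilinearMap.currySum u) v

theorem mulVec_eq_zero_of_det {n : Type*} [Fintype n] [DecidableEq n] (M : Matrix n n R)
    (hM : ∀ z : R, M.det * z = 0 → z = 0) {z : n → R} (h : M.mulVec z = 0) : z = 0 := by
  have h1 : (M.adjugate * M).mulVec z = 0 := by rw [← Matrix.mulVec_mulVec, h, Matrix.mulVec_zero]
  rw [Matrix.adjugate_mul, Matrix.smul_mulVec, Matrix.one_mulVec] at h1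
  ext i
  exact hM _ (congrFun h1 i)

/-- The coefficients in Cramer's rule. -/
noncomputable def cramerCoeff (A : ι → σ → R) (l : ι → σ) (y : ι → R) (i : ι) : R :=
  ∑ j, y j * (selCols A l).adjugate j i

theorem cramerCoeff_spec (A : ι → σ → R) (l : ι → σ) (y : ι → R) (j : ι) :
    ∑ i, cramerCoeff A l y i * A i (l j) = (selCols A l).det * y j := by
  have h1 : Matrix.vecMul (Matrix.vecMul y (selCols A l).adjugate) (selCols A l) =
      (selCols A l).det • y := by
    rw [Matrix.vecMul_vecMul, Matrix.adjugate_mul, Matrix.vecMul_smul, Matrix.vecMul_one]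
  exact congrFun h1 j

theorem cramer_of_kernel (u : κ → κ ⊕ ι → R) (A : ι → κ ⊕ ι → R) (l : ι → κ ⊕ ι)
    (hA : ∀ k i, ∑ a, u k a * A i a = 0) (hdet : ∀ z : R, (selRows u l).det * z = 0 → z = 0)
    (y : κ ⊕ ι → R) (hy : ∀ k, ∑ a, u k a * y a = 0) (a : κ ⊕ ι) :
    (selCols A l).det * y a = ∑ i, cramerCoeff A l (fun j => y (l j)) i * A i a := by
  let b := cramerCoeff A l (fun j => y (l j))
  have h := mulVec_eq_zero_of_det (selRows u l) hdet
    (z := fun a => (selCols A l).det * y a - ∑ i, b i * A i a) (by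
      ext s
      rcases s with k | j
      · change ∑ a, u k a * ((selCols A l).det * y a - ∑ i, b i * A i a) = 0
        simp only [mul_sub, Finset.sum_sub_distrib, Finset.mul_sum]
        rw [Finset.sum_comm]
        have h1 : ∀ i, ∑ a, u k a * (b i * A i a) = 0 := fun i => by
          simp only [mul_left_comm _ (b i), ← Finset.mul_sum, hA, mul_zero]
        have h2 : ∑ a, u k a * ((selCols A l).det * y a) = 0 := by
          simp only [mul_left_comm _ (selCols A l).det, ← Finset.mul_sum, hy, mul_zero]
        simp [h1, h2]
      · change ∑ a, (Pi.single (l j) 1 : κ ⊕ ι → R) a *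
          ((selCols A l).det * y a - ∑ i, b i * A i a) = 0
        rw [Finset.sum_eq_single (l j)]
        · rw [Pi.single_eq_same, one_mul, cramerCoeff_spec, sub_self]
        · intro a _ ha
          rw [Pi.single_eq_of_ne ha, zero_mul]
        · simp)
  exact sub_eq_zero.1 (congrFun h a)

/-- Exact orders of expansions dominated by one selection. -/
theorem exactOrder_expand {S : Type*} [CommRing S] {p : ℕ} (d : (ι → σ) → PowerSeries S)
    (l : ι → σ) (hd : ∀ r, d r ∈ lowIdeal Unit S p) (hl : ExactOrder p (d l))
    (v : ι → σ → PowerSeries S) (e : ι → PowerSeries S) (he : ∀ j, IsUnit (e j))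
    (hv : ∀ j b, v j b - (if l j = b then e j else 0) ∈ lowIdeal Unit S 1) :
    ExactOrder p (∑ r : ι → σ, (∏ j, v j (r j)) * d r) := by
  have h1 : ExactOrder p ((∏ j, v j (l j)) * d l) := by
    obtain ⟨w, hw, hw'⟩ := hl
    refine ⟨(∏ j, v j (l j)) * w, ?_, by rw [hw']; ring⟩
    refine IsUnit.mul ?_ hw
    refine IsUnit.prod_univ_iff.2 fun j => ?_
    have h2 := hv j (l j)
    rw [if_pos rfl, mem_lowIdeal_one, map_sub, sub_eq_zero] at h2
    rw [PowerSeries.isUnit_iff_constantCoeff]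
    have h3 := PowerSeries.isUnit_iff_constantCoeff.1 (he j)
    have h4 : PowerSeries.constantCoeff (v j (l j)) = PowerSeries.constantCoeff (e j) := h2
    rwa [h4]
  refine h1.of_sub_mem ?_
  rw [← Finset.add_sum_erase _ _ (Finset.mem_univ l), add_sub_cancel_left]
  refine Ideal.sum_mem _ fun r hr => ?_
  obtain ⟨j, hj⟩ := Function.ne_iff.1 (Finset.ne_of_mem_erase hr)
  have h2 := hv j (r j)
  rw [if_neg (Ne.symm hj), sub_zero] at h2
  have h3 : ∏ j, v j (r j) ∈ lowIdeal Unit S 1 := by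
    rw [← Finset.mul_prod_erase _ _ (Finset.mem_univ j)]
    exact Ideal.mul_mem_right _ _ h2
  rw [add_comm]
  exact mul_mem_lowIdeal h3 (hd r)

theorem ExactOrder.eq_zero_of_mul {S : Type*} [CommRing S] {q : ℕ} {g z : PowerSeries S}
    (hg : ExactOrder q g) (h : g * z = 0) : z = 0 :=
  hg.mul_cancel (by rw [h, mul_zero])

end Multilinear

section PolyDer

variable {S : Type*} [CommRing S] [Algebra ℂ S]

theorem coeff_sum_monomial (δ : Derivation ℂ S S) (p : Polynomial S) (n : ℕ) :
    (∑ i ∈ p.support, Polynomial.monomial i (δ (p.coeff i))).coeff n = δ (p.coeff n) := by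
  rw [Polynomial.finsetSum_coeff]
  simp only [Polynomial.coeff_monomial]
  rw [Finset.sum_ite_eq']
  split_ifs with h
  · rfl
  · rw [Polynomial.notMem_support_iff.1 h, map_zero]

/-- Coefficientwise application of a derivation to polynomials. -/
noncomputable def polyDer (δ : Derivation ℂ S S) : Derivation ℂ (Polynomial S) (Polynomial S) :=
  Derivation.mk'
    { toFun := fun p => ∑ i ∈ p.support, Polynomial.monomial i (δ (p.coeff i))
      map_add' := fun p q => by
        ext n
        rw [Polynomial.coeff_add]
        simp only [coeff_sum_monomial]
        rw [Polynomial.coeff_add, map_add]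
      map_smul' := fun a p => by
        ext n
        rw [Polynomial.coeff_smul]
        simp only [coeff_sum_monomial]
        rw [Polynomial.coeff_smul, Derivation.map_smul]
        rfl } (by
    intro p q
    ext n
    change (∑ i ∈ (p * q).support, Polynomial.monomial i (δ ((p * q).coeff i))).coeff n =
      (p * (∑ i ∈ q.support, Polynomial.monomial i (δ (q.coeff i))) +
        q * (∑ i ∈ p.support, Polynomial.monomial i (δ (p.coeff i)))).coeff n
    rw [coeff_sum_monomial, Polynomial.coeff_add, mul_comm q, Polynomial.coeff_mul,
      Polynomial.coeff_mul, Polynomial.coeff_mul, map_sum, ← Finset.sum_add_distrib]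
    refine Finset.sum_congr rfl fun x _ => ?_
    rw [coeff_sum_monomial, coeff_sum_monomial, Derivation.leibniz, smul_eq_mul, smul_eq_mul,
      mul_comm (q.coeff _)])

@[simp]
theorem coeff_polyDer (δ : Derivation ℂ S S) (p : Polynomial S) (n : ℕ) :
    (polyDer δ p).coeff n = δ (p.coeff n) := coeff_sum_monomial δ p n

theorem polyDer_C (δ : Derivation ℂ S S) (a : S) :
    polyDer δ (Polynomial.C a) = Polynomial.C (δ a) := by
  ext n
  rw [coeff_polyDer, Polynomial.coeff_C, Polynomial.coeff_C]
  split_ifs <;> simp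

/-- The formal derivative as a derivation over the base field. -/
noncomputable def polyDeriv (S : Type*) [CommRing S] [Algebra ℂ S] :
    Derivation ℂ (Polynomial S) (Polynomial S) :=
  (Polynomial.derivative' (R := S)).restrictScalars ℂ

theorem polyDeriv_apply (p : Polynomial S) : polyDeriv S p = Polynomial.derivative p := rfl

theorem polyDer_polyDeriv (δ : Derivation ℂ S S) (p : Polynomial S) :
    polyDer δ (polyDeriv S p) = polyDeriv S (polyDer δ p) := by
  ext n
  rw [coeff_polyDer, polyDeriv_apply, polyDeriv_apply, Polynomial.coeff_derivative,
    Polynomial.coeff_derivative, coeff_polyDer, Derivation.leibniz]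
  have : δ ((n : S) + 1) = 0 := by
    rw [← Nat.cast_add_one, δ.map_natCast]
  rw [this, smul_zero, zero_add, smul_eq_mul, mul_comm]

/-- Evaluation of polynomials, as a homomorphism over the base field. -/
noncomputable def polyEval (x : S) : Polynomial S →ₐ[ℂ] S := (Polynomial.aeval x).restrictScalars ℂ

theorem polyEval_apply (x : S) (p : Polynomial S) : polyEval x p = p.eval x := by
  simp [polyEval, Polynomial.aeval_def, Polynomial.eval₂_eq_eval_map]

theorem polyEval_polyDer (δ : Derivation ℂ S S) {x : S} (hx : δ x = 0) (p : Polynomial S) :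
    polyEval x (polyDer δ p) = δ (polyEval x p) := by
  induction p using Polynomial.induction_on' with
  | add p q hp hq => simp only [map_add, hp, hq]
  | monomial n a =>
    have : polyDer δ (Polynomial.monomial n a) = Polynomial.monomial n (δ a) := by
      ext k
      rw [coeff_polyDer, Polynomial.coeff_monomial, Polynomial.coeff_monomial]
      split_ifs <;> simp
    rw [this, polyEval_apply, polyEval_apply, Polynomial.eval_monomial, Polynomial.eval_monomial,
      Derivation.leibniz, Derivation.leibniz_pow, hx]
    simp [mul_comm]

end PolyDer

section Map

variable {S S' : Type*} [CommRing S] [Algebra ℂ S] [CommRing S'] [Algebra ℂ S']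

theorem map_mem_lowIdeal (θ : S →+* S') {d : ℕ} {g : PowerSeries S}
    (hg : g ∈ lowIdeal Unit S d) : PowerSeries.map θ g ∈ lowIdeal Unit S' d := by
  rw [powerSeries_mem_lowIdeal, PowerSeries.X_pow_dvd_iff] at *
  intro m hm
  rw [PowerSeries.coeff_map, hg m hm, map_zero]

theorem map_ev {σ : Type*} [Finite σ] (θ : S →ₐ[ℂ] S') (c : σ → PowerSeries S)
    (hc : ∀ i, c i ∈ lowIdeal Unit S 1) (g : MvPowerSeries σ ℂ) :
    PowerSeries.map (θ : S →+* S') (ev ℂ c hc g) =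
      ev ℂ (fun i => PowerSeries.map (θ : S →+* S') (c i))
        (fun i => map_mem_lowIdeal (θ : S →+* S') (hc i)) g := by
  have := algHom_ext_X ((MvPowerSeries.mapAlgHom θ).comp (ev ℂ c hc))
    (ev ℂ (fun i => PowerSeries.map (θ : S →+* S') (c i))
      (fun i => map_mem_lowIdeal (θ : S →+* S') (hc i)))
    (fun i => by
      rw [AlgHom.comp_apply, ev_X]
      exact map_mem_lowIdeal (θ : S →+* S') (hc i))
    (fun i => by rw [AlgHom.comp_apply, ev_X, ev_X]; rfl)
  exact DFunLike.congr_fun this g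

theorem map_coeffDer (θ : S →+* S') (δ : Derivation ℂ S S) (δ' : Derivation ℂ S' S')
    (h : ∀ x, θ (δ x) = δ' (θ x)) (g : PowerSeries S) :
    PowerSeries.map θ (coeffDer Unit δ g) = coeffDer Unit δ' (PowerSeries.map θ g) := by
  ext n
  rw [PowerSeries.coeff_map]
  exact h _

end Map

section Frame

variable {κ ι : Type*} [Fintype κ] [Fintype ι] [DecidableEq κ] [DecidableEq ι]
  {S : Type*} [CommRing S] [Algebra ℂ S]
  (f : κ → MvPowerSeries (κ ⊕ ι) ℂ)
  (V : ι → Derivation ℂ (MvPowerSeries (κ ⊕ ι) ℂ) (MvPowerSeries (κ ⊕ ι) ℂ))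
  (γ : κ ⊕ ι → PowerSeries S) (hγ : ∀ a, γ a ∈ lowIdeal Unit S 1)

/-- The components of the vector fields along a curve. -/
noncomputable def frame (i : ι) (a : κ ⊕ ι) : PowerSeries S := ev ℂ γ hγ (V i (X a))

/-- The differentials of the functions along a curve. -/
noncomputable def coframe (k : κ) (a : κ ⊕ ι) : PowerSeries S := ev ℂ γ hγ (pderiv ℂ a (f k))

/-- The map with components the given functions and selected coordinates. -/
noncomputable def selMap (l : ι → κ ⊕ ι) : κ ⊕ ι → MvPowerSeries (κ ⊕ ι) ℂ :=
  Sum.elim f fun j => X (l j)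

theorem jac_selMap (l : ι → κ ⊕ ι) : jac (selMap f l) γ hγ = selRows (coframe f γ hγ) l := by
  refine Matrix.ext fun s a => ?_
  rcases s with k | j
  · rfl
  · change ev ℂ γ hγ (pderiv ℂ a (X (l j))) = (Pi.single (l j) 1 : κ ⊕ ι → _) a
    rw [pderiv_X]
    rcases eq_or_ne a (l j) with h | h
    · subst h; simp
    · rw [Pi.single_eq_of_ne h, Pi.single_eq_of_ne h.symm, map_zero]

theorem coframe_mul_frame (hVf : ∀ i k, V i (f k) = 0) (k : κ) (i : ι) :
    ∑ a, coframe f γ hγ k a * frame V γ hγ i a = 0 := by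
  have h := hVf i k
  rw [derivation_apply] at h
  have h2 := congrArg (ev ℂ γ hγ) h
  rw [map_sum, map_zero] at h2
  simpa [coframe, frame] using h2

theorem exists_frame_coeff (hVf : ∀ i k, V i (f k) = 0) (l : ι → κ ⊕ ι) {p q : ℕ}
    (hq : ExactOrder q (jac (selMap f l) γ hγ).det)
    (hp : ExactOrder p (selCols (frame V γ hγ) l).det)
    (δ : Derivation ℂ (PowerSeries S) (PowerSeries S))
    (hδ : ∀ k, δ (ev ℂ γ hγ (f k)) = 0) :
    ∃ B : ι → PowerSeries S, ∀ a,
      PowerSeries.X ^ p * δ (γ a) = ∑ i, B i * frame V γ hγ i a := by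
  have h1 := cramer_of_kernel (coframe f γ hγ) (frame V γ hγ) l
    (coframe_mul_frame f V γ hγ hVf)
    (fun z hz => hq.eq_zero_of_mul (by rwa [jac_selMap])) (fun a => δ (γ a)) (fun k => by
      have := hδ k
      rwa [derivation_ev] at this)
  obtain ⟨u, hu, hu'⟩ := hp
  obtain ⟨w, hw⟩ := hu.exists_left_inv
  refine ⟨fun i => w * cramerCoeff (frame V γ hγ) l (fun j => δ (γ (l j))) i, fun a => ?_⟩
  have h2 := congrArg (w * ·) (h1 a)
  simp only [Finset.mul_sum, hu'] at h2
  simp only [mul_assoc]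
  rw [← h2]
  linear_combination (-(PowerSeries.X ^ p * δ (γ a))) * hw

theorem det_mul_frame_coeff {R : Type*} [CommRing R] {σ : Type*} (A : ι → σ → R) (l : ι → σ)
    {B : ι → R} {y : ι → R} (h : ∀ j, ∑ i, B i * A i (l j) = y j) (i : ι) :
    (selCols A l).det * B i = ∑ j, y j * (selCols A l).adjugate j i := by
  have h0 : Matrix.vecMul B (selCols A l) = y := funext h
  have h1 : Matrix.vecMul (Matrix.vecMul B (selCols A l)) (selCols A l).adjugate =
      (selCols A l).det • B := by
    rw [Matrix.vecMul_vecMul, Matrix.mul_adjugate, Matrix.vecMul_smul, Matrix.vecMul_one]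
  rw [h0] at h1
  exact (congrFun h1 i).symm

theorem frame_coeff_unique (l : ι → κ ⊕ ι) {p : ℕ}
    (hp : ExactOrder p (selCols (frame V γ hγ) l).det) {B B' : ι → PowerSeries S}
    (h : ∀ a, ∑ i, B i * frame V γ hγ i a = ∑ i, B' i * frame V γ hγ i a) : B = B' := by
  ext1 i
  refine hp.mul_cancel ?_
  rw [det_mul_frame_coeff _ l (fun j => h (l j)), det_mul_frame_coeff _ l (fun j => rfl)]

theorem frame_coeff_comm (hVV : ∀ i j g, V i (V j g) = V j (V i g)) (l : ι → κ ⊕ ι) {p : ℕ}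
    (hp : ExactOrder p (selCols (frame V γ hγ) l).det) {δ δ' : Derivation ℂ S S}
    (hδ : ∀ x, δ (δ' x) = δ' (δ x)) {B B' : ι → PowerSeries S}
    (hB : ∀ a, PowerSeries.X ^ p * coeffDer Unit δ (γ a) = ∑ i, B i * frame V γ hγ i a)
    (hB' : ∀ a, PowerSeries.X ^ p * coeffDer Unit δ' (γ a) = ∑ i, B' i * frame V γ hγ i a) (i : ι) :
    coeffDer Unit δ (B' i) = coeffDer Unit δ' (B i) := by
  have key : ∀ (δ : Derivation ℂ S S) (B : ι → PowerSeries S)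
      (_ : ∀ a, PowerSeries.X ^ p * coeffDer Unit δ (γ a) = ∑ i, B i * frame V γ hγ i a) (i a),
      PowerSeries.X ^ p * coeffDer Unit δ (frame V γ hγ i a) =
        ∑ j, B j * ev ℂ γ hγ (V j (V i (X a))) := by
    intro δ B hB i a
    rw [frame, derivation_ev, Finset.mul_sum]
    simp only [mul_left_comm (PowerSeries.X ^ p), hB, Finset.mul_sum]
    rw [Finset.sum_comm]
    refine Finset.sum_congr rfl fun j _ => ?_
    rw [derivation_apply (V j) (V i (X a)), map_sum, Finset.mul_sum]
    refine Finset.sum_congr rfl fun b _ => ?_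
    rw [map_mul, frame]
    ring
  have h1 : ∀ (δ : Derivation ℂ S S) (B B' : ι → PowerSeries S)
      (_ : ∀ a, PowerSeries.X ^ p * coeffDer Unit δ (γ a) = ∑ i, B i * frame V γ hγ i a) (a),
      PowerSeries.X ^ p * coeffDer Unit δ (∑ i, B' i * frame V γ hγ i a) =
        PowerSeries.X ^ p * (∑ i, coeffDer Unit δ (B' i) * frame V γ hγ i a) +
          ∑ i, ∑ j, B' i * B j * ev ℂ γ hγ (V j (V i (X a))) := by
    intro δ B B' hB a
    rw [map_sum, Finset.mul_sum, Finset.mul_sum, ← Finset.sum_add_distrib]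
    refine Finset.sum_congr rfl fun i _ => ?_
    rw [Derivation.leibniz, smul_eq_mul, smul_eq_mul, mul_add, mul_left_comm, key δ B hB,
      Finset.mul_sum, add_comm]
    simp only [mul_assoc]
    ring
  refine congrFun (frame_coeff_unique V γ hγ l hp (B := fun i => coeffDer Unit δ (B' i))
    (B' := fun i => coeffDer Unit δ' (B i)) fun a => ?_) i
  have h2 := h1 δ B B' hB a
  have h3 := h1 δ' B' B hB' a
  rw [← hB', coeffDer_X_pow_mul] at h2
  rw [← hB, coeffDer_X_pow_mul, ← coeffDer_comm hδ, h2] at h3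
  have h4 : ∑ i, ∑ j, B' i * B j * ev ℂ γ hγ (V j (V i (X a))) =
      ∑ i, ∑ j, B i * B' j * ev ℂ γ hγ (V j (V i (X a))) := by
    rw [Finset.sum_comm]
    refine Finset.sum_congr rfl fun i _ => Finset.sum_congr rfl fun j _ => ?_
    rw [hVV i j, mul_comm (B i)]
  rw [h4] at h3
  exact PowerSeries.X_pow_mul_cancel (add_right_cancel h3)

end Frame

theorem exists_trunc {S : Type*} [CommRing S] (g : PowerSeries S) (N : ℕ) :
    ∃ c : PowerSeries S, (∀ k, N ≤ k → PowerSeries.coeff k c = 0) ∧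
      g - c ∈ lowIdeal Unit S N := by
  refine ⟨(PowerSeries.trunc N g : Polynomial S), fun k hk => ?_, ?_⟩
  · rw [Polynomial.coeff_coe, PowerSeries.coeff_trunc, if_neg (not_lt.2 hk)]
  · rw [powerSeries_mem_lowIdeal, PowerSeries.X_pow_dvd_iff]
    intro m hm
    rw [map_sub, Polynomial.coeff_coe, PowerSeries.coeff_trunc, if_pos hm, sub_self]

theorem conv_of_coeff_eq_zero {S : Type*} [NormedCommRing S] {g : PowerSeries S} {N : ℕ}
    (h : ∀ k, N ≤ k → PowerSeries.coeff k g = 0) : Conv g := by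
  refine conv_of_finite_support (degLT Unit N) fun α hα => ?_
  have : α = Finsupp.single () (α ()) := by ext; simp
  rw [this] at hα ⊢
  rw [mem_degLT, Finsupp.degree_single, not_lt] at hα
  exact h _ hα

theorem Conv.of_exactOrder_mul {S : Type*} [NormedCommRing S] [NormOneClass S] {p : ℕ}
    {D y : PowerSeries S} (hD : Conv D) (hp : ExactOrder p D) (h : Conv (D * y)) : Conv y := by
  obtain ⟨u, hu, rfl⟩ := hp
  obtain ⟨w, hw⟩ := hu.exists_right_inv
  have h1 : Conv w := hD.of_X_pow_mul.of_mul_eq_one hw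
  rw [mul_assoc] at h
  have h2 := h1.mul h.of_X_pow_mul
  rwa [show w * (u * y) = y by rw [← mul_assoc, mul_comm w, hw, one_mul]] at h2

theorem wcoeff_zero_eval {χ : ℂ →+ ℂ} {P Q : Polynomial WRing}
    (h : polyDer (wscale χ) Q = polyDeriv WRing P) :
    wcoeff 0 (polyEval (1 : WRing) P) = wcoeff 0 (polyEval (0 : WRing) P) := by
  have h1 : ∀ n, wcoeff 0 (P.coeff (n + 1)) = 0 := by
    intro n
    have h2 := congrArg (fun R : Polynomial WRing => wcoeff 0 (R.coeff n)) h
    simp only [coeff_polyDer, wcoeff_wscale, map_zero, zero_mul, polyDeriv_apply,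
      Polynomial.coeff_derivative] at h2
    have h3 : P.coeff (n + 1) * ((n : WRing) + 1) = ((n : ℂ) + 1) • P.coeff (n + 1) := by
      rw [Algebra.smul_def, mul_comm, map_add, map_one, map_natCast]
    rw [h3, map_smul, smul_eq_mul] at h2
    exact (mul_eq_zero.1 h2.symm).resolve_left (Nat.cast_add_one_ne_zero n)
  rw [polyEval_apply, polyEval_apply, Polynomial.eval_eq_sum_range, ← Polynomial.coeff_zero_eq_eval_zero,
    Finset.sum_range_succ', map_add, map_sum]
  simp [h1]

section Homotopy

variable {κ ι : Type*} [Fintype κ] [Fintype ι] [DecidableEq κ] [DecidableEq ι]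
  {S : Type*} [CommRing S] [Algebra ℂ S]
  (f : κ → MvPowerSeries (κ ⊕ ι) ℂ)
  (V : ι → Derivation ℂ (MvPowerSeries (κ ⊕ ι) ℂ) (MvPowerSeries (κ ⊕ ι) ℂ))

theorem frame_congr {γ γ' : κ ⊕ ι → PowerSeries S} (h : ∀ a, γ a = γ' a)
    (hγ : ∀ a, γ a ∈ lowIdeal Unit S 1) (hγ' : ∀ a, γ' a ∈ lowIdeal Unit S 1) (i : ι) (a : κ ⊕ ι) :
    frame V γ hγ i a = frame V γ' hγ' i a := by
  obtain rfl := funext h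
  rfl

theorem exactOrder_selCols (l : ι → κ ⊕ ι) (γ γ' : κ ⊕ ι → PowerSeries S)
    (hγ : ∀ a, γ a ∈ lowIdeal Unit S 1) (hγ' : ∀ a, γ' a ∈ lowIdeal Unit S 1) {p : ℕ}
    (h : ∀ a, γ' a - γ a ∈ lowIdeal Unit S (p + 1))
    (hp : ExactOrder p (selCols (frame V γ hγ) l).det) :
    ExactOrder p (selCols (frame V γ' hγ') l).det :=
  hp.of_sub_mem (det_sub_mem _ _ _ fun _ _ => ev_sub_mem γ γ' hγ hγ' h _)

theorem map_frame {S' : Type*} [CommRing S'] [Algebra ℂ S'] (θ : S →ₐ[ℂ] S')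
    (γ : κ ⊕ ι → PowerSeries S) (hγ : ∀ a, γ a ∈ lowIdeal Unit S 1) (i : ι) (a : κ ⊕ ι) :
    PowerSeries.map (θ : S →+* S') (frame V γ hγ i a) =
      frame V (fun a => PowerSeries.map (θ : S →+* S') (γ a))
        (fun a => map_mem_lowIdeal (θ : S →+* S') (hγ a)) i a :=
  map_ev θ γ hγ _

theorem map_jac {S' : Type*} [CommRing S'] [Algebra ℂ S'] (θ : S →ₐ[ℂ] S')
    (F : κ ⊕ ι → MvPowerSeries (κ ⊕ ι) ℂ)
    (γ : κ ⊕ ι → PowerSeries S) (hγ : ∀ a, γ a ∈ lowIdeal Unit S 1) :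
    PowerSeries.map (θ : S →+* S') (jac F γ hγ).det =
      (jac F (fun a => PowerSeries.map (θ : S →+* S') (γ a))
        (fun a => map_mem_lowIdeal (θ : S →+* S') (hγ a))).det := by
  rw [RingHom.map_det]
  refine congrArg Matrix.det (Matrix.ext fun i j => ?_)
  exact map_ev θ γ hγ _

theorem map_selCols {S' : Type*} [CommRing S'] [Algebra ℂ S'] (θ : S →ₐ[ℂ] S') (l : ι → κ ⊕ ι)
    (γ : κ ⊕ ι → PowerSeries S) (hγ : ∀ a, γ a ∈ lowIdeal Unit S 1) :
    PowerSeries.map (θ : S →+* S') (selCols (frame V γ hγ) l).det =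
      (selCols (frame V (fun a => PowerSeries.map (θ : S →+* S') (γ a))
        (fun a => map_mem_lowIdeal (θ : S →+* S') (hγ a))) l).det := by
  rw [RingHom.map_det]
  refine congrArg Matrix.det (Matrix.ext fun i j => ?_)
  exact map_ev θ γ hγ _

/-- The inclusion of constants into polynomials, over the base field. -/
noncomputable def polyC (S : Type*) [CommRing S] [Algebra ℂ S] : S →ₐ[ℂ] Polynomial S :=
  IsScalarTower.toAlgHom ℂ S (Polynomial S)

theorem polyC_apply (x : S) : polyC S x = Polynomial.C x := rfl

theorem map_polyEval_polyC (x : S) (g : PowerSeries S) :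
    PowerSeries.map (polyEval x : Polynomial S →+* S)
      (PowerSeries.map (polyC S : S →+* Polynomial S) g) = g := by
  ext n
  simp [polyC_apply, polyEval_apply]

/-- Deform a curve to one with polynomial selected coordinates, keeping the
values of the functions `f`. -/
theorem exists_homotopy (l : ι → κ ⊕ ι) (γ : κ ⊕ ι → PowerSeries S)
    (hγ : ∀ a, γ a ∈ lowIdeal Unit S 1) {q : ℕ} (p : ℕ)
    (hq : ExactOrder q (jac (selMap f l) γ hγ).det) :
    ∃ (G : κ ⊕ ι → PowerSeries (Polynomial S)) (hG : ∀ a, G a ∈ lowIdeal Unit (Polynomial S) 1)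
      (T : κ ⊕ ι → PowerSeries S) (N : ℕ),
      (∀ a k, N ≤ k → PowerSeries.coeff k (T a) = 0) ∧
      (∀ a, G a - PowerSeries.map (polyC S : S →+* Polynomial S) (γ a) ∈
        lowIdeal Unit (Polynomial S) (p + q + 1)) ∧
      (∀ k, ev ℂ G hG (f k) = PowerSeries.map (polyC S : S →+* Polynomial S) (ev ℂ γ hγ (f k))) ∧
      (∀ j, PowerSeries.map (polyEval (0 : S) : Polynomial S →+* S) (G (l j)) = T (l j)) ∧
      (∀ a, PowerSeries.map (polyEval (1 : S) : Polynomial S →+* S) (G a) = γ a) := by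
  set N := 2 * q + p + 1 with hN
  choose T hT hγT using fun a => exists_trunc (γ a) N
  let ic : PowerSeries S →+* PowerSeries (Polynomial S) :=
    PowerSeries.map (polyC S : S →+* Polynomial S)
  let lam : PowerSeries (Polynomial S) := PowerSeries.C Polynomial.X
  let c : κ ⊕ ι → PowerSeries (Polynomial S) := fun a => ic (T a) + lam * ic (γ a - T a)
  have hiγ : ∀ a, ic (γ a) ∈ lowIdeal Unit (Polynomial S) 1 := fun a => map_mem_lowIdeal _ (hγ a)
  have hdiff : ∀ a, c a - ic (γ a) ∈ lowIdeal Unit (Polynomial S) N := fun a => by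
    have h1 : c a - ic (γ a) = (lam - 1) * ic (γ a - T a) := by
      simp only [c, map_sub]; ring
    rw [h1]
    exact Ideal.mul_mem_left _ _ (map_mem_lowIdeal _ (hγT a))
  have hc : ∀ a, c a ∈ lowIdeal Unit (Polynomial S) 1 := fun a => by
    have := Ideal.add_mem _ (lowIdeal_mono (by omega) (hdiff a)) (hiγ a)
    rwa [sub_add_cancel] at this
  let F := selMap f l
  let v : κ ⊕ ι → PowerSeries (Polynomial S) :=
    Sum.elim (fun k => ic (ev ℂ γ hγ (f k))) fun j => c (l j)
  have hJγ : ExactOrder q (jac F (fun a => ic (γ a)) hiγ).det := by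
    have := hq.map (polyC S : S →+* Polynomial S)
    rwa [map_jac] at this
  have hJ : ExactOrder q (jac F c hc).det :=
    hJγ.of_sub_mem (det_jac_sub_mem F _ c hiγ hc fun a => lowIdeal_mono (by omega) (hdiff a))
  obtain ⟨G, hG, hGc, hGF⟩ := tougeron_exists F c hc v (M := N) (q := q) (by omega) hJ (by
    rintro (k | j)
    · have h1 : v (Sum.inl k) = ev ℂ (fun a => ic (γ a)) hiγ (f k) := map_ev (polyC S) γ hγ (f k)
      rw [h1]
      exact ev_sub_mem _ c hiγ hc hdiff (f k)
    · change ev ℂ c hc (X (l j)) - c (l j) ∈ _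
      rw [ev_X, sub_self]
      exact Ideal.zero_mem _)
  have hGγ : ∀ a, G a - ic (γ a) ∈ lowIdeal Unit (Polynomial S) (p + q + 1) := fun a => by
    have := Ideal.add_mem _ (lowIdeal_mono (show p + q + 1 ≤ N - q by omega) (hGc a))
      (lowIdeal_mono (show p + q + 1 ≤ N by omega) (hdiff a))
    rwa [sub_add_sub_cancel] at this
  have hGl : ∀ j, G (l j) = c (l j) := fun j => by
    have := hGF (Sum.inr j)
    change ev ℂ G hG (X (l j)) = c (l j) at this
    rwa [ev_X] at this
  have hlam : ∀ x : S, PowerSeries.map (polyEval x : Polynomial S →+* S) lam = PowerSeries.C x := by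
    intro x
    simp [lam, polyEval_apply]
  refine ⟨G, hG, T, N, hT, hGγ, fun k => hGF (Sum.inl k), fun j => ?_, ?_⟩
  · rw [hGl, map_add, map_mul, hlam, map_zero, zero_mul, add_zero]
    exact map_polyEval_polyC 0 _
  · have h1 : ∀ a, PowerSeries.map (polyEval (1 : S) : Polynomial S →+* S) (G a) ∈ lowIdeal Unit S 1 :=
      fun a => map_mem_lowIdeal _ (hG a)
    have := tougeron_unique F γ (fun a => PowerSeries.map (polyEval (1 : S) : Polynomial S →+* S) (G a))
      hγ h1 hq (fun a => by
        have h2 := map_mem_lowIdeal (polyEval (1 : S) : Polynomial S →+* S) (hGγ a)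
        rw [map_sub, map_polyEval_polyC] at h2
        exact lowIdeal_mono (by omega) h2) (by
        rintro (k | j)
        · have h2 := congrArg (PowerSeries.map (polyEval (1 : S) : Polynomial S →+* S)) (hGF (Sum.inl k))
          change _ = PowerSeries.map _ (ic _) at h2
          rw [map_ev, map_polyEval_polyC] at h2
          exact h2.symm
        · change ev ℂ γ hγ (X (l j)) = ev ℂ _ h1 (X (l j))
          rw [ev_X, ev_X, hGl, map_add, map_mul, hlam, map_one, one_mul, ← map_add, ← map_add,
            add_sub_cancel]
          exact (map_polyEval_polyC 1 _).symm)
    exact fun a => (congrFun this a).symm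

/-- Convergence of the weight-zero part of the coefficients of an infinitesimal symmetry. -/
theorem conv_frame_coeff (hVf : ∀ i k, V i (f k) = 0) (hVV : ∀ i j g, V i (V j g) = V j (V i g))
    (hfc : ∀ k, Conv (f k)) (hVc : ∀ i a, Conv (V i (X a)))
    (l : ι → κ ⊕ ι) (γ : κ ⊕ ι → PowerSeries WRing) (hγ : ∀ a, γ a ∈ lowIdeal Unit WRing 1)
    {p q : ℕ} (hq : ExactOrder q (jac (selMap f l) γ hγ).det)
    (hp : ExactOrder p (selCols (frame V γ hγ) l).det)
    (χ : ℂ →+ ℂ) (hfγ : ∀ k, Conv (ev ℂ γ hγ (f k)))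
    (hfχ : ∀ k, coeffDer Unit (wscale χ) (ev ℂ γ hγ (f k)) = 0) {A : ι → PowerSeries WRing}
    (hA : ∀ a, PowerSeries.X ^ p * coeffDer Unit (wscale χ) (γ a) =
      ∑ i, A i * frame V γ hγ i a) (i : ι) : Conv (wc 0 (A i)) := by
  obtain ⟨G, hG, T, N, hT, hGγ, hGf, hG0, hG1⟩ := exists_homotopy f l γ hγ p hq
  let δ := polyDer (wscale χ)
  let dl := polyDeriv WRing
  have hicγ : ∀ a, PowerSeries.map (polyC WRing : WRing →+* Polynomial WRing) (γ a) ∈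
      lowIdeal Unit (Polynomial WRing) 1 := fun a => map_mem_lowIdeal _ (hγ a)
  have hpG : ExactOrder p (selCols (frame V G hG) l).det := by
    have h1 := hp.map (polyC WRing : WRing →+* Polynomial WRing)
    rw [map_selCols] at h1
    exact exactOrder_selCols V l _ G hicγ hG (fun a => lowIdeal_mono (by omega) (hGγ a)) h1
  have hqG : ExactOrder q (jac (selMap f l) G hG).det := by
    have h1 := hq.map (polyC WRing : WRing →+* Polynomial WRing)
    rw [map_jac] at h1
    exact h1.of_sub_mem (det_jac_sub_mem _ _ G hicγ hG
      fun a => lowIdeal_mono (by omega) (hGγ a))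
  obtain ⟨B, hB⟩ := exists_frame_coeff f V G hG hVf l hqG hpG (coeffDer Unit δ) (fun k => by
    rw [hGf, ← map_coeffDer (polyC WRing : WRing →+* Polynomial WRing) (wscale χ) δ
      (fun x => (polyDer_C _ x).symm), hfχ, map_zero])
  obtain ⟨B', hB'⟩ := exists_frame_coeff f V G hG hVf l hqG hpG (coeffDer Unit dl) (fun k => by
    rw [hGf]
    ext1 n
    change dl (Polynomial.C _) = 0
    rw [polyDeriv_apply, Polynomial.derivative_C])
  have hcomm := frame_coeff_comm V G hG hVV l hpG (fun x => polyDer_polyDeriv (wscale χ) x) hB hB'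
  have hw : ∀ i, wc 0 (PowerSeries.map (polyEval (1 : WRing) : Polynomial WRing →+* WRing) (B i)) =
      wc 0 (PowerSeries.map (polyEval (0 : WRing) : Polynomial WRing →+* WRing) (B i)) := by
    intro i
    ext1 n
    have h1 := congrArg (PowerSeries.coeff n) (hcomm i)
    exact wcoeff_zero_eval h1
  have hspec : ∀ (x : WRing) (_ : wscale χ x = 0) a, PowerSeries.X ^ p * coeffDer Unit (wscale χ)
      (PowerSeries.map (polyEval x : Polynomial WRing →+* WRing) (G a)) =
      ∑ i, PowerSeries.map (polyEval x : Polynomial WRing →+* WRing) (B i) *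
        frame V (fun a => PowerSeries.map (polyEval x : Polynomial WRing →+* WRing) (G a))
          (fun a => map_mem_lowIdeal _ (hG a)) i a := by
    intro x hx a
    have h1 := congrArg (PowerSeries.map (polyEval x : Polynomial WRing →+* WRing)) (hB a)
    rw [map_mul, map_pow, PowerSeries.map_X,
      map_coeffDer (polyEval x : Polynomial WRing →+* WRing) δ (wscale χ)
      (fun y => polyEval_polyDer _ hx y), map_sum] at h1
    simp only [map_mul, map_frame] at h1
    exact h1
  have hA1 : A = fun i => PowerSeries.map (polyEval (1 : WRing) : Polynomial WRing →+* WRing) (B i) := by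
    refine frame_coeff_unique V γ hγ l hp fun a => ?_
    have h1 := hspec 1 (Derivation.map_one_eq_zero _) a
    rw [hG1, hA] at h1
    rw [h1]
    exact Finset.sum_congr rfl fun i _ => congrArg _ (frame_congr V hG1 _ hγ i a)
  rw [congrFun hA1 i, hw]
  refine conv_wc ?_
  set γ₀ : κ ⊕ ι → PowerSeries WRing :=
    fun a => PowerSeries.map (polyEval (0 : WRing) : Polynomial WRing →+* WRing) (G a) with hγ₀def
  have hγ₀ : ∀ a, γ₀ a ∈ lowIdeal Unit WRing 1 := fun a => map_mem_lowIdeal _ (hG a)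
  have hq0 : ExactOrder q (jac (selMap f l) γ₀ hγ₀).det := by
    have h1 := hqG.map (polyEval (0 : WRing) : Polynomial WRing →+* WRing)
    rwa [map_jac] at h1
  have hp0 : ExactOrder p (selCols (frame V γ₀ hγ₀) l).det := by
    have h1 := hpG.map (polyEval (0 : WRing) : Polynomial WRing →+* WRing)
    rwa [map_selCols] at h1
  have hconv : ∀ a, Conv (γ₀ a) := by
    refine tougeron_conv (selMap f l) γ₀ (Sum.elim (fun k => ev ℂ γ hγ (f k)) fun j => T (l j))
      hγ₀ hq0 ?_ ?_ ?_
    · rintro (k | j)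
      · have h1 := congrArg (PowerSeries.map (polyEval (0 : WRing) : Polynomial WRing →+* WRing)) (hGf k)
        rw [map_ev, map_polyEval_polyC] at h1
        exact h1
      · change ev ℂ γ₀ hγ₀ (X (l j)) = T (l j)
        rw [ev_X]
        exact hG0 j
    · rintro (k | j)
      · exact hfc k
      · exact conv_X _
    · rintro (k | j)
      · exact hfγ k
      · exact conv_of_coeff_eq_zero (hT (l j))
  have hframe : ∀ i a, Conv (frame V γ₀ hγ₀ i a) := fun i a => Conv.ev _ _ (hVc i a) hconv
  have hdet : Conv (selCols (frame V γ₀ hγ₀) l).det := Conv.det fun i j => hframe i (l j)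
  refine hdet.of_exactOrder_mul hp0 ?_
  rw [det_mul_frame_coeff (frame V γ₀ hγ₀) l
    (B := fun i => PowerSeries.map (polyEval (0 : WRing) : Polynomial WRing →+* WRing) (B i))
    (fun j => (hspec 0 (map_zero _) (l j)).symm) i]
  refine Conv.sum _ fun j _ => Conv.mul ?_ (Conv.adjugate (fun i j => hframe i (l j)) j i)
  refine (Conv.X_pow p).mul ?_
  rw [hG0]
  refine conv_of_coeff_eq_zero (N := N) fun k hk => ?_
  change wscale χ (PowerSeries.coeff k (T (l j))) = 0
  rw [hT _ k hk, map_zero]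

end Homotopy

theorem exactOrder_of_ne_zero {D : PowerSeries ℂ} (h : D ≠ 0) :
    ∃ p, ExactOrder p D ∧ p = D.order.toNat := by
  refine ⟨D.order.toNat, ⟨_, ?_, (PowerSeries.X_pow_order_mul_divXPowOrder).symm⟩, rfl⟩
  rw [PowerSeries.isUnit_iff_constantCoeff, isUnit_iff_ne_zero]
  exact (PowerSeries.constantCoeff_divXPowOrder_eq_zero_iff).not.2 h

theorem ExactOrder.inc {p : ℕ} {D : PowerSeries ℂ} (h : ExactOrder p D) :
    ExactOrder p (inc D) :=
  h.map (algebraMap ℂ WRing)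

theorem ExactOrder.of_mul_isUnit {S : Type*} [CommRing S] {p : ℕ} {D u : PowerSeries S}
    (hu : IsUnit u) (h : ExactOrder p (D * u)) : ExactOrder p D := by
  obtain ⟨w, hw, hw'⟩ := h
  obtain ⟨z, hz⟩ := hu.exists_right_inv
  refine ⟨w * z, hw.mul (IsUnit.of_mul_eq_one u (by rwa [mul_comm])), ?_⟩
  calc D = D * u * z := by rw [mul_assoc, hz, mul_one]
    _ = _ := by rw [hw']; ring

theorem isUnit_of_sub_mem {S : Type*} [CommRing S] {u v : PowerSeries S} (hu : IsUnit u)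
    (h : v - u ∈ lowIdeal Unit S 1) : IsUnit v := by
  rw [mem_lowIdeal_one, map_sub, sub_eq_zero] at h
  rw [PowerSeries.isUnit_iff_constantCoeff] at hu ⊢
  have h' : PowerSeries.constantCoeff v = PowerSeries.constantCoeff u := h
  rwa [h']

section Selection

variable {κ ι : Type*} [Fintype κ] [Fintype ι] [DecidableEq κ] [DecidableEq ι]

theorem det_selRows_mul {R : Type*} [CommRing R] (u : κ → κ ⊕ ι → R) (A : ι → κ ⊕ ι → R)
    (hA : ∀ k i, ∑ a, u k a * A i a = 0) (y : κ → κ ⊕ ι → R) (r : ι → κ ⊕ ι) :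
    (selRows u r).det * (Matrix.of (Sum.elim y A)).det =
      (Matrix.of fun k k' => ∑ a, u k a * y k' a).det * (selCols A r).det := by
  have h : selRows u r * (Matrix.of (Sum.elim y A)).transpose =
      Matrix.fromBlocks (Matrix.of fun k k' => ∑ a, u k a * y k' a) 0
        (Matrix.of fun j k' => y k' (r j)) (selCols A r).transpose := by
    refine Matrix.ext fun s s' => ?_
    rw [Matrix.mul_apply]
    rcases s with k | j <;> rcases s' with k' | i
    · rfl
    · exact hA k i
    · change ∑ a, (Pi.single (r j) 1 : κ ⊕ ι → R) a * y k' a = y k' (r j)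
      rw [Finset.sum_eq_single (r j)]
      · simp
      · intro b _ hb
        simp [hb]
      · simp
    · change ∑ a, (Pi.single (r j) 1 : κ ⊕ ι → R) a * A i a = A i (r j)
      rw [Finset.sum_eq_single (r j)]
      · simp
      · intro b _ hb
        simp [hb]
      · simp
  have h2 := congrArg Matrix.det h
  rwa [Matrix.det_mul, Matrix.det_transpose, Matrix.det_fromBlocks_zero₁₂,
    Matrix.det_transpose] at h2

theorem exists_selection (u : κ → κ ⊕ ι → PowerSeries ℂ) (A : ι → κ ⊕ ι → PowerSeries ℂ)
    (hA : ∀ k i, ∑ a, u k a * A i a = 0) (y : κ → κ ⊕ ι → PowerSeries ℂ)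
    (hy : (Matrix.of fun k k' => ∑ a, u k a * y k' a).det ≠ 0)
    (v : ι → κ ⊕ ι → PowerSeries ℂ) (hv : (Matrix.of fun i j => ∑ b, A i b * v j b).det ≠ 0) :
    ∃ (l : ι → κ ⊕ ι) (p q : ℕ), ExactOrder p (selCols A l).det ∧
      ExactOrder q (selRows u l).det ∧ ∀ r : ι → κ ⊕ ι,
        (selCols A r).det ∈ lowIdeal Unit ℂ p ∧ (selRows u r).det ∈ lowIdeal Unit ℂ q := by
  obtain ⟨r₀, hr₀⟩ : ∃ r : ι → κ ⊕ ι, (selCols A r).det ≠ 0 := by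
    by_contra! h
    apply hv
    rw [det_selCols_expand]
    exact Finset.sum_eq_zero fun r _ => by rw [h, mul_zero]
  obtain ⟨l, -, hl⟩ := Finset.exists_min_image Finset.univ
    (fun r : ι → κ ⊕ ι => (selCols A r).det.order) ⟨r₀, Finset.mem_univ _⟩
  have hl0 : (selCols A l).det ≠ 0 := by
    intro h0
    have h1 := hl r₀ (Finset.mem_univ _)
    rw [h0, PowerSeries.order_zero, top_le_iff, PowerSeries.order_eq_top] at h1
    exact hr₀ h1
  obtain ⟨p, hp, hp'⟩ := exactOrder_of_ne_zero hl0
  have hrel := det_selRows_mul u A hA y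
  have hP : (Matrix.of (Sum.elim y A)).det ≠ 0 := by
    intro h
    have := hrel l
    rw [h, mul_zero] at this
    exact mul_ne_zero hy hl0 this.symm
  have hq0 : (selRows u l).det ≠ 0 := by
    intro h
    have := hrel l
    rw [h, zero_mul] at this
    exact mul_ne_zero hy hl0 this.symm
  obtain ⟨q, hq, -⟩ := exactOrder_of_ne_zero hq0
  have hpr : ∀ r, (selCols A r).det ∈ lowIdeal Unit ℂ p := fun r => by
    rw [powerSeries_mem_lowIdeal, PowerSeries.X_pow_dvd_iff]
    intro m hm
    refine PowerSeries.coeff_of_lt_order m (lt_of_lt_of_le ?_ (hl r (Finset.mem_univ _)))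
    rw [hp'] at hm
    rw [← ENat.natCast_toNat ((PowerSeries.order_eq_top).not.2 hl0)]
    exact_mod_cast hm
  refine ⟨l, p, q, hp, hq, fun r => ⟨hpr r, ?_⟩⟩
  have h1 : (selCols A l).det * (selRows u r).det = (selCols A r).det * (selRows u l).det := by
    refine mul_left_cancel₀ (mul_ne_zero hy hP) ?_
    linear_combination (Matrix.of fun k k' => ∑ a, u k a * y k' a).det * (selCols A l).det * hrel r
      - (Matrix.of fun k k' => ∑ a, u k a * y k' a).det * (selCols A r).det * hrel l
  refine hp.mem_of_mul (d := q) ?_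
  rw [h1]
  obtain ⟨w, -, hw⟩ := hq
  exact mul_mem_lowIdeal (hpr r) (powerSeries_mem_lowIdeal.2 ⟨w, hw⟩)

end Selection

section Curve

variable {κ ι : Type*} [Fintype κ] [Fintype ι] [DecidableEq κ] [DecidableEq ι]
  (f : κ → MvPowerSeries (κ ⊕ ι) ℂ)
  (V : ι → Derivation ℂ (MvPowerSeries (κ ⊕ ι) ℂ) (MvPowerSeries (κ ⊕ ι) ℂ))
  (μ : κ ⊕ ι → ℂ) (ψ : MvPowerSeries (κ ⊕ ι) ℂ ≃ₐ[ℂ] MvPowerSeries (κ ⊕ ι) ℂ)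

/-- The infinitesimal generators of the formal torus action converge along convergent curves. -/
theorem conv_torusDer_curve (hψ : ∀ i, ψ (X i) - X i ∈ lowIdeal (κ ⊕ ι) ℂ 2) (hVf : ∀ i k, V i (f k) = 0)
    (hVV : ∀ i j g, V i (V j g) = V j (V i g)) (hfc : ∀ k, Conv (f k))
    (hVc : ∀ i a, Conv (V i (X a))) (hfw : ∀ k, HasWeight μ 0 (ψ.symm (f k)))
    (hVw : ∀ i j, HasWeight μ (μ j) (ψ.symm (V i (ψ (X j)))))
    (c : κ ⊕ ι → PowerSeries ℂ) (hc : ∀ i, c i ∈ lowIdeal Unit ℂ 1) (hcc : ∀ i, Conv (c i))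
    (Y : κ → Derivation ℂ (MvPowerSeries (κ ⊕ ι) ℂ) (MvPowerSeries (κ ⊕ ι) ℂ))
    (hY : ev ℂ c hc (Matrix.of fun k k' => Y k' (f k)).det ≠ 0)
    (g : ι → MvPowerSeries (κ ⊕ ι) ℂ) (hg : ev ℂ c hc (Matrix.of fun i j => V i (g j)).det ≠ 0)
    (χ : ℂ →+ ℂ) (a : κ ⊕ ι) : Conv (ev ℂ c hc (torusDer μ ψ χ (X a))) := by
  let u := coframe f c hc
  let A := frame V c hc
  have hder : ∀ (D : Derivation ℂ (MvPowerSeries (κ ⊕ ι) ℂ) (MvPowerSeries (κ ⊕ ι) ℂ)) h,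
      ev ℂ c hc (D h) = ∑ a, ev ℂ c hc (pderiv ℂ a h) * ev ℂ c hc (D (X a)) := by
    intro D h
    rw [derivation_apply, map_sum]
    simp only [map_mul]
  have hA : ∀ k i, ∑ a, u k a * A i a = 0 := coframe_mul_frame f V c hc hVf
  obtain ⟨l, p, q, hp, hq, hr⟩ := exists_selection u A hA (fun k' a => ev ℂ c hc (Y k' (X a)))
    (by
      rw [AlgHom.map_det] at hY
      convert hY using 3
      ext1 k
      exact fun k' => (hder (Y k') (f k)).symm) (fun j b => ev ℂ c hc (pderiv ℂ b (g j))) (by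
      rw [AlgHom.map_det] at hg
      convert hg using 3
      ext1 i
      refine fun j => Eq.trans ?_ (hder (V i) (g j)).symm
      exact Finset.sum_congr rfl fun b _ => mul_comm _ _)
  let E := torusEv μ ψ hψ c hc
  let Th : (κ ⊕ ι) → MvPowerSeries (κ ⊕ ι) ℂ →ₗ[ℂ] PowerSeries WRing := torusPd μ ψ hψ c hc
  let γ : κ ⊕ ι → PowerSeries WRing := fun a => E (X a)
  have hγ : ∀ a, γ a ∈ lowIdeal Unit WRing 1 := torusEv_X_mem μ ψ hψ c hc
  have hE : ∀ h, ev ℂ γ hγ h = E h := fun h =>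
    (DFunLike.congr_fun (torusEv_eq_ev μ ψ hψ c hc) h).symm
  have hframe : ∀ i a, frame V γ hγ i a = ∑ b, inc (A i b) * Th b (X a) := fun i a =>
    (hE _).trans (torusEv_derivation μ ψ hψ c hc (V i) (hVw i) (X a))
  have hThX : ∀ j b, Th b (X (l j)) - (if l j = b then Cexp (μ (l j)) else 0) ∈
      lowIdeal Unit WRing 1 := fun j b => torusPd_X_sub_mem μ ψ hψ c hc (l j) b
  have hCexp : ∀ w, IsUnit (Cexp w) := fun w => (isUnit_fexp w).map (MvPowerSeries.C)
  have hp' : ExactOrder p (selCols (frame V γ hγ) l).det := by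
    have h1 : selCols (frame V γ hγ) l = Matrix.of fun i j => ∑ b, inc (A i b) * Th b (X (l j)) :=
      Matrix.ext fun i j => hframe i (l j)
    rw [h1, det_selCols_expand (fun i b => inc (A i b)) (fun j b => Th b (X (l j)))]
    have h2 : ∀ r : ι → κ ⊕ ι, (selCols (fun i b => inc (A i b)) r).det = inc (selCols A r).det :=
      fun r => (AlgHom.map_det inc _).symm
    simp only [h2]
    exact exactOrder_expand (fun r => inc (selCols A r).det) l
      (fun r => inc_mem_lowIdeal (hr r).1) hp.inc (fun j b => Th b (X (l j)))
      (fun j => Cexp (μ (l j))) (fun j => hCexp _) hThX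
  have hpd : ∀ b k, inc (u k b) = ∑ a, coframe f γ hγ k a * Th b (X a) := fun b k => by
    have h1 := torusPd_of_hasWeight μ ψ hψ c hc b (hfw k)
    rw [Cexp_zero, one_mul, torusPd_eq_sum] at h1
    refine h1.symm.trans (Finset.sum_congr rfl fun a _ => ?_)
    exact congrArg (· * Th b (X a)) (hE _).symm
  let T : Matrix (κ ⊕ ι) (κ ⊕ ι) (PowerSeries WRing) := Matrix.of fun a b => Th b (X a)
  have hT : IsUnit T.det := by
    have h1 : IsUnit (Matrix.diagonal fun a => Cexp (μ a)).det := by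
      rw [Matrix.det_diagonal]
      exact IsUnit.prod_univ_iff.2 fun a => hCexp _
    refine isUnit_of_sub_mem h1 (det_sub_mem _ _ _ fun a b => ?_)
    rw [Matrix.diagonal_apply]
    exact torusPd_X_sub_mem μ ψ hψ c hc a b
  have hq' : ExactOrder q (jac (selMap f l) γ hγ).det := by
    refine ExactOrder.of_mul_isUnit hT ?_
    have h1 : jac (selMap f l) γ hγ * T =
        Matrix.of (Sum.elim (fun k b => inc (u k b)) fun j b => Th b (X (l j))) := by
      rw [jac_selMap]
      refine Matrix.ext fun s b => ?_
      rw [Matrix.mul_apply]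
      rcases s with k | j
      · exact (hpd b k).symm
      · change ∑ a, (Pi.single (l j) 1 : κ ⊕ ι → PowerSeries WRing) a * Th b (X a) = Th b (X (l j))
        rw [Finset.sum_eq_single (l j)]
        · simp
        · intro a _ ha
          simp [ha]
        · simp
    rw [← Matrix.det_mul, h1, det_selRows_expand]
    have h2 : ∀ r : ι → κ ⊕ ι, (selRows (fun k b => inc (u k b)) r).det = inc (selRows u r).det := by
      intro r
      rw [AlgHom.map_det]
      refine congrArg Matrix.det (Matrix.ext fun s b => ?_)
      rcases s with k | j
      · rfl
      · change (Pi.single (r j) 1 : κ ⊕ ι → PowerSeries WRing) b =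
          inc ((Pi.single (r j) 1 : κ ⊕ ι → PowerSeries ℂ) b)
        rw [Pi.single_apply, Pi.single_apply]
        split_ifs <;> simp
    simp only [h2]
    exact exactOrder_expand (fun r => inc (selRows u r).det) l
      (fun r => inc_mem_lowIdeal (hr r).2) hq.inc (fun j b => Th b (X (l j)))
      (fun j => Cexp (μ (l j))) (fun j => hCexp _) hThX
  have hZf : ∀ k, torusDer μ ψ χ (f k) = 0 := fun k => by
    rw [torusDer_of_hasWeight μ ψ χ (hfw k), map_zero, zero_smul]
  have hcr := cramer_of_kernel u A l hA
    (fun z hz => hq.eq_zero_of_mul hz) (fun a => ev ℂ c hc (torusDer μ ψ χ (X a))) (fun k => by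
      have h1 := hder (torusDer μ ψ χ) (f k)
      rw [hZf, map_zero] at h1
      exact h1.symm)
  obtain ⟨w₀, hw₀, hw₀'⟩ := hp
  obtain ⟨w, hw⟩ := hw₀.exists_left_inv
  let b : ι → PowerSeries ℂ := fun i =>
    w * cramerCoeff A l (fun j => ev ℂ c hc (torusDer μ ψ χ (X (l j)))) i
  have hb : ∀ a, PowerSeries.X ^ p * ev ℂ c hc (torusDer μ ψ χ (X a)) = ∑ i, b i * A i a := by
    intro a
    have h2 := congrArg (w * ·) (hcr a)
    simp only [Finset.mul_sum, hw₀'] at h2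
    simp only [b, mul_assoc]
    rw [← h2]
    linear_combination (-(PowerSeries.X ^ p * ev ℂ c hc (torusDer μ ψ χ (X a)))) * hw
  have hZ : ∀ a, PowerSeries.X ^ p * coeffDer Unit (wscale χ) (γ a) =
      ∑ i, inc (b i) * frame V γ hγ i a := by
    intro a
    have h1 : coeffDer Unit (wscale χ) (γ a) = ∑ b, inc (ev ℂ c hc (torusDer μ ψ χ (X b))) *
        Th b (X a) := by
      rw [← torusEv_derivation μ ψ hψ c hc _ (hasWeight_torusDer μ ψ χ)]
      exact coeffDer_torusEv μ ψ hψ c hc χ (X a)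
    have hX : inc (PowerSeries.X ^ p) = PowerSeries.X ^ p := by
      rw [map_pow]
      congr 1
      exact PowerSeries.map_X _
    rw [h1, Finset.mul_sum]
    simp only [hframe, Finset.mul_sum]
    rw [Finset.sum_comm]
    refine Finset.sum_congr rfl fun b' _ => ?_
    rw [← mul_assoc, ← hX, ← map_mul, hb, map_sum, Finset.sum_mul]
    refine Finset.sum_congr rfl fun i _ => ?_
    rw [map_mul, mul_assoc]
  have hfγ : ∀ k, ev ℂ γ hγ (f k) = inc (ev ℂ c hc (f k)) := fun k => by
    rw [hE]
    have := torusEv_of_hasWeight μ ψ hψ c hc (hfw k)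
    rwa [Cexp_zero, one_mul] at this
  have hfin := conv_frame_coeff f V hVf hVV hfc hVc l γ hγ hq' hp' χ
    (fun k => by rw [hfγ]; exact conv_inc (Conv.ev c hc (hfc k) hcc))
    (fun k => by
      rw [hE]
      refine (coeffDer_torusEv μ ψ hψ c hc χ (f k)).trans ?_
      rw [hZf, map_zero]) hZ
  refine Conv.of_X_pow_mul (q := p) ?_
  rw [hb]
  refine Conv.sum _ fun i _ => Conv.mul ?_ (Conv.ev c hc (hVc i a) hcc)
  have := hfin i
  rwa [wc_inc] at this

end Curve

section Lines

variable {σ : Type*} [Fintype σ]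

/-- Cauchy's estimate for the coefficients of a polynomial in several variables. -/
theorem norm_coeff_mul_pow_le (p : MvPolynomial σ ℂ) {r M : ℝ} (hr : 0 < r)
    (h : ∀ θ : σ → ℂ, (∀ i, ‖θ i‖ = r) → ‖MvPolynomial.eval θ p‖ ≤ M) (α : σ →₀ ℕ) :
    ‖MvPolynomial.coeff α p‖ * r ^ α.degree ≤ M := by
  classical
  obtain ⟨N, hN0, hN⟩ : ∃ N : ℕ, N ≠ 0 ∧ ∀ β ∈ insert α p.support, ∀ i, β i < N := by
    refine ⟨(insert α p.support).sup Finsupp.degree + 1, by omega, fun β hβ i => ?_⟩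
    exact Nat.lt_succ_of_le ((Finsupp.le_degree i β).trans
      (Finset.le_sup (f := Finsupp.degree) hβ))
  set ζ : ℂ := Complex.exp (2 * Real.pi * Complex.I / N) with hζd
  have hζ : IsPrimitiveRoot ζ N := Complex.isPrimitiveRoot_exp N hN0
  have hζ0 : ζ ≠ 0 := hζ.ne_zero hN0
  have hζn : ‖ζ‖ = 1 := hζ.norm'_eq_one hN0
  have hgeom : ∀ a b : ℕ, a < N → b < N →
      ∑ j : Fin N, (ζ ^ a * (ζ ^ b)⁻¹) ^ (j : ℕ) = if a = b then (N : ℂ) else 0 := by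
    intro a b ha hb
    split_ifs with hab
    · subst hab
      simp [mul_inv_cancel₀ (pow_ne_zero a hζ0)]
    · rw [Fin.sum_univ_eq_sum_range (fun j => (ζ ^ a * (ζ ^ b)⁻¹) ^ j) N]
      have hne : ζ ^ a * (ζ ^ b)⁻¹ ≠ 1 := by
        intro h1
        rw [← div_eq_mul_inv, div_eq_one_iff_eq (pow_ne_zero _ hζ0)] at h1
        exact hab (hζ.pow_inj ha hb h1)
      rw [geom_sum_eq hne, mul_pow, inv_pow, ← pow_mul, ← pow_mul, mul_comm a, mul_comm b, pow_mul,
        pow_mul, hζ.pow_eq_one]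
      simp
  have hsum : ∑ j : σ → Fin N, (∏ i, ((ζ ^ α i)⁻¹) ^ (j i : ℕ)) *
      MvPolynomial.eval (fun i => (r : ℂ) * ζ ^ (j i : ℕ)) p =
      (N : ℂ) ^ Fintype.card σ * (MvPolynomial.coeff α p * (r : ℂ) ^ α.degree) := by
    have h1 : ∀ j : σ → Fin N, (∏ i, ((ζ ^ α i)⁻¹) ^ (j i : ℕ)) *
        MvPolynomial.eval (fun i => (r : ℂ) * ζ ^ (j i : ℕ)) p =
        ∑ β ∈ p.support, MvPolynomial.coeff β p * (r : ℂ) ^ β.degree *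
          ∏ i, (ζ ^ β i * (ζ ^ α i)⁻¹) ^ (j i : ℕ) := by
      intro j
      rw [MvPolynomial.eval_eq', Finset.mul_sum]
      refine Finset.sum_congr rfl fun β _ => ?_
      simp only [mul_pow, Finset.prod_mul_distrib, Finset.prod_pow_eq_pow_sum,
        Finsupp.degree_eq_sum, ← pow_mul, mul_comm (β _)]
      ring
    rw [Finset.sum_congr rfl fun j _ => h1 j, Finset.sum_comm]
    have h2 : ∀ β ∈ p.support, ∑ j : σ → Fin N, MvPolynomial.coeff β p * (r : ℂ) ^ β.degree *
          ∏ i, (ζ ^ β i * (ζ ^ α i)⁻¹) ^ (j i : ℕ) =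
        if β = α then (N : ℂ) ^ Fintype.card σ * (MvPolynomial.coeff α p * (r : ℂ) ^ α.degree)
          else 0 := by
      intro β hβ
      rw [← Finset.mul_sum, ← Fintype.prod_sum (fun i (j : Fin N) => (ζ ^ β i * (ζ ^ α i)⁻¹) ^ (j : ℕ))]
      rw [Finset.prod_congr rfl fun i _ => hgeom (β i) (α i)
        (hN β (Finset.mem_insert_of_mem hβ) i) (hN α (Finset.mem_insert_self _ _) i)]
      split_ifs with hβα
      · subst hβα
        simp
        ring
      · obtain ⟨i, hi⟩ : ∃ i, β i ≠ α i := by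
          by_contra hcon
          push Not at hcon
          exact hβα (Finsupp.ext hcon)
        rw [Finset.prod_eq_zero (Finset.mem_univ i) (if_neg hi), mul_zero]
    rw [Finset.sum_congr rfl h2, Finset.sum_ite_eq']
    split_ifs with hα
    · rfl
    · rw [MvPolynomial.notMem_support_iff.1 hα]; simp
  have hle : ‖(N : ℂ) ^ Fintype.card σ * (MvPolynomial.coeff α p * (r : ℂ) ^ α.degree)‖ ≤
      (N : ℝ) ^ Fintype.card σ * M := by
    rw [← hsum]
    refine (norm_sum_le _ _).trans ?_
    have : ∀ j ∈ (Finset.univ : Finset (σ → Fin N)), ‖(∏ i, ((ζ ^ α i)⁻¹) ^ (j i : ℕ)) *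
        MvPolynomial.eval (fun i => (r : ℂ) * ζ ^ (j i : ℕ)) p‖ ≤ M := by
      intro j _
      rw [norm_mul, norm_prod]
      have h1 : ∏ i, ‖((ζ ^ α i)⁻¹) ^ (j i : ℕ)‖ = 1 :=
        Finset.prod_eq_one fun i _ => by simp [hζn]
      rw [h1, one_mul]
      exact h _ fun i => by simp [hζn, abs_of_pos hr]
    refine (Finset.sum_le_card_nsmul _ _ _ this).trans ?_
    simp
  rw [norm_mul, norm_mul, norm_pow, norm_pow, Complex.norm_natCast, Complex.norm_real,
    Real.norm_of_nonneg hr.le] at hle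
  exact le_of_mul_le_mul_left hle (by positivity)

/-- The homogeneous part of degree `k` of a power series. -/
noncomputable def hpart (F : MvPowerSeries σ ℂ) (k : ℕ) : MvPolynomial σ ℂ :=
  ∑ α ∈ degLT σ (k + 1) with α.degree = k, MvPolynomial.monomial α (coeff α F)

theorem coeff_hpart (F : MvPowerSeries σ ℂ) (α : σ →₀ ℕ) :
    MvPolynomial.coeff α (hpart F α.degree) = coeff α F := by
  classical
  rw [hpart, MvPolynomial.coeff_sum, Finset.sum_eq_single α]
  · simp
  · intro β _ hβ
    rw [MvPolynomial.coeff_monomial, if_neg hβ]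
  · intro h
    exact absurd (by simp) h

theorem eval_hpart (F : MvPowerSeries σ ℂ) (k : ℕ) (θ : σ → ℂ) :
    MvPolynomial.eval θ (hpart F k) =
      ∑ α ∈ degLT σ (k + 1) with α.degree = k, coeff α F * ∏ i, θ i ^ α i := by
  rw [hpart, map_sum]
  refine Finset.sum_congr rfl fun α _ => ?_
  rw [MvPolynomial.eval_monomial, Finsupp.prod_fintype _ _ (by simp)]

theorem eval_smul_hpart (F : MvPowerSeries σ ℂ) (k : ℕ) (s : ℂ) (θ : σ → ℂ) :
    MvPolynomial.eval (s • θ) (hpart F k) = s ^ k * MvPolynomial.eval θ (hpart F k) := by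
  rw [eval_hpart, eval_hpart, Finset.mul_sum]
  refine Finset.sum_congr rfl fun α hα => ?_
  simp only [Finset.mem_filter] at hα
  simp only [Pi.smul_apply, smul_eq_mul, mul_pow, Finset.prod_mul_distrib,
    Finset.prod_pow_eq_pow_sum]
  rw [← Finsupp.degree_eq_sum, hα.2]
  ring

/-- The parametrized line in the direction `θ`. -/
noncomputable def line (θ : σ → ℂ) (i : σ) : PowerSeries ℂ := θ i • PowerSeries.X

theorem line_mem (θ : σ → ℂ) (i : σ) : line θ i ∈ lowIdeal Unit ℂ 1 := by
  rw [powerSeries_mem_lowIdeal, pow_one]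
  exact ⟨PowerSeries.C (θ i), by rw [line, PowerSeries.smul_eq_C_mul, mul_comm]⟩

theorem conv_line (θ : σ → ℂ) (i : σ) : Conv (line θ i) := by
  rw [line, PowerSeries.smul_eq_C_mul]
  exact (conv_C _).mul (conv_X _)

theorem coeff_ev_line (F : MvPowerSeries σ ℂ) (k : ℕ) (θ : σ → ℂ) :
    PowerSeries.coeff k (ev ℂ (line θ) (line_mem θ) F) = MvPolynomial.eval θ (hpart F k) := by
  rw [PowerSeries.coeff, coeff_ev (line θ) (line_mem θ) F _ (d := k + 1) (by simp), eval_hpart,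
    Finset.sum_filter]
  refine Finset.sum_congr rfl fun α _ => ?_
  have : (α.prod fun i k => line θ i ^ k) =
      (∏ i, θ i ^ α i) • (PowerSeries.X ^ α.degree : PowerSeries ℂ) := by
    rw [Finsupp.prod_fintype _ _ (by simp)]
    simp only [line, smul_pow, Finset.prod_smul, Finset.prod_pow_eq_pow_sum,
      Finsupp.degree_eq_sum]
  rw [this]
  change _ • PowerSeries.coeff k _ = _
  rw [PowerSeries.coeff_smul, PowerSeries.coeff_X_pow]
  split_ifs with h1 h2 h2
  · simp
  · exact absurd h1.symm h2
  · exact absurd h2.symm h1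
  · simp

theorem exists_hpart_ne_zero {F : MvPowerSeries σ ℂ} (hF : F ≠ 0) :
    ∃ k, ∃ θ : σ → ℂ, MvPolynomial.eval θ (hpart F k) ≠ 0 := by
  by_contra hcon
  push Not at hcon
  refine hF (MvPowerSeries.ext fun α => ?_)
  have h0 : hpart F α.degree = 0 := MvPolynomial.funext fun θ => by simp [hcon]
  rw [← coeff_hpart, h0]
  simp

/-- A power series which converges on an open set of lines is convergent. -/
theorem conv_of_conv_line {F : MvPowerSeries σ ℂ} {Ω : Set (σ → ℂ)} (hΩ : IsOpen Ω)
    (hne : Ω.Nonempty) (h : ∀ θ ∈ Ω, Conv (ev ℂ (line θ) (line_mem θ) F)) : Conv F := by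
  have hcont : ∀ k, Continuous fun θ : σ → ℂ => MvPolynomial.eval θ (hpart F k) :=
    fun k => MvPolynomial.continuous_eval _
  let A : ℕ → Set (σ → ℂ) := fun C =>
    {θ | ∀ k, ‖MvPolynomial.eval θ (hpart F k)‖ ≤ (C : ℝ) ^ (k + 1)}
  have hA : ∀ C, IsClosed (A C) := by
    intro C
    simp only [A, Set.ofPred_forall]
    exact isClosed_iInter fun k => isClosed_le (hcont k).norm continuous_const
  have hcov : ⋃ C, (A C ∪ Ωᶜ) = Set.univ := by
    refine Set.eq_univ_of_forall fun θ => Set.mem_iUnion.2 ?_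
    by_cases hθ : θ ∈ Ω
    · obtain ⟨C, hC1, hC⟩ := conv_powerSeries.1 (h θ hθ)
      obtain ⟨n, hn⟩ := exists_nat_ge C
      refine ⟨n, Or.inl fun k => ?_⟩
      rw [← coeff_ev_line]
      exact (hC k).trans (pow_le_pow_left₀ (by linarith) hn _)
    · exact ⟨0, Or.inr hθ⟩
  have hdense := dense_iUnion_interior_of_closed
    (fun C => (hA C).union hΩ.isClosed_compl) hcov
  obtain ⟨θ0, hθΩ, hθ0⟩ := hdense.inter_open_nonempty Ω hΩ hne
  obtain ⟨C, hC⟩ := Set.mem_iUnion.1 hθ0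
  have hmem : interior (A C ∪ Ωᶜ) ∩ Ω ∈ 𝓝 θ0 :=
    (isOpen_interior.inter hΩ).mem_nhds ⟨hC, hθΩ⟩
  obtain ⟨r, hr, hball⟩ := Metric.nhds_basis_closedBall.mem_iff.1 hmem
  have hAC : ∀ θ ∈ Metric.closedBall θ0 r, θ ∈ A C := fun θ hθ =>
    (interior_subset (hball hθ).1).resolve_right fun h' => h' (hball hθ).2
  have hbound : ∀ k, ∀ y : σ → ℂ, ‖y‖ ≤ r →
      ‖MvPolynomial.eval y (hpart F k)‖ ≤ (C : ℝ) ^ (k + 1) := by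
    intro k y hy
    let p : ℂ → ℂ := fun s => MvPolynomial.eval (s • θ0 + y) (hpart F k)
    have hp : Differentiable ℂ p := by
      intro s
      simp only [p, eval_hpart]
      fun_prop
    have hfr : ∀ z ∈ frontier (Metric.ball (0 : ℂ) 1), ‖p z‖ ≤ (C : ℝ) ^ (k + 1) := by
      intro z hz
      rw [frontier_ball _ one_ne_zero, mem_sphere_zero_iff_norm] at hz
      have hz0 : z ≠ 0 := by
        rintro rfl
        simp at hz
      have : p z = z ^ k * MvPolynomial.eval (θ0 + z⁻¹ • y) (hpart F k) := by
        rw [← eval_smul_hpart, smul_add, smul_inv_smul₀ hz0]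
      rw [this, norm_mul, norm_pow, hz, one_pow, one_mul]
      refine hAC _ ?_ k
      rw [mem_closedBall_iff_norm, add_sub_cancel_left, norm_smul, norm_inv, hz]
      simpa using hy
    have := Complex.norm_le_of_forall_mem_frontier_norm_le Metric.isBounded_ball
      hp.diffContOnCl hfr (z := 0) (subset_closure (by simp))
    simpa [p] using this
  have hcoef : ∀ α : σ →₀ ℕ, ‖coeff α F‖ * r ^ α.degree ≤ (C : ℝ) ^ (α.degree + 1) := by
    intro α
    rw [← coeff_hpart]
    refine norm_coeff_mul_pow_le _ hr (fun θ hθ => hbound _ θ ?_) α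
    exact (pi_norm_le_iff_of_nonneg hr.le).2 fun i => (hθ i).le
  refine ⟨max 1 (max C (C / r)), le_max_left _ _, fun α => ?_⟩
  have hC0 : (0 : ℝ) ≤ C := Nat.cast_nonneg C
  calc ‖coeff α F‖ ≤ C * (C / r) ^ α.degree := by
        rw [div_pow, ← mul_div_assoc, le_div_iff₀ (by positivity), ← pow_succ']
        exact hcoef α
    _ ≤ (max 1 (max (C : ℝ) (C / r))) * (max 1 (max (C : ℝ) (C / r))) ^ α.degree := by
        gcongr
        · exact (le_max_left _ _).trans (le_max_right _ _)
        · exact (le_max_right _ _).trans (le_max_right _ _)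
    _ = _ := (pow_succ' _ _).symm

end Lines

section Separating

/-- Finitely many additive functionals separate the integral combinations of finitely many
weights from zero. -/
theorem exists_separating {σ : Type*} [Fintype σ] (μ : σ → ℂ) :
    ∃ (T : Finset ℂ) (χ : ℂ → ℂ →+ ℂ), ∀ z : σ → ℤ, ∑ i, z i • μ i ≠ 0 →
      ∃ t ∈ T, 1 ≤ ‖χ t (∑ i, z i • μ i)‖ := by
  classical
  let B := Module.Basis.ofVectorSpace ℚ ℂ
  let T : Finset (Module.Basis.ofVectorSpaceIndex ℚ ℂ) :=
    Finset.univ.biUnion fun i => (B.repr (μ i)).support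
  let M : ℕ := ∏ i, ∏ t ∈ T, (B.repr (μ i) t).den
  have hM : ∀ i, ∀ t ∈ T, ∃ k : ℤ, (M : ℚ) * B.repr (μ i) t = k := by
    intro i t ht
    have hdvd : (B.repr (μ i) t).den ∣ M :=
      (Finset.dvd_prod_of_mem (fun t => (B.repr (μ i) t).den) ht).trans
        (Finset.dvd_prod_of_mem (fun i => ∏ t ∈ T, (B.repr (μ i) t).den) (Finset.mem_univ i))
    obtain ⟨q, hq⟩ := hdvd
    refine ⟨q * (B.repr (μ i) t).num, ?_⟩
    rw [hq]
    push_cast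
    rw [mul_right_comm, mul_comm ((B.repr (μ i) t).den : ℚ), Rat.mul_den_eq_num]
    ring
  have hM0 : (M : ℚ) ≠ 0 := by
    simp only [M, ne_eq, Nat.cast_eq_zero, Finset.prod_eq_zero_iff, not_exists, not_and]
    intro i _ t _
    exact Rat.den_nz _
  let χ' : Module.Basis.ofVectorSpaceIndex ℚ ℂ → ℂ →+ ℂ := fun t =>
    { toFun := fun x => ((M * B.repr x t : ℚ) : ℂ)
      map_zero' := by simp
      map_add' := fun x y => by simp [mul_add] }
  refine ⟨T.map ⟨Subtype.val, Subtype.val_injective⟩,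
    fun t => if ht : t ∈ Module.Basis.ofVectorSpaceIndex ℚ ℂ then χ' ⟨t, ht⟩ else 0, ?_⟩
  intro z hz
  have hrepr : ∀ t, B.repr (∑ i, z i • μ i) t = ∑ i, z i * B.repr (μ i) t := by
    intro t
    rw [map_sum, Finsupp.finsetSum_apply]
    exact Finset.sum_congr rfl fun i _ => by rw [map_zsmul, Finsupp.smul_apply, zsmul_eq_mul]
  obtain ⟨t, ht⟩ : ∃ t, B.repr (∑ i, z i • μ i) t ≠ 0 := by
    by_contra hcon
    push Not at hcon
    exact hz (B.repr.map_eq_zero_iff.1 (Finsupp.ext hcon))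
  have htT : t ∈ T := by
    by_contra hcon
    refine ht ?_
    rw [hrepr]
    refine Finset.sum_eq_zero fun i _ => ?_
    have : B.repr (μ i) t = 0 := by
      by_contra h
      exact hcon (Finset.mem_biUnion.2 ⟨i, Finset.mem_univ _, Finsupp.mem_support_iff.2 h⟩)
    rw [this, mul_zero]
  refine ⟨t, Finset.mem_map_of_mem _ htT, ?_⟩
  have hval : (if ht : (t : ℂ) ∈ Module.Basis.ofVectorSpaceIndex ℚ ℂ then χ' ⟨t, ht⟩ else 0) =
      χ' t := by
    rw [dif_pos t.2]
  simp only
  rw [hval]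
  change 1 ≤ ‖((M * B.repr (∑ i, z i • μ i) t : ℚ) : ℂ)‖
  choose k hk using fun i => hM i t htT
  have hcast : (M : ℚ) * B.repr (∑ i, z i • μ i) t = ((∑ i, z i * k i : ℤ) : ℚ) := by
    rw [hrepr, Finset.mul_sum]
    push_cast
    refine Finset.sum_congr rfl fun i _ => ?_
    rw [← hk i]; ring
  have hne : (∑ i, z i * k i : ℤ) ≠ 0 := by
    intro h0
    rw [h0, Int.cast_zero] at hcast
    exact mul_ne_zero hM0 ht hcast
  rw [hcast, Rat.cast_intCast, Complex.norm_intCast]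
  exact_mod_cast Int.one_le_abs hne

end Separating

section TorusConv

variable {σ : Type*} [Fintype σ] (μ : σ → ℂ) (ψ : MvPowerSeries σ ℂ ≃ₐ[ℂ] MvPowerSeries σ ℂ)
  (hψ : ∀ i, ψ (X i) - X i ∈ lowIdeal σ ℂ 2)
  (c : σ → PowerSeries ℂ) (hc : ∀ i, c i ∈ lowIdeal Unit ℂ 1)

theorem torusDer_mem_lowIdeal (hψ : ∀ i, ψ (X i) - X i ∈ lowIdeal σ ℂ 2) (χ : ℂ →+ ℂ) {d : ℕ}
    {g : MvPowerSeries σ ℂ} (hg : g ∈ lowIdeal σ ℂ d) : torusDer μ ψ χ g ∈ lowIdeal σ ℂ d := by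
  rw [← symm_sub_mem ψ hψ, torusDer_apply, AlgEquiv.symm_apply_apply]
  refine mem_lowIdeal.2 fun α hα => ?_
  rw [coeff_wtDer, mem_lowIdeal.1 ((symm_sub_mem ψ hψ).2 hg) α hα, mul_zero]

theorem torusDer_X_sub_mem (hψ : ∀ i, ψ (X i) - X i ∈ lowIdeal σ ℂ 2) (χ : ℂ →+ ℂ) (j : σ) :
    torusDer μ ψ χ (X j) - χ (μ j) • X j ∈ lowIdeal σ ℂ 2 := by
  have h1 : torusDer μ ψ χ (ψ (X j)) = χ (μ j) • ψ (X j) :=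
    torusDer_of_hasWeight μ ψ χ (by simpa using hasWeight_X μ j)
  have h2 : torusDer μ ψ χ (X j) - χ (μ j) • X j =
      χ (μ j) • (ψ (X j) - X j) - torusDer μ ψ χ (ψ (X j) - X j) := by
    rw [Derivation.map_sub, h1, smul_sub]; abel
  rw [h2]
  exact Ideal.sub_mem _ (smul_mem_lowIdeal _ (hψ j)) (torusDer_mem_lowIdeal μ ψ hψ χ (hψ j))

/-- The norm of an element of the weight ring whose weights are separated from `v`. -/
theorem norm_wring_le {x : WRing} {v : ℂ} (T : Finset ℂ) (χ : ℂ → ℂ →+ ℂ) (R : ℂ → WRing)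
    (hR : ∀ t ∈ T, ∀ w, χ t (w - v) * wcoeff w x = wcoeff w (R t))
    (hsep : ∀ w, wcoeff w x ≠ 0 → w ≠ v → ∃ t ∈ T, 1 ≤ ‖χ t (w - v)‖) :
    ‖x‖ ≤ ‖aug x‖ + 2 * ∑ t ∈ T, ‖R t‖ := by
  classical
  let s := insert v (x.coeff.support ∪ T.biUnion fun t => (R t).coeff.support)
  have hxs : x.coeff.support ⊆ s := fun w hw =>
    Finset.mem_insert_of_mem (Finset.mem_union_left _ hw)
  have hRs : ∀ t ∈ T, (R t).coeff.support ⊆ s := fun t ht w hw =>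
    Finset.mem_insert_of_mem (Finset.mem_union_right _ (Finset.mem_biUnion.2 ⟨t, ht, hw⟩))
  have hv : v ∈ s := Finset.mem_insert_self _ _
  have hrest : ∑ w ∈ s.erase v, ‖wcoeff w x‖ ≤ ∑ t ∈ T, ‖R t‖ := by
    have h1 : ∀ w ∈ s.erase v, ‖wcoeff w x‖ ≤ ∑ t ∈ T, ‖wcoeff w (R t)‖ := by
      intro w hw
      by_cases h0 : wcoeff w x = 0
      · rw [h0, norm_zero]
        exact Finset.sum_nonneg fun _ _ => norm_nonneg _
      obtain ⟨t, ht, h2⟩ := hsep w h0 (Finset.ne_of_mem_erase hw)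
      calc ‖wcoeff w x‖ ≤ ‖χ t (w - v)‖ * ‖wcoeff w x‖ :=
            le_mul_of_one_le_left (norm_nonneg _) h2
        _ = ‖wcoeff w (R t)‖ := by rw [← norm_mul, hR t ht]
        _ ≤ _ := Finset.single_le_sum (f := fun t => ‖wcoeff w (R t)‖)
            (fun _ _ => norm_nonneg _) ht
    refine (Finset.sum_le_sum h1).trans ?_
    rw [Finset.sum_comm]
    refine Finset.sum_le_sum fun t ht => ?_
    rw [norm_wring, wnorm_eq _ (hRs t ht)]
    exact Finset.sum_le_sum_of_subset_of_nonneg (Finset.erase_subset _ _)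
      fun _ _ _ => norm_nonneg _
  have haug : aug x = ∑ w ∈ s, wcoeff w x := by
    conv_lhs => rw [wring_eq_sum x]
    rw [map_sum]
    simp only [map_smul, aug_fexp, smul_eq_mul, mul_one]
    exact Finset.sum_subset hxs fun w _ hw => Finsupp.notMem_support_iff.1 hw
  have hvx : ‖wcoeff v x‖ ≤ ‖aug x‖ + ∑ w ∈ s.erase v, ‖wcoeff w x‖ := by
    have h3 : wcoeff v x = aug x - ∑ w ∈ s.erase v, wcoeff w x := by
      rw [haug, ← Finset.add_sum_erase _ _ hv]; ring
    rw [h3]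
    exact (norm_sub_le _ _).trans (by gcongr; exact norm_sum_le _ _)
  rw [norm_wring, wnorm_eq x hxs, ← Finset.add_sum_erase _ _ hv]
  linarith

theorem wcoeff_torusEv_ne_zero {g : MvPowerSeries σ ℂ} {e : Unit →₀ ℕ} {w : ℂ}
    (h : wcoeff w (MvPowerSeries.coeff e (torusEv μ ψ hψ c hc g)) ≠ 0) : ∃ α, wt μ α = w := by
  by_contra hcon
  push Not at hcon
  refine h ?_
  rw [← coeff_wc, wc_torusEv]
  have : wpart μ w (ψ.symm g) = 0 := MvPowerSeries.ext fun α => by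
    rw [coeff_wpart, if_neg (hcon α), map_zero]
  rw [this, map_zero, map_zero, map_zero]

theorem aug_coeff_torusEv (g : MvPowerSeries σ ℂ) (e : Unit →₀ ℕ) :
    aug (MvPowerSeries.coeff e (torusEv μ ψ hψ c hc g)) =
      MvPowerSeries.coeff e (ev ℂ c hc g) := by
  have h := aug_twist μ _ (curve_mem ψ c hψ hc) (ψ.symm g)
  rw [ev_curve ψ hψ, AlgEquiv.apply_symm_apply] at h
  rw [← h, MvPowerSeries.mapAlgHom_apply, coeff_map]
  rfl

theorem nrm_prod_le {S : Type*} [NormedCommRing S] [NormOneClass S] {s : ℝ} (hs : 0 < s)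
    (γ : σ → PowerSeries S) (hγ : ∀ i, γ i ∈ lowIdeal Unit S 1) {ρ : ℝ} {d : ℕ}
    (hρ : ∀ i, nrm s (d + 1) (γ i) ≤ ρ) (α : σ →₀ ℕ) (hα : 2 ≤ α.degree) :
    nrm s (d + 2) (α.prod fun i k => γ i ^ k) ≤ ρ ^ α.degree := by
  choose ζ hζ using fun i => powerSeries_mem_lowIdeal.1 (hγ i)
  simp only [pow_one] at hζ
  have hζn : ∀ i, nrm s d (ζ i) ≤ ρ / s := fun i => by
    rw [le_div_iff₀ hs, mul_comm, ← nrm_X_mul, ← hζ i]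
    exact hρ i
  have hprod : (α.prod fun i k => γ i ^ k) =
      PowerSeries.X ^ α.degree * α.prod fun i k => ζ i ^ k := by
    rw [Finsupp.prod_fintype _ _ (by simp), Finsupp.prod_fintype _ _ (by simp),
      Finsupp.degree_eq_sum, ← Finset.prod_pow_eq_pow_sum, ← Finset.prod_mul_distrib]
    exact Finset.prod_congr rfl fun i _ => by rw [hζ i, mul_pow]
  have hX : ∀ (k : ℕ) (g : PowerSeries S), nrm s d (PowerSeries.X ^ k * g) ≤ s ^ k * nrm s d g := by
    intro k g
    induction k with
    | zero => simp
    | succ k ih =>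
      rw [pow_succ', mul_assoc, pow_succ', mul_assoc]
      refine (nrm_mono hs.le (Nat.le_succ d) _).trans ?_
      rw [nrm_X_mul]
      exact mul_le_mul_of_nonneg_left ih hs.le
  obtain ⟨k, hk⟩ := Nat.exists_eq_add_of_le' hα
  rw [hprod, hk, pow_succ', pow_succ', mul_assoc, mul_assoc, nrm_X_mul, nrm_X_mul]
  have h1 := (hX k _).trans (mul_le_mul_of_nonneg_left
    (nrm_finsuppProd_le (d := d) (ρ := ρ / s) hs.le ζ hζn α) (pow_nonneg hs.le k))
  calc _ ≤ s * (s * (s ^ k * (ρ / s) ^ α.degree)) := by gcongr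
    _ = ρ ^ (k + 1 + 1) := by rw [hk, div_pow]; field_simp; ring

/-- The orbits of a convergent curve under the torus action converge as soon as the infinitesimal
generators of the action converge. -/
theorem conv_torusEv (hcc : ∀ i, Conv (c i))
    (hZ : ∀ χ j, Conv (torusDer μ ψ χ (X j))) :
    ∀ j, Conv (torusEv μ ψ hψ c hc (X j)) := by
  classical
  obtain ⟨T, χ, hsep⟩ := exists_separating μ
  let γ : σ → PowerSeries WRing := fun j => torusEv μ ψ hψ c hc (X j)
  have hγ : ∀ j, γ j ∈ lowIdeal Unit WRing 1 := torusEv_X_mem μ ψ hψ c hc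
  let R : ℂ → σ → MvPowerSeries σ ℂ := fun t j => torusDer μ ψ (χ t) (X j) - χ t (μ j) • X j
  have hR2 : ∀ t j, R t j ∈ lowIdeal σ ℂ 2 := fun t j => torusDer_X_sub_mem μ ψ hψ (χ t) j
  have hRc : ∀ t j, Conv (R t j) := fun t j =>
    (hZ _ _).sub (by rw [MvPowerSeries.smul_eq_C_mul]; exact (conv_C _).mul (conv_X _))
  have hcoef : ∀ j e, ‖MvPowerSeries.coeff e (γ j)‖ ≤ ‖MvPowerSeries.coeff e (c j)‖ +
      2 * ∑ t ∈ T, ‖MvPowerSeries.coeff e (ev ℂ γ hγ (R t j))‖ := by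
    intro j e
    have h := norm_wring_le (x := MvPowerSeries.coeff e (γ j)) (v := μ j) T χ
      (fun t => MvPowerSeries.coeff e (ev ℂ γ hγ (R t j))) ?_ ?_
    · rwa [aug_coeff_torusEv, ev_X] at h
    · intro t _ w
      rw [← torusEv_eq_ev]
      simp only [R, γ]
      rw [map_sub, map_sub, map_smul, map_sub, ← coeffDer_torusEv, map_sub, coeff_coeffDer,
        wcoeff_wscale]
      have : MvPowerSeries.coeff e (χ t (μ j) • torusEv μ ψ hψ c hc (X j)) =
        χ t (μ j) • MvPowerSeries.coeff e (torusEv μ ψ hψ c hc (X j)) := rfl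
      rw [this, map_smul, smul_eq_mul, sub_mul]
    · intro w hw hwj
      obtain ⟨α, rfl⟩ := wcoeff_torusEv_ne_zero μ ψ hψ c hc hw
      have hz : wt μ α - μ j = ∑ i, ((α i : ℤ) - if i = j then 1 else 0) • μ i := by
        simp only [sub_smul, Finset.sum_sub_distrib, ite_smul, one_smul, zero_smul,
          Finset.sum_ite_eq', Finset.mem_univ, if_true]
        rw [wt_eq_sum]
        simp
      rw [hz]
      exact hsep _ (by rw [← hz]; exact sub_ne_zero.2 hwj)
  have hnrm : ∀ (s : ℝ), 0 < s → ∀ d j, nrm s d (γ j) ≤ nrm s d (c j) +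
      2 * ∑ t ∈ T, nrm s d (ev ℂ γ hγ (R t j)) := by
    intro s hs d j
    simp only [nrm]
    rw [Finset.sum_comm, Finset.mul_sum, ← Finset.sum_add_distrib]
    refine Finset.sum_le_sum fun e _ => ?_
    refine (mul_le_mul_of_nonneg_right (hcoef j e) (pow_nonneg hs.le _)).trans_eq ?_
    rw [add_mul, mul_assoc, Finset.sum_mul]
  choose Mc hMc0 hMc using fun i => (hcc i).exists_nrm_le (hc i)
  choose C hC1 hC using hRc
  let K : ℝ := 1 + ∑ i, Mc i
  let C₀ : ℝ := 1 + ∑ t ∈ T, ∑ j, C t j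
  have hC0 : ∀ t j, 0 ≤ C t j := fun t j => by linarith [hC1 t j]
  have hK : ∀ i, Mc i ≤ K := fun i => by
    have := Finset.single_le_sum (f := Mc) (fun i _ => (hMc0 i).le) (Finset.mem_univ i)
    simp only [K]; linarith
  have hK1 : 1 ≤ K := by
    have h1 := Finset.sum_nonneg fun i (_ : i ∈ Finset.univ) => (hMc0 i).le
    simp only [K]; linarith
  have hC₀ : ∀ t ∈ T, ∀ j, C t j ≤ C₀ := fun t ht j => by
    have h1 := Finset.single_le_sum (f := C t) (fun j _ => hC0 t j) (Finset.mem_univ j)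
    have h2 := Finset.single_le_sum (f := fun t => ∑ j, C t j)
      (fun t _ => Finset.sum_nonneg fun j _ => hC0 t j) ht
    simp only [C₀]; linarith
  have hC₀1 : 1 ≤ C₀ := by
    have h1 := Finset.sum_nonneg fun t (_ : t ∈ T) =>
      Finset.sum_nonneg fun j (_ : j ∈ Finset.univ) => hC0 t j
    simp only [C₀]; linarith
  let D : ℝ := 2 * (T.card * (C₀ * (2 * C₀ * (2 * K)) ^ 2 * 2 ^ Fintype.card σ))
  obtain ⟨s, ⟨⟨h1, h2⟩, h3⟩, hs⟩ :=
    (((Filter.eventually_all.2 hMc).and (eventually_mul_le (2 * C₀ * (2 * K)) one_pos)).and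
      (eventually_mul_le D one_pos)).and self_mem_nhdsWithin |>.exists
  replace hs : 0 < s := hs
  suffices hmain : ∀ d j, nrm s (d + 1) (γ j) ≤ 2 * K * s from fun j =>
    Conv.of_nrm hs (M := 2 * K * s) fun d => (nrm_mono hs.le (Nat.le_succ d) _).trans (hmain d j)
  intro d
  induction d with
  | zero =>
    intro j
    rw [nrm_eq_zero_of_mem (by simpa using hγ j)]
    positivity
  | succ d ih =>
    intro j
    have hR : ∀ t ∈ T, nrm s (d + 2) (ev ℂ γ hγ (R t j)) ≤
        C₀ * (2 * C₀ * (2 * K * s)) ^ 2 * 2 ^ Fintype.card σ := fun t ht =>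
      nrm_ev_le hs.le γ hγ hC₀1
        (fun α => (hC t j α).trans (pow_le_pow_left₀ (hC0 t j) (hC₀ t ht j) _)) (hR2 t j)
        (fun α hα => nrm_prod_le hs γ hγ ih α hα) (by positivity) (by linarith)
    have h4 : ∑ t ∈ T, nrm s (d + 2) (ev ℂ γ hγ (R t j)) ≤
        T.card * (C₀ * (2 * C₀ * (2 * K * s)) ^ 2 * 2 ^ Fintype.card σ) := by
      refine (Finset.sum_le_sum hR).trans_eq ?_
      rw [Finset.sum_const, nsmul_eq_mul]
    have h5 : 2 * (T.card * (C₀ * (2 * C₀ * (2 * K * s)) ^ 2 * 2 ^ Fintype.card σ)) ≤ K * s := by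
      calc _ = (D * s) * s := by simp only [D]; ring
        _ ≤ 1 * s := by gcongr
        _ ≤ K * s := by gcongr
    have h6 : nrm s (d + 2) (c j) ≤ K * s := (h1 j _).trans (by
      rw [pow_one]; exact mul_le_mul_of_nonneg_right (hK j) hs.le)
    refine (hnrm s hs (d + 2) j).trans ?_
    linarith

end TorusConv

section Line

variable {σ : Type*} [Fintype σ]

theorem wpart_mem_lowIdeal (μ : σ → ℂ) (w : ℂ) {d : ℕ} {F : MvPowerSeries σ ℂ}
    (hF : F ∈ lowIdeal σ ℂ d) : wpart μ w F ∈ lowIdeal σ ℂ d := by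
  refine mem_lowIdeal.2 fun α hα => ?_
  rw [coeff_wpart, mem_lowIdeal.1 hF α hα, ite_self]

/-- The eigencoordinates of a formal torus action with convergent infinitesimal generators
converge. -/
theorem exists_conv_eigencoords (μ : σ → ℂ) (ψ : MvPowerSeries σ ℂ ≃ₐ[ℂ] MvPowerSeries σ ℂ)
    (hψ : ∀ i, ψ (X i) - X i ∈ lowIdeal σ ℂ 2)
    (hZ : ∀ χ j, Conv (torusDer μ ψ χ (X j))) :
    ∃ h : σ → MvPowerSeries σ ℂ, (∀ j, Conv (h j)) ∧ (∀ j, h j - X j ∈ lowIdeal σ ℂ 2) ∧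
      ∀ j, HasWeight μ (μ j) (ψ.symm (h j)) := by
  refine ⟨fun j => ψ (wpart μ (μ j) (ψ.symm (X j))), fun j => ?_, fun j => ?_, fun j => ?_⟩
  · refine conv_of_conv_line isOpen_univ Set.univ_nonempty fun θ _ => ?_
    rw [← wc_torusEv μ ψ hψ]
    exact conv_wc (conv_torusEv μ ψ hψ (line θ) (line_mem θ) (conv_line θ) hZ j)
  · have h1 : wpart μ (μ j) (X j) = X j := MvPowerSeries.ext fun α => by
      rw [coeff_wpart]
      by_cases h : coeff α (X j : MvPowerSeries σ ℂ) = 0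
      · rw [h, ite_self]
      · rw [if_pos (hasWeight_X μ j α h)]
    have h2 : ψ.symm (X j) - X j ∈ lowIdeal σ ℂ 2 := by
      have := (symm_sub_mem ψ hψ (g := ψ (X j) - X j)).2 (hψ j)
      rw [map_sub, AlgEquiv.symm_apply_apply] at this
      rw [← neg_sub]
      exact neg_mem this
    have h3 : wpart μ (μ j) (ψ.symm (X j)) - X j ∈ lowIdeal σ ℂ 2 := by
      have : wpart μ (μ j) (ψ.symm (X j)) - X j = wpart μ (μ j) (ψ.symm (X j) - X j) := by
        refine MvPowerSeries.ext fun α => ?_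
        have e := congrArg (coeff α) h1
        simp only [map_sub, coeff_wpart] at e ⊢
        split_ifs at e ⊢
        · rfl
        · rw [← e, sub_zero]
      rw [this]
      exact wpart_mem_lowIdeal μ _ h2
    have h4 : ψ (wpart μ (μ j) (ψ.symm (X j)) - X j) ∈ lowIdeal σ ℂ 2 := by
      rw [← symm_sub_mem ψ hψ, AlgEquiv.symm_apply_apply]
      exact h3
    have h5 := Ideal.add_mem _ h4 (hψ j)
    rw [map_sub] at h5
    simpa using h5
  · rw [AlgEquiv.symm_apply_apply]
    exact hasWeight_wpart _ _ _

end Line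

section Main

variable {κ ι : Type*} [Fintype κ] [Fintype ι] [DecidableEq κ] [DecidableEq ι]

theorem exists_semisimple_part (f : κ → MvPowerSeries (κ ⊕ ι) ℂ)
    (V : ι → Derivation ℂ (MvPowerSeries (κ ⊕ ι) ℂ) (MvPowerSeries (κ ⊕ ι) ℂ))
    (hVf : ∀ i k, V i (f k) = 0) (hVV : ∀ i j g, V i (V j g) = V j (V i g))
    (hfc : ∀ k, Conv (f k)) (hVc : ∀ i a, Conv (V i (X a)))
    (Y : κ → Derivation ℂ (MvPowerSeries (κ ⊕ ι) ℂ) (MvPowerSeries (κ ⊕ ι) ℂ))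
    (hY : (Matrix.of fun k k' => Y k' (f k)).det ≠ 0)
    (g : ι → MvPowerSeries (κ ⊕ ι) ℂ) (hg : (Matrix.of fun i j => V i (g j)).det ≠ 0)
    (i₀ : ι) (hD : ∀ a, V i₀ (X a) ∈ lowIdeal (κ ⊕ ι) ℂ 1) {μ : κ ⊕ ι → ℂ}
    (hμ : ∀ a, GenEig (V i₀) 2 (μ a) (X a)) :
    ∃ (h : κ ⊕ ι → MvPowerSeries (κ ⊕ ι) ℂ)
      (W : Derivation ℂ (MvPowerSeries (κ ⊕ ι) ℂ) (MvPowerSeries (κ ⊕ ι) ℂ)),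
      (∀ a, Conv (h a)) ∧ (∀ a, h a - X a ∈ lowIdeal (κ ⊕ ι) ℂ 2) ∧
      (∀ a, W (h a) = μ a • h a) ∧ (∀ F, W (V i₀ F) = V i₀ (W F)) ∧
      (∀ w F, (∀ d, GenEig (V i₀) d w F) → W F = w • F) ∧
      ∀ W' : Derivation ℂ (MvPowerSeries (κ ⊕ ι) ℂ) (MvPowerSeries (κ ⊕ ι) ℂ),
        (∀ w F, (∀ d, GenEig (V i₀) d w F) → W' F = w • F) → W' = W := by
  obtain ⟨ψ, hψ, hiff⟩ := exists_normalizing hD hμ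
  have hgen : ∀ a d, GenEig (V i₀) d (μ a) (ψ (X a)) := fun a =>
    (hiff _ _).2 (hasWeight_X μ a)
  have hfw : ∀ k, HasWeight μ 0 (ψ.symm (f k)) := fun k => by
    rw [← hiff]
    refine fun d => ⟨1, ?_⟩
    rw [AlgEquiv.apply_symm_apply, pow_one]
    have : shiftOp (V i₀) 0 (f k) = 0 := by
      rw [shiftOp, map_zero, sub_zero]
      exact hVf i₀ k
    rw [this]
    exact zero_mem _
  have hVw : ∀ i j, HasWeight μ (μ j) (ψ.symm (V i (ψ (X j)))) := fun i j => by
    rw [← hiff]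
    intro d
    rw [AlgEquiv.apply_symm_apply]
    exact (hgen j (d + 1)).comm (V i) (fun F => hVV i i₀ F)
  have hZ : ∀ χ a, Conv (torusDer μ ψ χ (X a)) := by
    intro χ a
    obtain ⟨k, θ, hθ⟩ := exists_hpart_ne_zero (mul_ne_zero hY hg)
    refine conv_of_conv_line (Ω := {θ | MvPolynomial.eval θ
      (hpart ((Matrix.of fun k k' => Y k' (f k)).det * (Matrix.of fun i j => V i (g j)).det) k) ≠ 0})
      (isOpen_ne_fun (MvPolynomial.continuous_eval _) continuous_const) ⟨θ, hθ⟩ fun θ' hθ' => ?_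
    have hne : ev ℂ (line θ') (line_mem θ')
        ((Matrix.of fun k k' => Y k' (f k)).det * (Matrix.of fun i j => V i (g j)).det) ≠ 0 := by
      intro h0
      refine hθ' ?_
      rw [← coeff_ev_line, h0, map_zero]
    rw [map_mul] at hne
    exact conv_torusDer_curve f V μ ψ hψ hVf hVV hfc hVc hfw hVw (line θ') (line_mem θ')
      (conv_line θ') Y (left_ne_zero_of_mul hne) g (right_ne_zero_of_mul hne) χ a
  obtain ⟨h, hhc, hhX, hhw⟩ := exists_conv_eigencoords μ ψ hψ hZ
  have hW : ∀ w F, (∀ d, GenEig (V i₀) d w F) →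
      torusDer μ ψ (AddMonoidHom.id ℂ) F = w • F := fun w F hF => by
    refine torusDer_of_hasWeight μ ψ (AddMonoidHom.id ℂ) ?_
    rw [← hiff]
    simpa using hF
  have hext : ∀ W₁ W₂ : Derivation ℂ (MvPowerSeries (κ ⊕ ι) ℂ) (MvPowerSeries (κ ⊕ ι) ℂ),
      (∀ a, W₁ (ψ (X a)) = W₂ (ψ (X a))) → W₁ = W₂ := by
    intro W₁ W₂ h12
    have h3 : conjDer ψ W₁ = conjDer ψ W₂ := derivation_ext_X fun a => by
      rw [conjDer_apply, conjDer_apply, h12]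
    refine Derivation.ext fun F => ?_
    have h4 := DFunLike.congr_fun h3 (ψ.symm F)
    simp only [conjDer_apply, AlgEquiv.apply_symm_apply] at h4
    exact ψ.symm.injective h4
  refine ⟨h, torusDer μ ψ (AddMonoidHom.id ℂ), hhc, hhX, fun a => ?_, fun F => ?_, hW,
    fun W' hW' => hext _ _ fun a => ?_⟩
  · exact torusDer_of_hasWeight μ ψ (AddMonoidHom.id ℂ) (hhw a)
  · have hbr : ⁅torusDer μ ψ (AddMonoidHom.id ℂ), V i₀⁆ = 0 := hext _ _ fun a => by
      rw [Derivation.commutator_apply, hW (μ a) (ψ (X a)) (hgen a),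
        hW (μ a) (V i₀ (ψ (X a))) fun d => (hgen a (d + 1)).comm (V i₀) fun F => rfl,
        Derivation.map_smul, sub_self]
      rfl
    have := DFunLike.congr_fun hbr F
    rw [Derivation.commutator_apply] at this
    exact sub_eq_zero.1 this
  · rw [hW' _ _ (hgen a), hW _ _ (hgen a)]

end Main

section Transport

variable {σ τ : Type*} [Fintype σ] [Fintype τ]

/-- The derivation transported along an isomorphism of power series algebras. -/
noncomputable def transDer (Φ : MvPowerSeries σ ℂ ≃ₐ[ℂ] MvPowerSeries τ ℂ)
    (D : Derivation ℂ (MvPowerSeries τ ℂ) (MvPowerSeries τ ℂ)) :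
    Derivation ℂ (MvPowerSeries σ ℂ) (MvPowerSeries σ ℂ) :=
  Derivation.mk' (Φ.symm.toLinearMap ∘ₗ D.toLinearMap ∘ₗ Φ.toLinearMap) fun a b => by
    simp [Derivation.leibniz]

variable (Φ : MvPowerSeries σ ℂ ≃ₐ[ℂ] MvPowerSeries τ ℂ)
  (D : Derivation ℂ (MvPowerSeries τ ℂ) (MvPowerSeries τ ℂ))

theorem transDer_apply (g : MvPowerSeries σ ℂ) : transDer Φ D g = Φ.symm (D (Φ g)) := rfl

theorem transDer_symm (D : Derivation ℂ (MvPowerSeries σ ℂ) (MvPowerSeries σ ℂ)) :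
    transDer Φ (transDer Φ.symm D) = D := by
  refine Derivation.ext fun g => ?_
  simp [transDer_apply]

theorem equiv_mem_lowIdeal (h1 : ∀ i, Φ (X i) ∈ lowIdeal τ ℂ 1)
    (h2 : ∀ i, Φ.symm (X i) ∈ lowIdeal σ ℂ 1) {d : ℕ} {g : MvPowerSeries σ ℂ} :
    Φ g ∈ lowIdeal τ ℂ d ↔ g ∈ lowIdeal σ ℂ d := by
  constructor
  · intro h
    have := ringHom_mem_lowIdeal Φ.symm.toRingEquiv.toRingHom h2 h
    simpa using this
  · exact fun h => ringHom_mem_lowIdeal Φ.toRingEquiv.toRingHom h1 h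

theorem genEig_transDer (h1 : ∀ i, Φ (X i) ∈ lowIdeal τ ℂ 1)
    (h2 : ∀ i, Φ.symm (X i) ∈ lowIdeal σ ℂ 1) {d : ℕ} {w : ℂ} {g : MvPowerSeries σ ℂ} :
    GenEig (transDer Φ D) d w g ↔ GenEig D d w (Φ g) := by
  have : ∀ N, Φ ((shiftOp (transDer Φ D) w ^ N) g) = (shiftOp D w ^ N) (Φ g) := by
    intro N
    induction N with
    | zero => rfl
    | succ N ih =>
      rw [pow_succ', pow_succ', Module.End.mul_apply, Module.End.mul_apply, ← ih]
      simp [shiftOp, transDer_apply, Algebra.algebraMap_eq_smul_one]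
  simp only [GenEig, ← this, equiv_mem_lowIdeal Φ h1 h2]

theorem det_map_symm_ne_zero {ν : Type*} [Fintype ν] [DecidableEq ν]
    (A : Matrix ν ν (MvPowerSeries τ ℂ)) (hA : A.det ≠ 0) : (A.map Φ.symm).det ≠ 0 := fun h0 => by
  refine hA (Φ.symm.injective ?_)
  rw [map_zero, ← h0]
  exact RingHom.map_det Φ.symm.toRingEquiv.toRingHom A

/-- The linear forms with the given coefficients. -/
noncomputable def linForm (P : Matrix σ τ ℂ) (i : σ) : MvPowerSeries τ ℂ := ∑ a, P i a • X a

theorem linForm_mem (P : Matrix σ τ ℂ) (i : σ) : linForm P i ∈ lowIdeal τ ℂ 1 :=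
  Ideal.sum_mem _ fun a _ => smul_mem_lowIdeal _ (X_mem_lowIdeal a)

theorem conv_smul {S : Type*} [Finite S] {F : MvPowerSeries S ℂ} (a : ℂ) (hF : Conv F) : Conv (a • F) := by
  rw [MvPowerSeries.smul_eq_C_mul]
  exact (conv_C _).mul hF

theorem conv_linForm (P : Matrix σ τ ℂ) (i : σ) : Conv (linForm P i) :=
  Conv.sum _ fun a _ => conv_smul _ (conv_X a)

theorem ev_linForm (P : Matrix σ τ ℂ) (Q : Matrix τ σ ℂ) [DecidableEq σ] (h : P * Q = 1) (i : σ) :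
    ev ℂ (linForm Q) (linForm_mem Q) (linForm P i) = X i := by
  simp only [linForm, map_sum, map_smul, ev_X, Finset.smul_sum, smul_smul]
  rw [Finset.sum_comm]
  simp only [← Finset.sum_smul]
  have : ∀ b, ∑ a, P i a * Q a b = if i = b then 1 else 0 := fun b => by
    rw [← Matrix.mul_apply, h, Matrix.one_apply]
  simp [this]

/-- An invertible linear change of variables. -/
noncomputable def linEquiv (P : Matrix σ τ ℂ) (Q : Matrix τ σ ℂ) [DecidableEq σ] [DecidableEq τ]
    (h : P * Q = 1) (h' : Q * P = 1) : MvPowerSeries σ ℂ ≃ₐ[ℂ] MvPowerSeries τ ℂ :=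
  AlgEquiv.ofAlgHom (ev ℂ (linForm P) (linForm_mem P)) (ev ℂ (linForm Q) (linForm_mem Q))
    (algHom_ext_X _ _ (fun i => by
      simpa using ev_mem_lowIdeal _ (linForm_mem P) (linForm_mem Q i)) fun i => by
        simpa using ev_linForm Q P h' i)
    (algHom_ext_X _ _ (fun i => by
      simpa using ev_mem_lowIdeal _ (linForm_mem Q) (linForm_mem P i)) fun i => by
        simpa using ev_linForm P Q h i)

end Transport

section Main

variable {κ ι σ : Type*} [Fintype κ] [Fintype ι] [DecidableEq κ] [DecidableEq ι] [Fintype σ]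
  [DecidableEq σ]

/-- The semisimple part of an integrable formal vector field has convergent eigenfunctions. -/
theorem exists_semisimple_part_of_linForm (f : κ → MvPowerSeries σ ℂ)
    (V : ι → Derivation ℂ (MvPowerSeries σ ℂ) (MvPowerSeries σ ℂ))
    (hVf : ∀ i k, V i (f k) = 0) (hVV : ∀ i j g, V i (V j g) = V j (V i g))
    (hfc : ∀ k, Conv (f k)) (hVc : ∀ i a, Conv (V i (X a)))
    (Y : κ → Derivation ℂ (MvPowerSeries σ ℂ) (MvPowerSeries σ ℂ))
    (hY : (Matrix.of fun k k' => Y k' (f k)).det ≠ 0)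
    (g : ι → MvPowerSeries σ ℂ) (hg : (Matrix.of fun i j => V i (g j)).det ≠ 0)
    (i₀ : ι) (hD : ∀ a, V i₀ (X a) ∈ lowIdeal σ ℂ 1)
    (P : Matrix (κ ⊕ ι) σ ℂ) (Q : Matrix σ (κ ⊕ ι) ℂ) (hPQ : P * Q = 1) (hQP : Q * P = 1)
    {μ : κ ⊕ ι → ℂ} (hμ : ∀ a, GenEig (V i₀) 2 (μ a) (linForm P a)) :
    ∃ (h : κ ⊕ ι → MvPowerSeries σ ℂ)
      (W : Derivation ℂ (MvPowerSeries σ ℂ) (MvPowerSeries σ ℂ)),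
      (∀ a, Conv (h a)) ∧ (∀ a, h a - linForm P a ∈ lowIdeal σ ℂ 2) ∧
      (∀ a, W (h a) = μ a • h a) ∧ (∀ F, W (V i₀ F) = V i₀ (W F)) ∧
      (∀ w F, (∀ d, GenEig (V i₀) d w F) → W F = w • F) ∧
      ∀ W' : Derivation ℂ (MvPowerSeries σ ℂ) (MvPowerSeries σ ℂ),
        (∀ w F, (∀ d, GenEig (V i₀) d w F) → W' F = w • F) → W' = W := by
  let Φ := linEquiv P Q hPQ hQP
  have hΦe : ∀ F, Φ F = ev ℂ (linForm P) (linForm_mem P) F := fun _ => rfl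
  have hΦe' : ∀ F, Φ.symm F = ev ℂ (linForm Q) (linForm_mem Q) F := fun _ => rfl
  have hΦX : ∀ a, Φ (X a) = linForm P a := fun a => ev_X (linForm P) (linForm_mem P) a
  have hΦX' : ∀ a, Φ.symm (X a) = linForm Q a := fun a => ev_X (linForm Q) (linForm_mem Q) a
  have h1 : ∀ a, Φ (X a) ∈ lowIdeal σ ℂ 1 := fun a => by rw [hΦX]; exact linForm_mem P a
  have h2 : ∀ a, Φ.symm (X a) ∈ lowIdeal (κ ⊕ ι) ℂ 1 := fun a => by
    rw [hΦX']; exact linForm_mem Q a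
  have hΦc : ∀ {F}, Conv F → Conv (Φ F) := fun hF => by
    rw [hΦe]; exact Conv.ev _ (linForm_mem P) hF (conv_linForm P)
  have hΦc' : ∀ {F}, Conv F → Conv (Φ.symm F) := fun hF => by
    rw [hΦe']; exact Conv.ev _ (linForm_mem Q) hF (conv_linForm Q)
  have hVlin : ∀ i a, V i (linForm P a) = ∑ b, P a b • V i (X b) := fun i a => by
    rw [linForm, map_sum]
    exact Finset.sum_congr rfl fun b _ => Derivation.map_smul _ _ _
  obtain ⟨h, W, hhc, hhX, hWh, hWV, hWg, hWu⟩ := exists_semisimple_part (κ := κ) (ι := ι)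
    (fun k => Φ.symm (f k)) (fun i => transDer Φ (V i))
    (fun i k => by simp [transDer_apply, hVf])
    (fun i j F => by simp [transDer_apply, hVV i j]) (fun k => hΦc' (hfc k))
    (fun i a => by
      rw [transDer_apply, hΦX, hVlin]
      exact hΦc' (Conv.sum _ fun b _ => conv_smul _ (hVc i b)))
    (fun k => transDer Φ (Y k))
    (by
      have := det_map_symm_ne_zero Φ _ hY
      refine fun h0 => this ?_
      rw [← h0]
      congr 1
      refine Matrix.ext fun i j => ?_
      simp [transDer_apply])
    (fun i => Φ.symm (g i))
    (by
      have := det_map_symm_ne_zero Φ _ hg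
      refine fun h0 => this ?_
      rw [← h0]
      congr 1
      refine Matrix.ext fun i j => ?_
      simp [transDer_apply])
    i₀
    (fun a => by
      rw [transDer_apply, ← equiv_mem_lowIdeal Φ h1 h2, AlgEquiv.apply_symm_apply, hΦX, hVlin]
      exact Ideal.sum_mem _ fun b _ => smul_mem_lowIdeal _ (hD b))
    (μ := μ) (fun a => by rw [genEig_transDer Φ _ h1 h2, hΦX]; exact hμ a)
  have hgen : ∀ {w F}, (∀ d, GenEig (V i₀) d w F) →
      ∀ d, GenEig (transDer Φ (V i₀)) d w (Φ.symm F) := fun hF d => by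
    rw [genEig_transDer Φ _ h1 h2, AlgEquiv.apply_symm_apply]; exact hF d
  refine ⟨fun a => Φ (h a), transDer Φ.symm W, fun a => hΦc (hhc a), fun a => ?_, fun a => ?_,
    fun F => ?_, fun w F hF => ?_, fun W' hW' => ?_⟩
  · rw [← hΦX, ← map_sub, equiv_mem_lowIdeal Φ h1 h2]
    exact hhX a
  · simp [transDer_apply, hWh]
  · have := hWV (Φ.symm F)
    simp only [transDer_apply, AlgEquiv.apply_symm_apply, AlgEquiv.symm_symm] at this ⊢
    rw [this, AlgEquiv.apply_symm_apply]
  · rw [transDer_apply, hWg w _ (hgen hF), map_smul, AlgEquiv.symm_symm,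
      AlgEquiv.apply_symm_apply]
  · have h3 : transDer Φ W' = W := hWu _ fun w F hF => by
      rw [transDer_apply, hW' w (Φ F) fun d => (genEig_transDer Φ _ h1 h2).1 (hF d), map_smul,
        AlgEquiv.symm_apply_apply]
    rw [← h3]
    exact (transDer_symm Φ.symm W').symm

end Main

section Diagonalization

variable {σ τ : Type*} [Fintype σ] [Fintype τ] [DecidableEq σ] [DecidableEq τ]

theorem exists_eigenvector_basis {K E : Type*} [Field K] [IsAlgClosed K] [AddCommGroup E]
    [Module K E] [FiniteDimensional K E] {T : Module.End K E} (hT : T.IsSemisimple)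
    (hE : Module.finrank K E = Fintype.card τ) :
    ∃ (b : Module.Basis τ K E) (μ : τ → K), ∀ a, T (b a) = μ a • b a := by
  have hs : ⊤ ≤ Submodule.span K {v | ∃ c : K, T v = c • v} := by
    rw [← hT.iSup_eigenspace_eq_top]
    refine iSup_le fun c v hv => Submodule.subset_span ⟨c, ?_⟩
    exact Module.End.mem_eigenspace_iff.1 hv
  let b := Module.Basis.ofSpan hs
  have := Fintype.ofFinite ((linearIndepOn_empty K id).extend (Set.empty_subset
    {v | ∃ c : K, T v = c • v}))
  have hcard := (Module.finrank_eq_card_basis b).symm.trans hE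
  let e := Fintype.equivOfCardEq hcard
  have hb : ∀ a, ∃ c : K, T (b.reindex e a) = c • b.reindex e a := fun a => by
    rw [Module.Basis.reindex_apply]
    exact Module.Basis.ofSpan_subset hs ⟨_, rfl⟩
  choose μ hμ using hb
  exact ⟨b.reindex e, μ, hμ⟩

theorem exists_left_eigenvectors (S : Matrix σ σ ℝ) (hS : Module.End.IsSemisimple (Matrix.toLin' S))
    (hcard : Fintype.card σ = Fintype.card τ) :
    ∃ (P : Matrix τ σ ℂ) (Q : Matrix σ τ ℂ) (μ : τ → ℂ), P * Q = 1 ∧ Q * P = 1 ∧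
      ∀ a, Matrix.vecMul (P a) (S.map (algebraMap ℝ ℂ)) = μ a • P a := by
  set p := minpoly ℝ (Matrix.toLin' S)
  have hsep : (p.map (algebraMap ℝ ℂ)).Separable :=
    (PerfectField.separable_iff_squarefree.2 hS.minpoly_squarefree).map
  have h0 : Polynomial.aeval S p = 0 := by
    have h1 : p = minpoly ℝ S := Matrix.minpoly_toLin' S
    rw [h1]
    exact minpoly.aeval ℝ S
  have h1 : Polynomial.aeval (S.map (algebraMap ℝ ℂ)) (p.map (algebraMap ℝ ℂ)) = 0 := by
    rw [Polynomial.aeval_map_algebraMap]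
    have := Polynomial.aeval_algHom_apply (Algebra.ofId ℝ ℂ).mapMatrix S p
    rw [h0, map_zero] at this
    exact this
  have h2 : Polynomial.aeval (S.map (algebraMap ℝ ℂ)).transpose (p.map (algebraMap ℝ ℂ)) = 0 := by
    have h3 := Polynomial.aeval_algHom_apply (Matrix.transposeAlgEquiv σ ℂ ℂ)
      (S.map (algebraMap ℝ ℂ)) (p.map (algebraMap ℝ ℂ))
    rw [h1, map_zero] at h3
    rw [← MulOpposite.op_eq_zero_iff, ← h3]
    change _ = Polynomial.aeval (MulOpposite.op (S.map (algebraMap ℝ ℂ)).transpose) _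
    rw [Polynomial.aeval_eq_sum_range, Polynomial.aeval_eq_sum_range]
    simp
  have h3 : Polynomial.aeval (Matrix.toLin' (S.map (algebraMap ℝ ℂ)).transpose)
      (p.map (algebraMap ℝ ℂ)) = 0 := by
    have := Polynomial.aeval_algHom_apply (Matrix.toLinAlgEquiv' (R := ℂ) (n := σ))
      (S.map (algebraMap ℝ ℂ)).transpose (p.map (algebraMap ℝ ℂ))
    rw [h2, map_zero] at this
    exact this
  obtain ⟨b, μ, hb⟩ := exists_eigenvector_basis (τ := τ)
    (Module.End.isSemisimple_of_squarefree_aeval_eq_zero hsep.squarefree h3) (by simp [hcard])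
  refine ⟨((Pi.basisFun ℂ σ).toMatrix b).transpose, (b.toMatrix (Pi.basisFun ℂ σ)).transpose, μ,
    ?_, ?_, fun a => ?_⟩
  · rw [← Matrix.transpose_mul, Module.Basis.toMatrix_mul_toMatrix_flip, Matrix.transpose_one]
  · rw [← Matrix.transpose_mul, Module.Basis.toMatrix_mul_toMatrix_flip, Matrix.transpose_one]
  · have := hb a
    rw [Matrix.toLin'_apply, Matrix.mulVec_transpose] at this
    have hP : ((Pi.basisFun ℂ σ).toMatrix b).transpose a = b a := by
      ext i; simp [Module.Basis.toMatrix_apply]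
    rw [hP, this]

end Diagonalization

section Linear

variable {σ : Type*} [Fintype σ] [DecidableEq σ]

/-- The linear form with given coefficients. -/
noncomputable def lform {R : Type*} [CommRing R] (v : σ → R) : MvPowerSeries σ R := ∑ a, v a • X a

theorem lform_mem (v : σ → ℂ) : lform v ∈ lowIdeal σ ℂ 1 :=
  Ideal.sum_mem _ fun a _ => smul_mem_lowIdeal _ (X_mem_lowIdeal a)

theorem genEig_lform {D : Derivation ℂ (MvPowerSeries σ ℂ) (MvPowerSeries σ ℂ)}
    {L S N : Matrix σ σ ℂ} (hL : ∀ a, D (X a) - lform (L a) ∈ lowIdeal σ ℂ 2)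
    (hLSN : L = S + N) (hSN : S * N = N * S) (hN : IsNilpotent N) {v : σ → ℂ} {μ : ℂ}
    (hv : Matrix.vecMul v S = μ • v) : GenEig D 2 μ (lform v) := by
  have hD : ∀ a, D (X a) ∈ lowIdeal σ ℂ 1 := fun a => by
    have := Ideal.add_mem _ (lowIdeal_mono one_le_two (hL a)) (lform_mem (L a))
    simpa using this
  have hDv : ∀ u : σ → ℂ, D (lform u) - lform (Matrix.vecMul u L) ∈ lowIdeal σ ℂ 2 := fun u => by
    have h1 : D (lform u) - lform (Matrix.vecMul u L) = ∑ a, u a • (D (X a) - lform (L a)) := by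
      simp only [lform, map_sum, Derivation.map_smul, Matrix.vecMul, dotProduct, smul_sub,
        Finset.sum_sub_distrib, Finset.smul_sum, smul_smul, Finset.sum_smul]
      rw [Finset.sum_comm]
    rw [h1]
    exact Ideal.sum_mem _ fun a _ => smul_mem_lowIdeal _ (hL a)
  have hpow : ∀ k, Matrix.vecMul (Matrix.vecMul v (N ^ k)) S = μ • Matrix.vecMul v (N ^ k) :=
    fun k => by
      have : S * N ^ k = N ^ k * S := (Commute.pow_right (a := S) (b := N) hSN k).eq
      rw [Matrix.vecMul_vecMul, ← this, ← Matrix.vecMul_vecMul, hv, Matrix.smul_vecMul]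
  have key : ∀ k, (shiftOp D μ ^ k) (lform v) - lform (Matrix.vecMul v (N ^ k)) ∈
      lowIdeal σ ℂ 2 := by
    intro k
    induction k with
    | zero => simp
    | succ k ih =>
      have h1 := shiftOp_pow_mem hD μ 1 ih
      have h2 := hDv (Matrix.vecMul v (N ^ k))
      rw [pow_one, map_sub, shiftOp_apply (g := lform _)] at h1
      have h3 : lform (Matrix.vecMul (Matrix.vecMul v (N ^ k)) L) =
          μ • lform (Matrix.vecMul v (N ^ k)) + lform (Matrix.vecMul v (N ^ (k + 1))) := by
        rw [hLSN, Matrix.vecMul_add, hpow, Matrix.vecMul_vecMul, ← pow_succ]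
        simp [lform, add_smul, Finset.sum_add_distrib, Finset.smul_sum, smul_smul]
      rw [h3] at h2
      rw [pow_succ', Module.End.mul_apply]
      convert Ideal.add_mem _ h1 h2 using 1
      abel
  obtain ⟨k, hk⟩ := hN
  refine ⟨k, ?_⟩
  have := key k
  rw [hk] at this
  simpa [lform] using this

end Linear

section FieldDer

variable {σ R : Type*} [Fintype σ] [CommRing R]

/-- The derivation attached to a formal vector field. -/
noncomputable def fieldDer (F : σ → MvPowerSeries σ R) :
    Derivation R (MvPowerSeries σ R) (MvPowerSeries σ R) := ∑ b, F b • pderiv R b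

theorem fieldDer_apply (F : σ → MvPowerSeries σ R) (g : MvPowerSeries σ R) :
    fieldDer F g = ∑ b, F b * pderiv R b g := by
  rw [fieldDer, ← Derivation.coeFnAddMonoidHom_apply, map_sum, Finset.sum_apply]
  rfl

theorem fieldDer_X [DecidableEq σ] (F : σ → MvPowerSeries σ R) (a : σ) :
    fieldDer F (X a) = F a := by
  simp [fieldDer_apply, pderiv_X, Pi.single_apply]

theorem fieldDer_comm {F G : σ → MvPowerSeries σ R}
    (h : ∀ a, fieldDer F (G a) = fieldDer G (F a)) (g : MvPowerSeries σ R) :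
    fieldDer F (fieldDer G g) = fieldDer G (fieldDer F g) := by
  classical
  have : ⁅fieldDer F, fieldDer G⁆ = 0 := derivation_ext_X fun a => by
    simp [Derivation.commutator_apply, fieldDer_X, h a]
  have h2 := DFunLike.congr_fun this g
  rw [Derivation.commutator_apply, Derivation.zero_apply] at h2
  exact sub_eq_zero.1 h2

variable {S : Type*} [CommRing S] (φ : R →+* S)

theorem map_pderiv (b : σ) (g : MvPowerSeries σ R) :
    MvPowerSeries.map φ (pderiv R b g) = pderiv S b (MvPowerSeries.map φ g) := by
  ext α
  simp [coeff_pderiv, coeff_map]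

theorem map_fieldDer (F : σ → MvPowerSeries σ R) (g : MvPowerSeries σ R) :
    MvPowerSeries.map φ (fieldDer F g) =
      fieldDer (fun a => MvPowerSeries.map φ (F a)) (MvPowerSeries.map φ g) := by
  simp [fieldDer_apply, map_pderiv]

theorem map_smul_series (a : R) (g : MvPowerSeries σ R) :
    MvPowerSeries.map φ (a • g) = φ a • MvPowerSeries.map φ g := by
  simp [smul_eq_C_mul]

theorem map_coeff_mem_lowIdeal {d : ℕ} {g : MvPowerSeries σ R} (hg : g ∈ lowIdeal σ R d) :
    MvPowerSeries.map φ g ∈ lowIdeal σ S d := by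
  rw [mem_lowIdeal] at hg ⊢
  intro α hα
  rw [coeff_map, hg α hα, map_zero]

theorem map_injective_series (hφ : Function.Injective φ) :
    Function.Injective (MvPowerSeries.map (σ := σ) φ) := fun f g h => by
  ext α
  apply hφ
  rw [← coeff_map, ← coeff_map, h]

end FieldDer

section Conj

variable {σ : Type*} [Fintype σ]

/-- Complexification of real power series. -/
noncomputable abbrev cplx : MvPowerSeries σ ℝ →+* MvPowerSeries σ ℂ :=
  MvPowerSeries.map (algebraMap ℝ ℂ)

/-- Coefficientwise complex conjugation. -/
noncomputable abbrev conjS : MvPowerSeries σ ℂ →+* MvPowerSeries σ ℂ :=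
  MvPowerSeries.map (starRingEnd ℂ)

theorem conjS_conjS (g : MvPowerSeries σ ℂ) : conjS (conjS g) = g := by
  ext α; simp

theorem conjS_cplx (g : MvPowerSeries σ ℝ) : conjS (cplx g) = cplx g := by
  ext α; simp [coeff_map]

/-- Coefficientwise real part. -/
noncomputable def reS (g : MvPowerSeries σ ℂ) : MvPowerSeries σ ℝ := fun α => (coeff α g).re

theorem coeff_reS (g : MvPowerSeries σ ℂ) (α : σ →₀ ℕ) : coeff α (reS g) = (coeff α g).re := rfl

theorem cplx_reS (g : MvPowerSeries σ ℂ) :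
    cplx (reS g) = (2⁻¹ : ℂ) • (g + conjS g) := by
  ext α
  rw [coeff_map, coeff_reS, coeff_smul, map_add, coeff_map]
  simp [Complex.add_conj]

theorem conv_cplx {g : MvPowerSeries σ ℝ} : Conv (cplx g) ↔ Conv g := by
  simp [Conv, coeff_map]

theorem Conv.reS {g : MvPowerSeries σ ℂ} (hg : Conv g) : Conv (reS g) := by
  obtain ⟨C, hC, h⟩ := hg
  exact ⟨C, hC, fun α => (Complex.abs_re_le_norm _).trans (h α)⟩

/-- The complex conjugate of a derivation. -/
noncomputable def conjDeriv (W : Derivation ℂ (MvPowerSeries σ ℂ) (MvPowerSeries σ ℂ)) :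
    Derivation ℂ (MvPowerSeries σ ℂ) (MvPowerSeries σ ℂ) :=
  Derivation.mk' { toFun := fun g => conjS (W (conjS g))
                   map_add' := fun g h => by simp
                   map_smul' := fun a g => by
                    simp [map_smul_series, Derivation.map_smul] }
    fun a b => by simp

theorem conjDeriv_apply (W : Derivation ℂ (MvPowerSeries σ ℂ) (MvPowerSeries σ ℂ))
    (g : MvPowerSeries σ ℂ) : conjDeriv W g = conjS (W (conjS g)) := rfl

theorem GenEig.conjS {D : Derivation ℂ (MvPowerSeries σ ℂ) (MvPowerSeries σ ℂ)}
    (hD : ∀ g, D (conjS g) = conjS (D g)) {d : ℕ} {w : ℂ} {g : MvPowerSeries σ ℂ}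
    (hg : GenEig D d w g) : GenEig D d (starRingEnd ℂ w) (conjS g) := by
  obtain ⟨N, hN⟩ := hg
  refine ⟨N, ?_⟩
  have : ∀ k, (shiftOp D (starRingEnd ℂ w) ^ k) (PoincareDulac.conjS g) =
      PoincareDulac.conjS ((shiftOp D w ^ k) g) := fun k => by
    induction k with
    | zero => rfl
    | succ k ih =>
      rw [pow_succ', pow_succ', Module.End.mul_apply, Module.End.mul_apply, ih, shiftOp_apply,
        shiftOp_apply, hD, map_sub, map_smul_series]
  rw [this]
  exact map_coeff_mem_lowIdeal _ hN

end Conj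

section Main

variable {κ ι σ : Type*} [Fintype κ] [Fintype ι] [DecidableEq κ] [DecidableEq ι] [Fintype σ]
  [DecidableEq σ]

/-- The Jacobian matrix of a tuple of power series. -/
noncomputable def jacS {R : Type*} [CommRing R] (G : σ → MvPowerSeries σ R) :
    Matrix σ σ (MvPowerSeries σ R) := Matrix.of fun a b => pderiv R b (G a)

theorem mulVec_derivation {R : Type*} [CommRing R]
    (W : Derivation R (MvPowerSeries σ R) (MvPowerSeries σ R)) (G : σ → MvPowerSeries σ R) :
    (jacS G).mulVec (fun b => W (X b)) = fun a => W (G a) := by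
  ext1 a
  rw [derivation_apply W (G a)]
  rfl

theorem cplx_det_ne_zero {ν : Type*} [Fintype ν] [DecidableEq ν]
    {A : Matrix ν ν (MvPowerSeries σ ℝ)} (hA : A.det ≠ 0) : (A.map cplx).det ≠ 0 := fun h => by
  refine hA (map_injective_series _ (algebraMap ℝ ℂ).injective ?_)
  rw [map_zero, ← h]
  exact RingHom.map_det cplx A

theorem exists_real_eigencoords (f : κ → MvPowerSeries σ ℝ) (F : ι → σ → MvPowerSeries σ ℝ)
    (hFf : ∀ i k, fieldDer (F i) (f k) = 0)
    (hFF : ∀ i j a, fieldDer (F i) (F j a) = fieldDer (F j) (F i a))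
    (hfc : ∀ k, Conv (f k)) (hFc : ∀ i a, Conv (F i a))
    (t : κ → σ) (ht : (Matrix.of fun k k' => pderiv ℝ (t k') (f k)).det ≠ 0)
    (s : ι → σ) (hs : (Matrix.of fun i j => F i (s j)).det ≠ 0)
    (hcard : Fintype.card σ = Fintype.card (κ ⊕ ι)) (i₀ : ι)
    {L S N : Matrix σ σ ℝ} (hL : ∀ a, F i₀ a - lform (L a) ∈ lowIdeal σ ℝ 2)
    (hLSN : L = S + N) (hSN : S * N = N * S) (hN : IsNilpotent N)
    (hS : Module.End.IsSemisimple (Matrix.toLin' S)) :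
    ∃ G : σ → MvPowerSeries σ ℝ, (∀ a, Conv (G a)) ∧ (∀ a, G a - X a ∈ lowIdeal σ ℝ 2) ∧
      (jacS fun a => fieldDer (F i₀) (G a)).mulVec
        ((jacS G).adjugate.mulVec ((S.map C).mulVec G)) =
      (jacS G).det • (S.map C).mulVec fun a => fieldDer (F i₀) (G a) := by
  obtain ⟨P, Q, μ, hPQ, hQP, hP⟩ := exists_left_eigenvectors S hS hcard
  let V : ι → Derivation ℂ (MvPowerSeries σ ℂ) (MvPowerSeries σ ℂ) :=
    fun i => fieldDer fun a => cplx (F i a)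
  have hVX : ∀ i a, V i (X a) = cplx (F i a) := fun i a => fieldDer_X _ a
  have hVr : ∀ i g, V i (cplx g) = cplx (fieldDer (F i) g) := fun i g => (map_fieldDer _ _ _).symm
  have hL' : ∀ a, V i₀ (X a) - lform (L.map (algebraMap ℝ ℂ) a) ∈ lowIdeal σ ℂ 2 := fun a => by
    have := map_coeff_mem_lowIdeal (algebraMap ℝ ℂ) (hL a)
    rw [map_sub, ← hVX] at this
    simpa [lform, map_smul_series, Matrix.map_apply] using this
  have hμ : ∀ a, GenEig (V i₀) 2 (μ a) (linForm P a) := fun a => by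
    refine genEig_lform (S := S.map (algebraMap ℝ ℂ)) (N := N.map (algebraMap ℝ ℂ)) hL' ?_ ?_ ?_
      (hP a)
    · rw [hLSN, Matrix.map_add _ (map_add _)]
    · rw [← Matrix.map_mul, hSN, Matrix.map_mul]
    · exact hN.map (algebraMap ℝ ℂ).mapMatrix
  have hD : ∀ a, V i₀ (X a) ∈ lowIdeal σ ℂ 1 := fun a => by
    have := Ideal.add_mem _ (lowIdeal_mono one_le_two (hL' a))
      (lform_mem (L.map (algebraMap ℝ ℂ) a))
    rwa [sub_add_cancel] at this
  obtain ⟨h, W, hhc, hhP, hWh, hWV, hWg, hWu⟩ := exists_semisimple_part_of_linForm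
    (fun k => cplx (f k)) V (fun i k => by rw [hVr, hFf, map_zero])
    (fun i j => fieldDer_comm fun a => by
      rw [← map_fieldDer, ← map_fieldDer, hFF])
    (fun k => conv_cplx.2 (hfc k)) (fun i a => by rw [hVX]; exact conv_cplx.2 (hFc i a))
    (fun k => pderiv ℂ (t k))
    (by
      have := cplx_det_ne_zero ht
      convert this using 2
      refine Matrix.ext fun k k' => ?_
      simp [map_pderiv])
    (fun j => X (s j))
    (by
      have := cplx_det_ne_zero hs
      convert this using 2
      refine Matrix.ext fun k k' => ?_
      simp [hVX])
    i₀ hD P Q hPQ hQP hμ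
  have hconj : conjDeriv W = W := hWu _ fun w g hg => by
    rw [conjDeriv_apply, hWg (starRingEnd ℂ w) (conjS g) fun d => (hg d).conjS fun g => ?_,
      map_smul_series, conjS_conjS, Complex.conj_conj]
    rw [map_fieldDer]
    simp only [conjS_cplx]
    rfl
  let H : σ → MvPowerSeries σ ℂ := fun a => ∑ j, Q a j • h j
  have hWH : ∀ a, W (H a) = ∑ b, (S a b : ℂ) • H b := fun a => by
    have hSQ : ∀ j, ∑ b, (S a b : ℂ) * Q b j = Q a j * μ j := by
      have h1 : P * S.map (algebraMap ℝ ℂ) = Matrix.diagonal μ * P := by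
        refine Matrix.ext fun i j => ?_
        have := congrFun (hP i) j
        rw [Matrix.diagonal_mul]
        exact this
      have h2 : S.map (algebraMap ℝ ℂ) * Q = Q * Matrix.diagonal μ := by
        calc S.map (algebraMap ℝ ℂ) * Q = (Q * P) * S.map (algebraMap ℝ ℂ) * Q := by
              rw [hQP, one_mul]
          _ = Q * (P * S.map (algebraMap ℝ ℂ)) * Q := by simp only [Matrix.mul_assoc]
          _ = Q * Matrix.diagonal μ * (P * Q) := by rw [h1]; simp only [Matrix.mul_assoc]
          _ = _ := by rw [hPQ, Matrix.mul_one]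
      intro j
      have := congrFun (congrFun h2 a) j
      rw [Matrix.mul_diagonal] at this
      exact this
    simp only [H, map_sum, Derivation.map_smul, hWh, Finset.smul_sum, smul_smul]
    rw [Finset.sum_comm]
    refine Finset.sum_congr rfl fun j _ => ?_
    rw [← Finset.sum_smul, hSQ]
  have hHX : ∀ a, H a - X a ∈ lowIdeal σ ℂ 2 := fun a => by
    have h1 : X a = ∑ j, Q a j • linForm P j := by
      have := ev_linForm Q P hQP a
      simpa [linForm, map_sum, map_smul] using this.symm
    rw [h1, ← Finset.sum_sub_distrib]
    simp only [← smul_sub]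
    exact Ideal.sum_mem _ fun j _ => smul_mem_lowIdeal _ (hhP j)
  let G : σ → MvPowerSeries σ ℝ := fun a => reS (H a)
  have hWG : ∀ a, W (cplx (G a)) = ∑ b, (S a b : ℂ) • cplx (G b) := fun a => by
    have h1 : W (conjS (H a)) = ∑ b, (S a b : ℂ) • conjS (H b) := by
      rw [← conjS_conjS (W (conjS (H a))), ← conjDeriv_apply, hconj, hWH, map_sum]
      simp only [map_smul_series, Complex.conj_ofReal]
    simp only [G, cplx_reS, Derivation.map_smul, map_add, h1, hWH, ← Finset.sum_add_distrib,
      Finset.smul_sum]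
    refine Finset.sum_congr rfl fun b _ => ?_
    rw [← smul_add, smul_comm]
  have hWZ : ∀ a, W (cplx (fieldDer (F i₀) (G a))) =
      ∑ b, (S a b : ℂ) • cplx (fieldDer (F i₀) (G b)) := fun a => by
    simp only [← hVr, hWV, hWG, map_sum, Derivation.map_smul]
  refine ⟨G, fun a => ?_, fun a => ?_, ?_⟩
  · exact (Conv.sum _ fun j _ => conv_smul _ (hhc j)).reS
  · rw [mem_lowIdeal]
    intro α hα
    have := mem_lowIdeal.1 (hHX a) α hα
    rw [map_sub, sub_eq_zero] at this ⊢
    rw [coeff_reS, this, coeff_X, coeff_X]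
    split_ifs <;> simp
  · have hjac : ∀ G' : σ → MvPowerSeries σ ℝ,
        (jacS G').map cplx = jacS fun a => cplx (G' a) := fun G' => by
      refine Matrix.ext fun a b => ?_
      simp [jacS, map_pderiv]
    have hSC : ∀ G' : σ → MvPowerSeries σ ℝ, (fun a => cplx ((S.map C).mulVec G' a)) =
        fun a => ∑ b, (S a b : ℂ) • cplx (G' b) := fun G' => by
      ext1 a
      simp [Matrix.mulVec, dotProduct, smul_eq_C_mul]
    have hmv : ∀ (A : Matrix σ σ (MvPowerSeries σ ℝ)) (v : σ → MvPowerSeries σ ℝ),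
        (fun a => cplx (A.mulVec v a)) = (A.map cplx).mulVec fun a => cplx (v a) :=
      fun A v => by
        ext1 a
        exact RingHom.map_mulVec cplx A v a
    have h1 : (fun a => cplx ((jacS G).adjugate.mulVec ((S.map C).mulVec G) a)) =
        ((jacS G).map cplx).det • fun b => W (X b) := by
      rw [hmv, hSC]
      have h2 := mulVec_derivation W fun a => cplx (G a)
      simp only [hWG] at h2
      have h3 : (jacS G).adjugate.map cplx = ((jacS G).map cplx).adjugate :=
        RingHom.map_adjugate cplx (jacS G)
      rw [← h2, h3, ← hjac, Matrix.mulVec_mulVec, Matrix.adjugate_mul, Matrix.smul_mulVec,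
        Matrix.one_mulVec]
    ext1 a
    refine map_injective_series _ (algebraMap ℝ ℂ).injective ?_
    have h4 := mulVec_derivation W fun a => cplx (fieldDer (F i₀) (G a))
    have h5 := congrFun (hmv (jacS fun a => fieldDer (F i₀) (G a))
      ((jacS G).adjugate.mulVec ((S.map C).mulVec G))) a
    refine h5.trans ?_
    rw [h1, hjac, Matrix.mulVec_smul, h4, Pi.smul_apply, Pi.smul_apply, hWZ, smul_eq_mul,
      smul_eq_mul, map_mul, RingHom.map_det]
    congr 1
    exact (congrFun (hSC fun a => fieldDer (F i₀) (G a)) a).symm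

end Main

section SumFn

variable {σ : Type*} [Fintype σ]

/-- The monomial function with exponent `α`. -/
def mono (α : σ →₀ ℕ) (x : σ → ℝ) : ℝ := ∏ i, x i ^ α i

theorem mono_zero (x : σ → ℝ) : mono 0 x = 1 := by simp [mono]

theorem mono_add (α β : σ →₀ ℕ) (x : σ → ℝ) : mono (α + β) x = mono α x * mono β x := by
  simp [mono, pow_add, Finset.prod_mul_distrib]

theorem mono_at_zero {α : σ →₀ ℕ} (h : α ≠ 0) : mono α 0 = 0 := by
  obtain ⟨i, hi⟩ := Finsupp.ne_iff.1 h
  exact Finset.prod_eq_zero (Finset.mem_univ i) (by simpa using hi)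

theorem norm_mono_le (α : σ →₀ ℕ) {x : σ → ℝ} {r : ℝ} (hx : ‖x‖ ≤ r) :
    ‖mono α x‖ ≤ r ^ α.degree := by
  rw [mono, norm_prod, Finsupp.degree_eq_sum, ← Finset.prod_pow_eq_pow_sum]
  refine Finset.prod_le_prod (fun _ _ => norm_nonneg _) fun i _ => ?_
  rw [norm_pow]
  exact pow_le_pow_left₀ (norm_nonneg _) ((norm_le_pi_norm x i).trans hx) _

theorem summable_half_pow_degree : Summable fun α : σ →₀ ℕ => (1 / 2 : ℝ) ^ α.degree :=
  summable_of_sum_le (fun _ => by positivity) sum_half_pow_degree_le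

/-- The function defined by a power series. -/
noncomputable def sumFn (F : MvPowerSeries σ ℝ) (x : σ → ℝ) : ℝ := ∑' α, coeff α F * mono α x

theorem sumFn_zero : sumFn (0 : MvPowerSeries σ ℝ) = 0 := by
  ext x; simp [sumFn]

theorem sumFn_at_zero (F : MvPowerSeries σ ℝ) : sumFn F 0 = constantCoeff F := by
  rw [sumFn, tsum_eq_single 0 fun α hα => by rw [mono_at_zero hα, mul_zero], mono_zero, mul_one,
    coeff_zero_eq_constantCoeff_apply]

theorem Conv.eventually_summable {F : MvPowerSeries σ ℝ} (hF : Conv F) :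
    ∀ᶠ x in 𝓝 (0 : σ → ℝ), Summable fun α => ‖coeff α F * mono α x‖ := by
  obtain ⟨C, hC, h⟩ := hF
  have hr : 0 < 1 / (2 * C) := by positivity
  filter_upwards [Metric.ball_mem_nhds 0 hr] with x hx
  refine (summable_half_pow_degree.mul_left C).of_nonneg_of_le (fun _ => norm_nonneg _)
    fun α => ?_
  rw [norm_mul]
  have hx' : ‖x‖ ≤ 1 / (2 * C) := by simpa using (mem_ball_zero_iff.1 hx).le
  calc _ ≤ C ^ (α.degree + 1) * (1 / (2 * C)) ^ α.degree :=
        mul_le_mul (h α) (norm_mono_le α hx') (norm_nonneg _) (by positivity)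
    _ = C * (C * (1 / (2 * C))) ^ α.degree := by rw [pow_succ, mul_pow]; ring
    _ = _ := by congr 2; field_simp

theorem sumFn_add {F G : MvPowerSeries σ ℝ} (hF : Conv F) (hG : Conv G) :
    ∀ᶠ x in 𝓝 0, sumFn (F + G) x = sumFn F x + sumFn G x := by
  filter_upwards [hF.eventually_summable, hG.eventually_summable] with x h1 h2
  rw [sumFn, sumFn, sumFn, ← h1.of_norm.tsum_add h2.of_norm]
  simp [add_mul]

theorem sumFn_mul {F G : MvPowerSeries σ ℝ} (hF : Conv F) (hG : Conv G) :
    ∀ᶠ x in 𝓝 0, sumFn (F * G) x = sumFn F x * sumFn G x := by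
  classical
  filter_upwards [hF.eventually_summable, hG.eventually_summable] with x h1 h2
  rw [sumFn, sumFn, sumFn, h1.of_norm.tsum_mul_tsum_eq_tsum_sum_antidiagonal h2.of_norm
    (summable_mul_of_summable_norm h1 h2)]
  refine tsum_congr fun α => ?_
  rw [coeff_mul, Finset.sum_mul]
  refine Finset.sum_congr rfl fun β hβ => ?_
  rw [← Finset.HasAntidiagonal.mem_antidiagonal.1 hβ, mono_add]
  ring

theorem sumFn_C (a : ℝ) (x : σ → ℝ) : sumFn (C a : MvPowerSeries σ ℝ) x = a := by
  classical
  rw [sumFn, tsum_eq_single 0 fun α hα => by simp [coeff_C, hα], mono_zero]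
  simp

variable [DecidableEq σ]

theorem hasFDerivAt_mono (α : σ →₀ ℕ) (x : σ → ℝ) :
    HasFDerivAt (mono α) (∑ i, ((α i : ℝ) * mono (α - Finsupp.single i 1) x) •
      (ContinuousLinearMap.proj i : (σ → ℝ) →L[ℝ] ℝ)) x := by
  have h1 : ∀ i ∈ Finset.univ, HasFDerivAt (fun y : σ → ℝ => y i ^ α i)
      ((α i * x i ^ (α i - 1)) • (ContinuousLinearMap.proj i : (σ → ℝ) →L[ℝ] ℝ)) x :=
    fun i _ => by
      have := (hasFDerivAt_apply (𝕜 := ℝ) i x).pow (α i)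
      simpa using this
  refine (HasFDerivAt.finsetProd h1).congr_fderiv (Finset.sum_congr rfl fun i _ => ?_)
  rw [smul_smul]
  congr 1
  rw [mono, ← Finset.mul_prod_erase _ _ (Finset.mem_univ i)]
  have : ∏ j ∈ Finset.univ.erase i, x j ^ (α - Finsupp.single i 1 : σ →₀ ℕ) j =
      ∏ j ∈ Finset.univ.erase i, x j ^ α j := Finset.prod_congr rfl fun j hj => by
    simp [(Finset.ne_of_mem_erase hj).symm]
  rw [this]
  simp
  ring

/-- The partial derivative of a function. -/
noncomputable def pd (i : σ) (g : (σ → ℝ) → ℝ) (x : σ → ℝ) : ℝ := fderiv ℝ g x (Pi.single i 1)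

theorem norm_deriv_term_le {F : MvPowerSeries σ ℝ} {C : ℝ} (hC : 1 ≤ C)
    (h : ∀ α : σ →₀ ℕ, ‖coeff α F‖ ≤ C ^ (α.degree + 1)) {x : σ → ℝ} (hx : ‖x‖ ≤ 1 / (4 * C))
    (α : σ →₀ ℕ) (i : σ) :
    ‖coeff α F * ((α i : ℝ) * mono (α - Finsupp.single i 1) x)‖ ≤
      4 * C ^ 2 * (1 / 2) ^ α.degree := by
  by_cases hi : α i = 0
  · simp only [hi, Nat.cast_zero, zero_mul, mul_zero, norm_zero]
    positivity
  have hdeg : (α - Finsupp.single i 1).degree + 1 = α.degree := by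
    have h1 : α - Finsupp.single i 1 + Finsupp.single i 1 = α :=
      tsub_add_cancel_of_le (Finsupp.single_le_iff.2 (Nat.one_le_iff_ne_zero.2 hi))
    have := congrArg Finsupp.degree h1
    rwa [map_add, Finsupp.degree_single] at this
  set k := (α - Finsupp.single i 1).degree
  have h2 : ‖(α i : ℝ)‖ ≤ 2 ^ α.degree := by
    rw [Real.norm_natCast]
    have h3 := Finsupp.le_degree i α
    have h4 := Nat.lt_two_pow_self (n := α.degree)
    have h5 : α i ≤ 2 ^ α.degree := by omega
    exact_mod_cast h5
  rw [norm_mul, norm_mul]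
  calc _ ≤ C ^ (α.degree + 1) * (2 ^ α.degree * (1 / (4 * C)) ^ k) := by
        refine mul_le_mul (h α) (mul_le_mul h2 (norm_mono_le _ hx) (norm_nonneg _)
          (by positivity)) (by positivity) (by positivity)
    _ = _ := by
        rw [← hdeg]
        have h6 : C * 2 * (1 / (4 * C)) = 1 / 2 := by field_simp; norm_num
        calc C ^ (k + 1 + 1) * (2 ^ (k + 1) * (1 / (4 * C)) ^ k)
            = 2 * C ^ 2 * (C * 2 * (1 / (4 * C))) ^ k := by
              rw [mul_pow, mul_pow]; ring
          _ = _ := by rw [h6]; ring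

theorem pd_sumFn {F : MvPowerSeries σ ℝ} (hF : Conv F) (i : σ) :
    pd i (sumFn F) =ᶠ[𝓝 0] sumFn (pderiv ℝ i F) := by
  obtain ⟨C, hC, h⟩ := hF
  have hr : 0 < 1 / (4 * C) := by positivity
  let f' : (σ →₀ ℕ) → (σ → ℝ) → (σ → ℝ) →L[ℝ] ℝ := fun α x => coeff α F •
    ∑ i, ((α i : ℝ) * mono (α - Finsupp.single i 1) x) •
      (ContinuousLinearMap.proj i : (σ → ℝ) →L[ℝ] ℝ)
  have hf' : ∀ α x, x ∈ Metric.ball (0 : σ → ℝ) (1 / (4 * C)) →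
      ‖f' α x‖ ≤ Fintype.card σ * (4 * C ^ 2 * (1 / 2) ^ α.degree) := fun α x hx => by
    have hx' : ‖x‖ ≤ 1 / (4 * C) := (mem_ball_zero_iff.1 hx).le
    simp only [f', Finset.smul_sum, smul_smul]
    refine (norm_sum_le _ _).trans ?_
    rw [← nsmul_eq_mul, ← Finset.card_univ]
    refine Finset.sum_le_card_nsmul _ _ _ fun j _ => ?_
    rw [norm_smul]
    refine (mul_le_mul (norm_deriv_term_le hC h hx' α j) (d := 1) ?_ (norm_nonneg _)
      (by positivity)).trans (by rw [mul_one])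
    refine ContinuousLinearMap.opNorm_le_bound _ zero_le_one fun y => ?_
    rw [one_mul]
    exact norm_le_pi_norm y j
  have hsum : Summable fun α : σ →₀ ℕ =>
      (Fintype.card σ : ℝ) * (4 * C ^ 2 * (1 / 2) ^ α.degree) :=
    (summable_half_pow_degree.mul_left _).mul_left _
  filter_upwards [Metric.ball_mem_nhds 0 hr] with x hx
  have hd : HasFDerivAt (sumFn F) (∑' α, f' α x) x :=
    hasFDerivAt_tsum_of_isPreconnected hsum Metric.isOpen_ball
      (convex_ball _ _).isPreconnected
      (fun α y _ => (hasFDerivAt_mono α y).const_mul (coeff α F)) hf' (Metric.mem_ball_self hr)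
      (by
        refine summable_of_ne_finset_zero (s := {0}) fun α hα => ?_
        rw [mono_at_zero (by simpa using hα), mul_zero]) hx
  rw [pd, hd.fderiv]
  have hs : Summable fun α => f' α x := Summable.of_norm_bounded hsum fun α => hf' α x hx
  have h1 : (∑' α, f' α x) (Pi.single i 1) =
      ∑' α, coeff α F * ((α i : ℝ) * mono (α - Finsupp.single i 1) x) := by
    rw [← ContinuousLinearMap.apply_apply (𝕜 := ℝ) (Fₗ := ℝ) (Pi.single i 1) (∑' α, f' α x),
      ContinuousLinearMap.map_tsum _ hs]
    refine tsum_congr fun α => ?_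
    simp [f', Pi.single_apply]
  rw [h1, sumFn]
  have hinj : Function.Injective fun β : σ →₀ ℕ => β + Finsupp.single i 1 :=
    add_left_injective _
  rw [← hinj.tsum_eq]
  · refine tsum_congr fun β => ?_
    simp only [add_tsub_cancel_right, coeff_pderiv]
    simp
    ring
  · intro α hα
    refine ⟨α - Finsupp.single i 1, tsub_add_cancel_of_le (Finsupp.single_le_iff.2 ?_)⟩
    by_contra h0
    have h2 : α i = 0 := by omega
    simp [h2] at hα

theorem Conv.pderiv_real {F : MvPowerSeries σ ℝ} (hF : Conv F) (i : σ) :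
    Conv (MvPowerSeries.pderiv ℝ i F) := by
  rw [← conv_cplx, map_pderiv]
  exact (conv_cplx.2 hF).pderiv i

theorem eq_zero_of_sumFn {F : MvPowerSeries σ ℝ} (hF : Conv F) (h : sumFn F =ᶠ[𝓝 0] 0) :
    F = 0 := by
  refine eq_zero_of_forall_mem_lowIdeal fun d => ?_
  induction d generalizing F with
  | zero => exact lowIdeal_zero _
  | succ d ih =>
    have h1 : ∀ i, pderiv ℝ i F ∈ lowIdeal σ ℝ d := fun i => by
      refine ih (hF.pderiv_real i) ((pd_sumFn hF i).symm.trans ?_)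
      filter_upwards [h.fderiv (𝕜 := ℝ)] with x hx
      rw [pd, hx]
      simp
    rw [mem_lowIdeal]
    intro α hα
    by_cases h0 : α = 0
    · rw [h0, coeff_zero_eq_constantCoeff_apply, ← sumFn_at_zero, h.self_of_nhds]; rfl
    · obtain ⟨i, hi⟩ := Finsupp.ne_iff.1 h0
      have h2 : α - Finsupp.single i 1 + Finsupp.single i 1 = α :=
        tsub_add_cancel_of_le (Finsupp.single_le_iff.2 (Nat.one_le_iff_ne_zero.2 hi))
      have h3 := mem_lowIdeal.1 (h1 i) (α - Finsupp.single i 1) (by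
        have := congrArg Finsupp.degree h2
        rw [map_add, Finsupp.degree_single] at this
        omega)
      rw [coeff_pderiv, h2] at h3
      refine (mul_eq_zero.1 h3).resolve_right ?_
      positivity

end SumFn

section Analytic

variable {σ : Type*} [Fintype σ] [DecidableEq σ]

theorem mem_finsuppAntidiag_univ {k : ℕ} {α : σ →₀ ℕ} :
    α ∈ (Finset.univ : Finset σ).finsuppAntidiag k ↔ α.degree = k := by
  rw [Finset.mem_finsuppAntidiag, Finsupp.degree_eq_sum]
  simp

theorem tsum_fiber_degree (u : (σ →₀ ℕ) → ℝ) (k : ℕ) :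
    ∑' β : ((Finsupp.degree : (σ →₀ ℕ) → ℕ) ⁻¹' ({k} : Set ℕ) : Set (σ →₀ ℕ)), u β =
      ∑ α ∈ (Finset.univ : Finset σ).finsuppAntidiag k, u α := by
  have : ((Finsupp.degree : (σ →₀ ℕ) → ℕ) ⁻¹' ({k} : Set ℕ) : Set (σ →₀ ℕ)) =
      ((Finset.univ : Finset σ).finsuppAntidiag k : Finset (σ →₀ ℕ)) := by
    ext α
    simp only [Set.mem_preimage, Set.mem_singleton_iff, Finset.mem_coe, mem_finsuppAntidiag_univ]
  rw [this, ← Finset.tsum_subtype]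
  rfl

theorem hasSum_homogeneous {F : MvPowerSeries σ ℝ} {x : σ → ℝ}
    (h : Summable fun α => ‖coeff α F * mono α x‖) :
    HasSum (fun k => ∑ α ∈ (Finset.univ : Finset σ).finsuppAntidiag k, coeff α F * mono α x)
      (sumFn F x) := by
  have := h.of_norm.hasSum.tsum_fiberwise (Finsupp.degree : (σ →₀ ℕ) → ℕ)
  have h2 := funext fun k => tsum_fiber_degree (fun α => coeff α F * mono α x) k
  exact h2 ▸ this

theorem exists_multilinear_mono (k : ℕ) (α : σ →₀ ℕ) :
    ∃ M : (σ → ℝ)[×k]→L[ℝ] ℝ, ‖M‖ ≤ 1 ∧ (α.degree = k → ∀ x, M (fun _ => x) = mono α x) := by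
  by_cases h : α.degree = k
  swap
  · exact ⟨0, by simp, fun h' => absurd h' h⟩
  have hl : ∃ l : List σ, l.length = k ∧ ∀ x : σ → ℝ, (l.map x).prod = mono α x := by
    refine ⟨(Finsupp.toMultiset α).toList, ?_, fun x => ?_⟩
    · rw [Multiset.length_toList, Finsupp.card_toMultiset, Finsupp.sum_fintype _ _ (by simp),
        ← h, Finsupp.degree_eq_sum]
      rfl
    · rw [← Multiset.prod_coe, ← Multiset.map_coe, Multiset.coe_toList, Finsupp.toMultiset_map,
        Finsupp.prod_toMultiset, Finsupp.prod_mapDomain_index (by simp) (by simp [pow_add]),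
        Finsupp.prod_fintype _ _ (by simp), mono]
  obtain ⟨l, rfl, hl⟩ := hl
  refine ⟨(ContinuousMultilinearMap.mkPiAlgebraFin ℝ l.length ℝ).compContinuousLinearMap
    fun j => (ContinuousLinearMap.proj (l.get j) : (σ → ℝ) →L[ℝ] ℝ), ?_, fun _ x => ?_⟩
  · refine (ContinuousMultilinearMap.norm_compContinuousLinearMap_le _ _).trans ?_
    rw [ContinuousMultilinearMap.norm_mkPiAlgebraFin, one_mul]
    refine Finset.prod_le_one (fun _ _ => norm_nonneg _) fun j _ => ?_
    refine ContinuousLinearMap.opNorm_le_bound _ zero_le_one fun y => ?_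
    rw [one_mul]
    exact norm_le_pi_norm y _
  · rw [ContinuousMultilinearMap.compContinuousLinearMap_apply,
      ContinuousMultilinearMap.mkPiAlgebraFin_apply, ← hl x]
    congr 1
    refine List.ext_getElem (by simp) fun i h1 h2 => by simp

theorem Conv.analyticAt {F : MvPowerSeries σ ℝ} (hF : Conv F) : AnalyticAt ℝ (sumFn F) 0 := by
  choose M hM hMx using exists_multilinear_mono (σ := σ)
  have hF' := hF
  obtain ⟨C, hC, h⟩ := hF'
  obtain ⟨ε, hε, hs⟩ := Metric.eventually_nhds_iff_ball.1 hF.eventually_summable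
  let p : FormalMultilinearSeries ℝ (σ → ℝ) ℝ := fun k =>
    ∑ α ∈ (Finset.univ : Finset σ).finsuppAntidiag k, coeff α F • M k α
  have hr : 0 < 1 / (2 * C) := by positivity
  have hrad : ENNReal.ofReal (1 / (2 * C)) ≤ p.radius := by
    refine p.le_radius_of_bound (C * 2 ^ Fintype.card σ) fun k => ?_
    rw [Real.coe_toNNReal _ hr.le]
    calc ‖p k‖ * (1 / (2 * C)) ^ k
        ≤ (∑ α ∈ (Finset.univ : Finset σ).finsuppAntidiag k, C ^ (k + 1)) *
            (1 / (2 * C)) ^ k := by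
          refine mul_le_mul_of_nonneg_right ((norm_sum_le _ _).trans
            (Finset.sum_le_sum fun α hα => ?_)) (by positivity)
          rw [norm_smul]
          have h1 := h α
          rw [mem_finsuppAntidiag_univ.1 hα] at h1
          exact (mul_le_mul h1 (hM k α) (norm_nonneg _) (by positivity)).trans (by rw [mul_one])
      _ = C * ∑ α ∈ (Finset.univ : Finset σ).finsuppAntidiag k, (1 / 2 : ℝ) ^ α.degree := by
          rw [Finset.sum_mul, Finset.mul_sum]
          refine Finset.sum_congr rfl fun α hα => ?_
          rw [mem_finsuppAntidiag_univ.1 hα, pow_succ, mul_right_comm, ← mul_pow]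
          rw [mul_comm]
          congr 2
          field_simp
      _ ≤ _ := mul_le_mul_of_nonneg_left (sum_half_pow_degree_le _) (by positivity)
  refine HasFPowerSeriesOnBall.analyticAt (p := p)
    (r := min (ENNReal.ofReal (1 / (2 * C))) (ENNReal.ofReal ε))
    ⟨(min_le_left _ _).trans hrad, lt_min (ENNReal.ofReal_pos.2 hr) (ENNReal.ofReal_pos.2 hε),
      fun {y} hy => ?_⟩
  have hy' : y ∈ Metric.ball (0 : σ → ℝ) ε := by
    rw [← Metric.eball_ofReal]
    exact Metric.eball_subset_eball (min_le_right _ _) hy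
  rw [zero_add]
  have h2 : ∀ k, p k (fun _ => y) =
      ∑ α ∈ (Finset.univ : Finset σ).finsuppAntidiag k, coeff α F * mono α y := fun k => by
    rw [_root_.sum_apply]
    refine Finset.sum_congr rfl fun α hα => ?_
    rw [_root_.smul_apply, hMx k α (mem_finsuppAntidiag_univ.1 hα), smul_eq_mul]
  simp only [h2]
  exact hasSum_homogeneous (hs y hy')

theorem exists_conv_of_analyticAt {g : (σ → ℝ) → ℝ} (hg : AnalyticAt ℝ g 0) :
    ∃ F : MvPowerSeries σ ℝ, Conv F ∧ g =ᶠ[𝓝 0] sumFn F := by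
  obtain ⟨p, r, hp⟩ := hg
  obtain ⟨A, b, hA, hb, hbd⟩ := p.le_mul_pow_of_radius_pos (hp.r_pos.trans_le hp.r_le)
  let cnt : (k : ℕ) → (Fin k → σ) → (σ →₀ ℕ) := fun k j => ∑ l, Finsupp.single (j l) 1
  have hcnt : ∀ k j, (cnt k j).degree = k := fun k j => by
    simp only [cnt, map_sum, Finsupp.degree_single]
    simp
  have hmono : ∀ k j x, mono (cnt k j) x = ∏ l, x (j l) := fun k j x => by
    have h1 : ∀ s : Finset (Fin k),
        mono (∑ l ∈ s, Finsupp.single (j l) 1) x = ∏ l ∈ s, x (j l) := fun s => by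
      induction s using Finset.induction_on with
      | empty => simp [mono_zero]
      | insert a s ha ih =>
        rw [Finset.sum_insert ha, Finset.prod_insert ha, mono_add, ih]
        congr 1
        rw [mono, Finset.prod_eq_single (j a)]
        · simp
        · intro i _ hi
          simp [hi.symm]
        · simp
    exact h1 _
  let c : ℕ → (σ →₀ ℕ) → ℝ := fun k α =>
    ∑ j with cnt k j = α, p k fun l => Pi.single (j l) 1
  let F : MvPowerSeries σ ℝ := fun α => c α.degree α
  have hF : ∀ α, coeff α F = c α.degree α := fun _ => rfl
  have hconv : Conv F := by
    refine ⟨max 1 (max A (Fintype.card σ * b)), le_max_left _ _, fun α => ?_⟩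
    rw [hF]
    set k := α.degree
    calc ‖c k α‖ ≤ ∑ j : Fin k → σ, A * b ^ k := by
          refine (norm_sum_le _ _).trans ((Finset.sum_le_sum fun j _ => ?_).trans
            (Finset.sum_le_sum_of_subset_of_nonneg (Finset.filter_subset _ _)
              fun _ _ _ => by positivity))
          refine ((p k).le_opNorm _).trans ?_
          have : ∏ l, ‖(Pi.single (j l) 1 : σ → ℝ)‖ ≤ 1 := by
            refine Finset.prod_le_one (fun _ _ => norm_nonneg _) fun l _ => ?_
            rw [Pi.norm_single, norm_one]
          exact (mul_le_mul (hbd k) this (Finset.prod_nonneg fun _ _ => norm_nonneg _)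
            (by positivity)).trans (by rw [mul_one])
      _ = A * (Fintype.card σ * b) ^ k := by
          rw [Finset.sum_const, Finset.card_univ, Fintype.card_fun, Fintype.card_fin, nsmul_eq_mul,
            Nat.cast_pow, mul_pow]
          ring
      _ ≤ _ := by
          rw [pow_succ']
          refine mul_le_mul ((le_max_left _ _).trans (le_max_right _ _))
            (pow_le_pow_left₀ (by positivity) ((le_max_right _ _).trans (le_max_right _ _)) _)
            (by positivity) (by positivity)
  have hk : ∀ k x, p k (fun _ => x) =
      ∑ α ∈ (Finset.univ : Finset σ).finsuppAntidiag k, coeff α F * mono α x := fun k x => by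
    have hx : x = ∑ i, x i • (Pi.single i 1 : σ → ℝ) := by
      simpa using (pi_eq_sum_univ' x)
    have h1 : p k (fun _ => x) = ∑ j : Fin k → σ,
        mono (cnt k j) x * p k fun l => Pi.single (j l) 1 := by
      conv_lhs => rw [hx]
      rw [(p k).map_sum]
      refine Finset.sum_congr rfl fun j _ => ?_
      rw [(p k).map_smul_univ (fun l => x (j l)) fun l => Pi.single (j l) 1, hmono, smul_eq_mul]
    rw [h1, ← Finset.sum_fiberwise_of_maps_to (g := cnt k)
      (t := (Finset.univ : Finset σ).finsuppAntidiag k)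
      fun j _ => mem_finsuppAntidiag_univ.2 (hcnt k j)]
    refine Finset.sum_congr rfl fun α hα => ?_
    rw [hF, mem_finsuppAntidiag_univ.1 hα, Finset.sum_mul]
    refine Finset.sum_congr rfl fun j hj => ?_
    rw [(Finset.mem_filter.1 hj).2, mul_comm]
  refine ⟨F, hconv, ?_⟩
  filter_upwards [hconv.eventually_summable, Metric.eball_mem_nhds (0 : σ → ℝ) hp.r_pos]
    with x hx hxr
  have h1 := hp.hasSum hxr
  simp only [hk, zero_add] at h1
  exact h1.unique (hasSum_homogeneous hx)

end Analytic

theorem exists_det_ne_zero_of_linearIndependent {K ι σ : Type*} [Field K] [Fintype ι]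
    [DecidableEq ι] [Fintype σ] {v : ι → σ → K} (hv : LinearIndependent K v) :
    ∃ s : ι → σ, (Matrix.of fun i j => v i (s j)).det ≠ 0 := by
  classical
  let A : Matrix ι σ K := Matrix.of v
  have hrank : A.rank = Fintype.card ι := LinearIndependent.rank_matrix (M := A) hv
  obtain ⟨κ, a, ha, hspan, hli⟩ := exists_linearIndependent' K A.col
  have : Finite κ := Finite.of_injective a ha
  have := Fintype.ofFinite κ
  have hcard : Fintype.card κ = Fintype.card ι := by
    rw [← hrank, Matrix.rank_eq_finrank_span_cols, ← hspan, finrank_span_eq_card hli]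
  let e := Fintype.equivOfCardEq hcard
  refine ⟨fun j => a (e.symm j), ?_⟩
  have h1 : LinearIndependent K (Matrix.of fun i j => v i (a (e.symm j))).col :=
    hli.comp _ e.symm.injective
  have h2 := Matrix.linearIndependent_cols_iff_isUnit.1 h1
  rw [Matrix.isUnit_iff_isUnit_det] at h2
  exact h2.ne_zero

section Repr

variable {σ : Type*} [Fintype σ] [DecidableEq σ]

theorem fderiv_eq_sum_pd (g : (σ → ℝ) → ℝ) (x v : σ → ℝ) :
    fderiv ℝ g x v = ∑ b, v b * pd b g x := by
  conv_lhs => rw [pi_eq_sum_univ' v]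
  simp only [map_sum, map_smul, smul_eq_mul]
  rfl

/-- The function `g` is represented near the origin by the convergent power series `F`. -/
def Represents (g : (σ → ℝ) → ℝ) (F : MvPowerSeries σ ℝ) : Prop :=
  Conv F ∧ g =ᶠ[𝓝 0] sumFn F

namespace Represents

variable {g h : (σ → ℝ) → ℝ} {F G : MvPowerSeries σ ℝ}

theorem congr (hg : Represents g F) (e : h =ᶠ[𝓝 0] g) : Represents h F := ⟨hg.1, e.trans hg.2⟩

theorem eq (hg : Represents g F) (hg' : Represents h F) : g =ᶠ[𝓝 0] h := hg.2.trans hg'.2.symm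

theorem analyticAt (hg : Represents g F) : AnalyticAt ℝ g 0 := hg.1.analyticAt.congr hg.2.symm

theorem add (hg : Represents g F) (hh : Represents h G) :
    Represents (fun x => g x + h x) (F + G) :=
  ⟨hg.1.add hh.1, by
    filter_upwards [hg.2, hh.2, sumFn_add hg.1 hh.1] with x h1 h2 h3
    rw [h1, h2, h3]⟩

theorem mul (hg : Represents g F) (hh : Represents h G) :
    Represents (fun x => g x * h x) (F * G) :=
  ⟨hg.1.mul hh.1, by
    filter_upwards [hg.2, hh.2, sumFn_mul hg.1 hh.1] with x h1 h2 h3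
    rw [h1, h2, h3]⟩

theorem const (a : ℝ) : Represents (fun _ : σ → ℝ => a) (C a) :=
  ⟨conv_C a, .of_forall fun x => (sumFn_C a x).symm⟩

theorem sum {ι : Type*} (s : Finset ι) {g : ι → (σ → ℝ) → ℝ} {F : ι → MvPowerSeries σ ℝ}
    (h : ∀ i ∈ s, Represents (g i) (F i)) :
    Represents (fun x => ∑ i ∈ s, g i x) (∑ i ∈ s, F i) := by
  classical
  induction s using Finset.induction_on with
  | empty => simpa using const (σ := σ) 0
  | insert a s ha ih =>
    simp only [Finset.sum_insert ha]
    exact (h a (Finset.mem_insert_self a s)).add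
      (ih fun i hi => h i (Finset.mem_insert_of_mem hi))

theorem prod {ι : Type*} (s : Finset ι) {g : ι → (σ → ℝ) → ℝ} {F : ι → MvPowerSeries σ ℝ}
    (h : ∀ i ∈ s, Represents (g i) (F i)) :
    Represents (fun x => ∏ i ∈ s, g i x) (∏ i ∈ s, F i) := by
  classical
  induction s using Finset.induction_on with
  | empty => simpa using const (σ := σ) 1
  | insert a s ha ih =>
    simp only [Finset.prod_insert ha]
    exact (h a (Finset.mem_insert_self a s)).mul
      (ih fun i hi => h i (Finset.mem_insert_of_mem hi))

theorem pd (hg : Represents g F) (i : σ) :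
    Represents (PoincareDulac.pd i g) (MvPowerSeries.pderiv ℝ i F) := by
  refine ⟨hg.1.pderiv_real i, Filter.EventuallyEq.trans ?_ (pd_sumFn hg.1 i)⟩
  filter_upwards [hg.2.fderiv (𝕜 := ℝ)] with x hx
  rw [PoincareDulac.pd, hx]
  rfl

theorem fderiv_apply {v : σ → (σ → ℝ) → ℝ} {V : σ → MvPowerSeries σ ℝ} (hg : Represents g F)
    (hv : ∀ b, Represents (v b) (V b)) :
    Represents (fun x => fderiv ℝ g x fun b => v b x) (fieldDer V F) := by
  simp only [fderiv_eq_sum_pd, fieldDer_apply]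
  exact sum _ fun b _ => (hv b).mul (hg.pd b)

theorem at_zero (hg : Represents g F) : g 0 = constantCoeff F := by
  rw [hg.2.self_of_nhds, sumFn_at_zero]

theorem unique (hF : Represents g F) (hG : Represents g G) : F = G := by
  have h1 : Represents (fun _ : σ → ℝ => (0 : ℝ)) (F + C (-1) * G) :=
    (hF.add ((const (-1)).mul hG)).congr (.of_forall fun x => by simp)
  have h2 := eq_zero_of_sumFn h1.1 h1.2.symm
  rw [map_neg, map_one, neg_one_mul, ← sub_eq_add_neg, sub_eq_zero] at h2
  exact h2

theorem eventually_eq_zero (hg : Represents g 0) : g =ᶠ[𝓝 0] 0 := by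
  have := hg.2
  rwa [sumFn_zero] at this

variable {ι : Type*} [Fintype ι] [DecidableEq ι] {M : (σ → ℝ) → Matrix ι ι ℝ}
  {A : Matrix ι ι (MvPowerSeries σ ℝ)}

theorem det (h : ∀ i j, Represents (fun x => M x i j) (A i j)) :
    Represents (fun x => (M x).det) A.det := by
  simp only [Matrix.det_apply']
  refine sum _ fun τ _ => mul ?_ (prod _ fun i _ => h _ _)
  have := const (σ := σ) ((Equiv.Perm.sign τ : ℤ) : ℝ)
  rwa [map_intCast] at this

theorem adjugate (h : ∀ i j, Represents (fun x => M x i j) (A i j)) (i j : ι) :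
    Represents (fun x => (M x).adjugate i j) (A.adjugate i j) := by
  simp only [Matrix.adjugate_apply]
  refine det fun a b => ?_
  simp only [Matrix.updateRow_apply, Pi.single_apply]
  split_ifs
  · simpa using const (σ := σ) 1
  · simpa using const (σ := σ) 0
  · exact h a b

theorem mulVec {v : (σ → ℝ) → ι → ℝ} {V : ι → MvPowerSeries σ ℝ}
    (h : ∀ i j, Represents (fun x => M x i j) (A i j)) (hv : ∀ i, Represents (fun x => v x i) (V i))
    (i : ι) : Represents (fun x => (M x).mulVec (v x) i) (A.mulVec V i) := by
  simp only [Matrix.mulVec, dotProduct]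
  exact sum _ fun j _ => (h i j).mul (hv j)

end Represents

theorem exists_represents {g : (σ → ℝ) → ℝ} (hg : AnalyticAt ℝ g 0) : ∃ F, Represents g F :=
  exists_conv_of_analyticAt hg

theorem mem_lowIdeal_two {g : MvPowerSeries σ ℝ} (h0 : constantCoeff g = 0)
    (h1 : ∀ i, constantCoeff (pderiv ℝ i g) = 0) : g ∈ lowIdeal σ ℝ 2 := by
  rw [mem_lowIdeal]
  intro α hα
  by_cases h : α = 0
  · rw [h, coeff_zero_eq_constantCoeff_apply, h0]
  · obtain ⟨i, hi⟩ := Finsupp.ne_iff.1 h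
    have h2 : α - Finsupp.single i 1 + Finsupp.single i 1 = α :=
      tsub_add_cancel_of_le (Finsupp.single_le_iff.2 (Nat.one_le_iff_ne_zero.2 hi))
    have h3 : α - Finsupp.single i 1 = 0 := by
      have := congrArg Finsupp.degree h2
      rw [map_add, Finsupp.degree_single] at this
      exact (Finsupp.degree_eq_zero_iff _).1 (by omega)
    have h4 := h1 i
    rw [← coeff_zero_eq_constantCoeff_apply, coeff_pderiv, ← h3, h2] at h4
    refine (mul_eq_zero.1 h4).resolve_right ?_
    positivity

theorem constantCoeff_pderiv_of_mem {g : MvPowerSeries σ ℝ} (h : g ∈ lowIdeal σ ℝ 2) (i : σ) :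
    constantCoeff (pderiv ℝ i g) = 0 :=
  mem_lowIdeal_one.1 (pderiv_mem_lowIdeal i h)

end Repr

section Assembly

variable {κ ι σ : Type*} [Fintype κ] [DecidableEq κ] [Fintype ι] [DecidableEq ι] [Fintype σ]
  [DecidableEq σ]

theorem fderiv_apply_component {Z : (σ → ℝ) → σ → ℝ} {x : σ → ℝ} (hZ : DifferentiableAt ℝ Z x)
    (v : σ → ℝ) (a : σ) : fderiv ℝ Z x v a = fderiv ℝ (fun y => Z y a) x v := by
  rw [fderiv_apply hZ]
  rfl

theorem pderiv_lform (v : σ → ℝ) (b : σ) :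
    pderiv ℝ b (lform v) = C (v b) := by
  rw [lform, map_sum, Finset.sum_eq_single b]
  · rw [Derivation.map_smul, pderiv_X, Pi.single_eq_same, smul_eq_C_mul, mul_one]
  · intro a _ ha
    rw [Derivation.map_smul, pderiv_X, Pi.single_eq_of_ne ha, smul_zero]
  · simp

theorem constantCoeff_lform (v : σ → ℝ) : constantCoeff (lform v) = 0 := by
  rw [lform, map_sum]
  refine Finset.sum_eq_zero fun a _ => ?_
  rw [smul_eq_C_mul, map_mul, constantCoeff_X, mul_zero]

theorem exists_analytic_eigencoords {X : ι → (σ → ℝ) → σ → ℝ} {f : κ → (σ → ℝ) → ℝ}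
    (hX : ∀ i, AnalyticAt ℝ (X i) 0) (hf : ∀ k, AnalyticAt ℝ (f k) 0)
    (hcomm : ∀ i j, ∀ᶠ x in 𝓝 0, VectorField.lieBracket ℝ (X i) (X j) x = 0)
    (hfirst : ∀ i k, ∀ᶠ x in 𝓝 0, fderiv ℝ (f k) x (X i x) = 0)
    (t : κ → σ) (ht : ¬ (fun x => (Matrix.of fun k k' => pd (t k') (f k) x).det) =ᶠ[𝓝 0] 0)
    (s : ι → σ) (hs : ¬ (fun x => (Matrix.of fun i j => X i x (s j)).det) =ᶠ[𝓝 0] 0)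
    (hcard : Fintype.card σ = Fintype.card (κ ⊕ ι)) (i₀ : ι) (h0 : X i₀ 0 = 0)
    {S N : (σ → ℝ) →L[ℝ] (σ → ℝ)} (hL : fderiv ℝ (X i₀) 0 = S + N) (hSN : S ∘L N = N ∘L S)
    (hN : IsNilpotent (N : Module.End ℝ (σ → ℝ)))
    (hS : Module.End.IsSemisimple (S : Module.End ℝ (σ → ℝ))) :
    ∃ G : (σ → ℝ) → σ → ℝ, AnalyticAt ℝ G 0 ∧ G 0 = 0 ∧
      fderiv ℝ G 0 = ContinuousLinearMap.id ℝ (σ → ℝ) ∧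
      fderiv ℝ (fun x => fderiv ℝ G x (X i₀ x)) 0 = fderiv ℝ (X i₀) 0 ∧
      ∀ᶠ x in 𝓝 0, ∀ w, fderiv ℝ G x w = S (G x) →
        fderiv ℝ (fun x => fderiv ℝ G x (X i₀ x)) x w = S (fderiv ℝ G x (X i₀ x)) := by
  have hXa : ∀ i a, AnalyticAt ℝ (fun x => X i x a) 0 := fun i =>
    analyticAt_pi_iff.1 (hX i)
  choose F hF using fun i a => exists_represents (hXa i a)
  choose g hg using fun k => exists_represents (hf k)
  have hFf : ∀ i k, fieldDer (F i) (g k) = 0 := fun i k => by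
    refine ((hg k).fderiv_apply (hF i)).unique
      (((Represents.const 0).congr (hfirst i k)).congr .rfl) |>.trans (map_zero C)
  have hFF : ∀ i j a, fieldDer (F i) (F j a) = fieldDer (F j) (F i a) := fun i j a => by
    refine ((hF j a).fderiv_apply (hF i)).unique (((hF i a).fderiv_apply (hF j)).congr ?_)
    filter_upwards [hcomm i j, (hX i).eventually_analyticAt, (hX j).eventually_analyticAt]
      with x h1 h2 h3
    have h4 := congrFun h1 a
    rw [VectorField.lieBracket_eq] at h4
    simp only [Pi.sub_apply, Pi.zero_apply, sub_eq_zero] at h4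
    rwa [fderiv_apply_component h2.differentiableAt,
      fderiv_apply_component h3.differentiableAt] at h4
  let S' : Matrix σ σ ℝ := LinearMap.toMatrix' (S : (σ → ℝ) →ₗ[ℝ] (σ → ℝ))
  let N' : Matrix σ σ ℝ := LinearMap.toMatrix' (N : (σ → ℝ) →ₗ[ℝ] (σ → ℝ))
  have hSv : ∀ v, S v = S'.mulVec v := fun v => by
    rw [← Matrix.toLin'_apply, Matrix.toLin'_toMatrix']
    rfl
  have hLa : ∀ a b, pd b (fun x => X i₀ x a) 0 = (S' + N') a b := fun a b => by
    rw [pd, ← fderiv_apply_component (hX i₀).differentiableAt, hL, Matrix.add_apply]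
    simp only [S', N', LinearMap.toMatrix'_apply]
    rfl
  have hF2 : ∀ a, F i₀ a - lform ((S' + N') a) ∈ lowIdeal σ ℝ 2 := fun a => by
    refine mem_lowIdeal_two ?_ fun b => ?_
    · rw [map_sub, constantCoeff_lform, ← (hF i₀ a).at_zero, h0]
      simp
    · rw [map_sub, pderiv_lform, map_sub, ← ((hF i₀ a).pd b).at_zero, hLa, constantCoeff_C,
        sub_self]
  have ht' : (Matrix.of fun k k' => pderiv ℝ (t k') (g k)).det ≠ 0 := fun h => ht <| by
    have := Represents.det (M := fun x => Matrix.of fun k k' => pd (t k') (f k) x)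
      (A := Matrix.of fun k k' => pderiv ℝ (t k') (g k)) fun k k' => (hg k).pd (t k')
    rw [h] at this
    exact this.eventually_eq_zero
  have hs' : (Matrix.of fun i j => F i (s j)).det ≠ 0 := fun h => hs <| by
    have := Represents.det (M := fun x => Matrix.of fun i j => X i x (s j))
      (A := Matrix.of fun i j => F i (s j)) fun i j => hF i (s j)
    rw [h] at this
    exact this.eventually_eq_zero
  have hS' : Matrix.toLin' S' = (S : (σ → ℝ) →ₗ[ℝ] (σ → ℝ)) := Matrix.toLin'_toMatrix' _
  obtain ⟨Γ, hΓc, hΓ2, hΓ⟩ := exists_real_eigencoords g F hFf hFF (fun k => (hg k).1)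
    (fun i a => (hF i a).1) t ht' s hs' hcard i₀ (L := S' + N') (S := S') (N := N') hF2 rfl
    (by
      simp only [S', N']
      rw [← LinearMap.toMatrix'_comp, ← LinearMap.toMatrix'_comp]
      exact congrArg LinearMap.toMatrix' (congrArg ContinuousLinearMap.toLinearMap hSN))
    (by
      obtain ⟨d, hd⟩ := hN
      refine ⟨d, ?_⟩
      have := congrArg LinearMap.toMatrixAlgEquiv' hd
      rw [map_pow, map_zero] at this
      exact this)
    (by rw [hS']; exact hS)
  let G : (σ → ℝ) → σ → ℝ := fun x a => sumFn (Γ a) x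
  have hG : ∀ a, Represents (fun x => G x a) (Γ a) := fun a => ⟨hΓc a, .rfl⟩
  have hGan : AnalyticAt ℝ G 0 := analyticAt_pi_iff.2 fun a => (hG a).analyticAt
  let Z : (σ → ℝ) → σ → ℝ := fun x => fderiv ℝ G x (X i₀ x)
  have hZ : ∀ a, Represents (fun x => Z x a) (fieldDer (F i₀) (Γ a)) := fun a => by
    refine ((hG a).fderiv_apply (hF i₀)).congr ?_
    filter_upwards [hGan.eventually_analyticAt] with x hx
    exact fderiv_apply_component hx.differentiableAt _ _
  have hZan : AnalyticAt ℝ Z 0 := analyticAt_pi_iff.2 fun a => (hZ a).analyticAt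
  have hpdG : ∀ a b, pd b (fun x => G x a) 0 = (1 : Matrix σ σ ℝ) a b := fun a b => by
    have h1 := constantCoeff_pderiv_of_mem (hΓ2 a) b
    rw [map_sub, map_sub, pderiv_X, sub_eq_zero] at h1
    rw [((hG a).pd b).at_zero, h1, Matrix.one_apply, Pi.single_apply]
    split_ifs <;> simp_all
  have hpdZ : ∀ a b, pd b (fun x => Z x a) 0 = pd b (fun x => X i₀ x a) 0 := fun a b => by
    rw [((hZ a).pd b).at_zero, ((hF i₀ a).pd b).at_zero, ← sub_eq_zero, ← map_sub, ← map_sub]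
    refine constantCoeff_pderiv_of_mem ?_ b
    have h1 : fieldDer (F i₀) (Γ a) - F i₀ a = fieldDer (F i₀) (Γ a - MvPowerSeries.X a) := by
      rw [map_sub, fieldDer_X]
    rw [h1, fieldDer_apply]
    refine Ideal.sum_mem _ fun b _ => mul_mem_lowIdeal (d := 1) (e := 1) ?_
      (pderiv_mem_lowIdeal b (hΓ2 a))
    rw [mem_lowIdeal_one, ← (hF i₀ b).at_zero, h0]
    rfl
  refine ⟨G, hGan, ?_, ?_, ?_, ?_⟩
  · ext a
    have h1 := mem_lowIdeal_one.1 (lowIdeal_mono one_le_two (hΓ2 a))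
    rw [map_sub, constantCoeff_X, sub_zero] at h1
    rw [(hG a).at_zero, h1]
    rfl
  · refine ContinuousLinearMap.ext fun v => funext fun a => ?_
    rw [fderiv_apply_component hGan.differentiableAt, fderiv_eq_sum_pd]
    simp [hpdG, Matrix.one_apply]
  · refine ContinuousLinearMap.ext fun v => funext fun a => ?_
    rw [fderiv_apply_component hZan.differentiableAt,
      fderiv_apply_component (hX i₀).differentiableAt, fderiv_eq_sum_pd, fderiv_eq_sum_pd]
    simp only [hpdZ]
  · let J : (σ → ℝ) → Matrix σ σ ℝ := fun x => Matrix.of fun a b => pd b (fun y => G y a) x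
    let JZ : (σ → ℝ) → Matrix σ σ ℝ := fun x => Matrix.of fun a b => pd b (fun y => Z y a) x
    have hJ : ∀ a b, Represents (fun x => J x a b) (jacS Γ a b) := fun a b => (hG a).pd b
    have hJZ : ∀ a b, Represents (fun x => JZ x a b)
      (jacS (fun a => fieldDer (F i₀) (Γ a)) a b) := fun a b => (hZ a).pd b
    have hSc : ∀ a b, Represents (fun _ : σ → ℝ => S' a b) ((S'.map C) a b) := fun a b =>
      Represents.const _
    have hl : ∀ a, Represents
        (fun x => (JZ x).mulVec ((J x).adjugate.mulVec (S'.mulVec (G x))) a) _ := fun a =>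
      Represents.mulVec hJZ (Represents.mulVec (Represents.adjugate hJ)
        (Represents.mulVec (M := fun _ => S') hSc hG)) a
    have hr : ∀ a, Represents (fun x => (J x).det * S'.mulVec (Z x) a) _ := fun a =>
      (Represents.det hJ).mul (Represents.mulVec (M := fun _ => S') hSc hZ a)
    have heq : ∀ᶠ x in 𝓝 0, ∀ a, (JZ x).mulVec ((J x).adjugate.mulVec (S'.mulVec (G x))) a =
        (J x).det * S'.mulVec (Z x) a := by
      refine Filter.eventually_all.2 fun a => (hl a).eq ?_
      rw [congrFun hΓ a]
      exact hr a
    have hdet : ∀ᶠ x in 𝓝 0, (J x).det ≠ 0 := by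
      have h1 : (J 0).det = 1 := by
        rw [show J 0 = 1 from Matrix.ext fun a b => hpdG a b, Matrix.det_one]
      refine (Represents.det hJ).analyticAt.continuousAt.eventually_ne ?_
      rw [h1]
      exact one_ne_zero
    filter_upwards [heq, hdet, hGan.eventually_analyticAt, hZan.eventually_analyticAt]
      with x h1 h2 h3 h4 w hw
    have hJw : ∀ v, fderiv ℝ G x v = (J x).mulVec v := fun v => funext fun a => by
      rw [fderiv_apply_component h3.differentiableAt, fderiv_eq_sum_pd]
      simp [Matrix.mulVec, dotProduct, J, mul_comm]
    have hJZw : ∀ v, fderiv ℝ Z x v = (JZ x).mulVec v := fun v => funext fun a => by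
      rw [fderiv_apply_component h4.differentiableAt, fderiv_eq_sum_pd]
      simp [Matrix.mulVec, dotProduct, JZ, mul_comm]
    change fderiv ℝ Z x w = S (Z x)
    rw [hJZw, hSv]
    refine funext fun a => mul_left_cancel₀ h2 ?_
    rw [← h1 a, ← hSv, ← hw, hJw, Matrix.mulVec_mulVec w, Matrix.adjugate_mul,
      Matrix.smul_mulVec, Matrix.one_mulVec, Matrix.mulVec_smul]
    rfl

end Assembly

theorem admitsPDNormalization_of_linearizing {n : ℕ} {X G : (Fin n → ℝ) → Fin n → ℝ}
    {S N : (Fin n → ℝ) →L[ℝ] (Fin n → ℝ)} (hX : AnalyticAt ℝ X 0) (h0 : X 0 = 0)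
    (hL : fderiv ℝ X 0 = S + N) (hSN : S ∘L N = N ∘L S)
    (hN : IsNilpotent (N : Module.End ℝ (Fin n → ℝ)))
    (hS : Module.End.IsSemisimple (S : Module.End ℝ (Fin n → ℝ)))
    (hG : AnalyticAt ℝ G 0) (hG0 : G 0 = 0)
    (hG1 : fderiv ℝ G 0 = ContinuousLinearMap.id ℝ (Fin n → ℝ))
    (hZ1 : fderiv ℝ (fun x => fderiv ℝ G x (X x)) 0 = fderiv ℝ X 0)
    (hGS : ∀ᶠ x in 𝓝 0, ∀ w, fderiv ℝ G x w = S (G x) →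
      fderiv ℝ (fun x => fderiv ℝ G x (X x)) x w = S (fderiv ℝ G x (X x))) :
    AdmitsPDNormalization ℝ X := by
  set Z : (Fin n → ℝ) → Fin n → ℝ := fun x => fderiv ℝ G x (X x)
  have hZ : AnalyticAt ℝ Z 0 :=
    (ContinuousLinearMap.analyticAt_bilinear (ContinuousLinearMap.id ℝ
      ((Fin n → ℝ) →L[ℝ] (Fin n → ℝ))) _).comp (hG.fderiv.prod hX)
  have hstrict : HasStrictFDerivAt G
      ((ContinuousLinearEquiv.refl ℝ (Fin n → ℝ) : (Fin n → ℝ) ≃L[ℝ] (Fin n → ℝ)) :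
        (Fin n → ℝ) →L[ℝ] (Fin n → ℝ)) 0 := by
    have := hG.hasStrictFDerivAt
    rwa [hG1] at this
  let e := hstrict.toOpenPartialHomeomorph G
  have h0e : (0 : Fin n → ℝ) ∈ e.source := hstrict.mem_toOpenPartialHomeomorph_source
  have he : ∀ x, e x = G x := fun _ => rfl
  let φ : (Fin n → ℝ) → Fin n → ℝ := e.symm
  have hφ0 : φ 0 = 0 := by
    have := e.left_inv h0e
    rwa [he, hG0] at this
  have hφan : AnalyticAt ℝ φ 0 := by
    have := e.analyticAt_symm' (i := ContinuousLinearEquiv.refl ℝ (Fin n → ℝ)) h0e hG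
      hstrict.hasFDerivAt.fderiv
    rwa [he, hG0] at this
  have htend : Filter.Tendsto φ (𝓝 0) (𝓝 0) := by
    have := hφan.continuousAt.tendsto
    rwa [hφ0] at this
  have hGφ : ∀ᶠ y in 𝓝 0, G (φ y) = y := by
    have : e.target ∈ 𝓝 (0 : Fin n → ℝ) := by
      refine e.open_target.mem_nhds ?_
      have := e.map_source h0e
      rwa [he, hG0] at this
    filter_upwards [this] with y hy using e.right_inv hy
  have hφG : ∀ᶠ x in 𝓝 0, φ (G x) = x := by
    filter_upwards [e.open_source.mem_nhds h0e] with x hx using e.left_inv hx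
  have hgood : ∀ᶠ y in 𝓝 0, G (φ y) = y ∧ AnalyticAt ℝ φ y ∧ AnalyticAt ℝ Z (φ y) ∧
      (∀ v, fderiv ℝ G (φ y) (fderiv ℝ φ y v) = v) ∧
      (∀ v, fderiv ℝ φ y (fderiv ℝ G (φ y) v) = v) ∧
      ∀ w, fderiv ℝ G (φ y) w = S (G (φ y)) → fderiv ℝ Z (φ y) w = S (Z (φ y)) := by
    filter_upwards [hGφ, hφan.eventually_analyticAt, htend.eventually hZ.eventually_analyticAt,
      htend.eventually hG.eventually_analyticAt, hGφ.eventually_nhds,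
      htend.eventually hφG.eventually_nhds, htend.eventually hGS] with y h1 h2 h3 h4 h5 h6 h7
    refine ⟨h1, h2, h3, fun v => ?_, fun v => ?_, h7⟩
    · have hc : HasFDerivAt (fun y => G (φ y)) ((fderiv ℝ G (φ y)).comp (fderiv ℝ φ y)) y :=
        h4.differentiableAt.hasFDerivAt.comp y h2.differentiableAt.hasFDerivAt
      have := hc.unique ((hasFDerivAt_id y).congr_of_eventuallyEq h5)
      exact congrArg (fun A : (Fin n → ℝ) →L[ℝ] (Fin n → ℝ) => A v) this
    · have h2' : DifferentiableAt ℝ φ (G (φ y)) := by rw [h1]; exact h2.differentiableAt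
      have hc : HasFDerivAt (fun x => φ (G x))
          ((fderiv ℝ φ (G (φ y))).comp (fderiv ℝ G (φ y))) (φ y) :=
        h2'.hasFDerivAt.comp (φ y) h4.differentiableAt.hasFDerivAt
      rw [h1] at hc
      have := hc.unique ((hasFDerivAt_id (φ y)).congr_of_eventuallyEq h6)
      exact congrArg (fun A : (Fin n → ℝ) →L[ℝ] (Fin n → ℝ) => A v) this
  obtain ⟨V, hV, hVo, h0V⟩ := eventually_nhds_iff.1 hgood
  have hYd : ∀ y ∈ V, HasFDerivAt (fun y => Z (φ y))
      ((fderiv ℝ Z (φ y)).comp (fderiv ℝ φ y)) y := fun y hy =>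
    (hV y hy).2.2.1.differentiableAt.hasFDerivAt.comp y (hV y hy).2.1.differentiableAt.hasFDerivAt
  have hφ1 : ∀ v, fderiv ℝ φ 0 v = v := fun v => by
    have := (hV 0 h0V).2.2.2.1 v
    rw [hφ0, hG1] at this
    exact this
  refine ⟨V, fun y => Z (φ y), φ, hVo, h0V, fun y hy => (hV y hy).2.2.1.comp (hV y hy).2.1,
    fun y hy => (hV y hy).2.1, ?_, hφ0, ?_, ⟨S, N, ?_, hS, hN, hSN, fun y hy => ?_⟩,
    fun y hy => (hV y hy).2.2.2.2.1 _⟩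
  · simp only [hφ0, Z, h0, map_zero]
  · rw [show ⇑(fderiv ℝ φ 0) = id from funext hφ1]
    exact Function.bijective_id
  · rw [(hYd 0 h0V).fderiv, hφ0, hZ1, hL]
    ext1 v
    rw [ContinuousLinearMap.comp_apply, hφ1]
  · obtain ⟨h1, -, -, h4, -, h6⟩ := hV y hy
    rw [VectorField.lieBracket_eq]
    simp only [(hYd y hy).fderiv, ContinuousLinearMap.comp_apply]
    rw [h6 _ ((h4 _).trans (by rw [h1]))]
    rw [show fderiv ℝ (fun y => S y) y = S from S.fderiv, sub_self]

theorem not_eventuallyEq_zero_of_ne {n : ℕ} {U : Set (Fin n → ℝ)} (hU : IsConnected U)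
    (h0 : (0 : Fin n → ℝ) ∈ U) {g : (Fin n → ℝ) → ℝ} (hg : AnalyticOnNhd ℝ g U)
    {x : Fin n → ℝ} (hx : x ∈ U) (hgx : g x ≠ 0) : ¬ g =ᶠ[𝓝 0] 0 := fun h =>
  hgx (hg.eqOn_of_preconnected_of_eventuallyEq (fun _ _ => analyticAt_const) hU.isPreconnected
    h0 h hx)

theorem analyticAt_pd {σ : Type*} [Fintype σ] [DecidableEq σ] {g : (σ → ℝ) → ℝ} {x : σ → ℝ}
    (hg : AnalyticAt ℝ g x) (i : σ) : AnalyticAt ℝ (pd i g) x :=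
  ((ContinuousLinearMap.apply ℝ ℝ (Pi.single i 1 : σ → ℝ)).analyticAt _).comp hg.fderiv

theorem analyticAt_det {E ι : Type*} [NormedAddCommGroup E] [NormedSpace ℝ E] [Fintype ι]
    [DecidableEq ι] {M : ι → ι → E → ℝ} {x : E} (h : ∀ i j, AnalyticAt ℝ (M i j) x) :
    AnalyticAt ℝ (fun y => (Matrix.of fun i j => M i j y).det) x := by
  simp only [Matrix.det_apply', Matrix.of_apply]
  exact Finset.analyticAt_fun_sum _ fun τ _ =>
    analyticAt_const.mul (Finset.analyticAt_fun_prod _ fun i _ => h _ _)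

end PoincareDulac

/-- **Convergence versus integrability in Poincaré–Dulac normal form** (Zung).
A real analytic vector field on `(ℝⁿ, 0)` which is integrable in the
non-Hamiltonian sense (it belongs to an `m`-tuple of pairwise commuting,
almost-everywhere linearly independent analytic vector fields admitting
`n - m` almost-everywhere functionally independent common analytic first
integrals) admits a convergent Poincaré–Dulac normalization. -/
theorem integrable_admitsPDNormalization_real
    (n m : ℕ) (hn : 1 ≤ n) (hm : 1 ≤ m) (hmn : m ≤ n)
    (U : Set (Fin n → ℝ)) (hUopen : IsOpen U) (hUconn : IsConnected U)
    (h0U : (0 : Fin n → ℝ) ∈ U)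
    (X : Fin m → (Fin n → ℝ) → (Fin n → ℝ))
    (f : Fin (n - m) → (Fin n → ℝ) → ℝ)
    (hXan : ∀ i, AnalyticOnNhd ℝ (X i) U)
    (hfan : ∀ j, AnalyticOnNhd ℝ (f j) U)
    (hX10 : X ⟨0, hm⟩ 0 = 0)
    (hcomm : ∀ i j, ∀ x ∈ U, VectorField.lieBracket ℝ (X i) (X j) x = 0)
    (hfirst : ∀ i j, ∀ x ∈ U, fderiv ℝ (f j) x (X i x) = 0)
    (hXind : ∃ x ∈ U, LinearIndependent ℝ (fun i => X i x))
    (hfind : ∃ x ∈ U, LinearIndependent ℝ (fun j => fderiv ℝ (f j) x)) :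
    AdmitsPDNormalization ℝ (X ⟨0, hm⟩) := by
  have hev : ∀ {p : (Fin n → ℝ) → Prop}, (∀ x ∈ U, p x) → ∀ᶠ x in nhds 0, p x := fun h =>
    Filter.mem_of_superset (hUopen.mem_nhds h0U) h
  obtain ⟨x, hx, hli⟩ := hXind
  obtain ⟨s, hs⟩ := PoincareDulac.exists_det_ne_zero_of_linearIndependent hli
  obtain ⟨y, hy, hlf⟩ := hfind
  have hlf' : LinearIndependent ℝ fun k b => PoincareDulac.pd b (f k) y := by
    let T : ((Fin n → ℝ) →L[ℝ] ℝ) →ₗ[ℝ] (Fin n → ℝ) :=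
      LinearMap.pi fun b => (ContinuousLinearMap.apply ℝ ℝ (Pi.single b 1)).toLinearMap
    refine hlf.map' T (LinearMap.ker_eq_bot'.2 fun A hA => ?_)
    ext v
    rw [pi_eq_sum_univ' v]
    have h1 : ∀ b, A (Pi.single b 1) = 0 := fun b => congrFun hA b
    simp [h1]
  obtain ⟨t, ht⟩ := PoincareDulac.exists_det_ne_zero_of_linearIndependent hlf'
  obtain ⟨N, hNa, S, hSa, hN, hS, hNS⟩ := Module.End.exists_isNilpotent_isSemisimple
    (f := (fderiv ℝ (X ⟨0, hm⟩) 0 : Module.End ℝ (Fin n → ℝ)))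
  have hcom : Commute S N :=
    (Algebra.commute_of_mem_adjoin_singleton_of_commute hSa
      (Algebra.commute_of_mem_adjoin_self hNa).symm).symm
  let S' := LinearMap.toContinuousLinearMap S
  let N' := LinearMap.toContinuousLinearMap N
  have hL : fderiv ℝ (X ⟨0, hm⟩) 0 = S' + N' := by
    ext1 v
    have := congrArg (fun A : Module.End ℝ (Fin n → ℝ) => A v) hNS
    exact this.trans (add_comm _ _)
  have hSN : S' ∘L N' = N' ∘L S' := by
    ext1 v
    exact congrArg (fun A : Module.End ℝ (Fin n → ℝ) => A v) hcom.eq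
  obtain ⟨G, hG, hG0, hG1, hZ1, hGS⟩ := PoincareDulac.exists_analytic_eigencoords (X := X) (f := f)
    (fun i => hXan i 0 h0U) (fun k => hfan k 0 h0U) (fun i j => hev (hcomm i j))
    (fun i k => hev (hfirst i k)) t
    (PoincareDulac.not_eventuallyEq_zero_of_ne hUconn h0U
      (fun z hz => PoincareDulac.analyticAt_det fun k k' =>
        PoincareDulac.analyticAt_pd (hfan k z hz) (t k')) hy ht) s
    (PoincareDulac.not_eventuallyEq_zero_of_ne hUconn h0U
      (fun z hz => PoincareDulac.analyticAt_det fun i j =>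
        (ContinuousLinearMap.proj (R := ℝ) (φ := fun _ : Fin n => ℝ) (s j)).analyticAt _ |>.comp
          (hXan i z hz)) hx hs)
    (by simp; omega) ⟨0, hm⟩ hX10 hL hSN hN hS
  exact PoincareDulac.admitsPDNormalization_of_linearizing (hXan _ 0 h0U) hX10 hL hSN hN hS
    hG hG0 hG1 hZ1 hGS
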